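/- arXiv:math/0608796 — 4 statements merged into one kernel-verified Lean document; each statement's English description precedes it below -/
import Mathlib

section
/- The equation 2^a + 2^b + 1 = x^2 has no solutions in positive integers (a, b, x) with a ≥ b except for the following: (a, b, x) = (2t, t+1, 2^t + 1) for some positive integer t; (a, b, x) = (5, 4, 7); and (a, b, x) = (9, 4, 23). -/
/-- Multiplication by the unit `3 + 2√2`. -/
def pellStep (v : ℕ × ℕ) : ℕ × ℕ := (3 * v.1 + 4 * v.2, 2 * v.1 + 3 * v.2)

def pellStepMod (v : ℕ × ℕ) : ℕ × ℕ :=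
  ((3 * v.1 + 4 * v.2) % 8224, (2 * v.1 + 3 * v.2) % 8224)

lemma pell_descent (D : ℕ) (n : ℕ) : ∀ x y : ℕ, y ≤ n → 0 < y → x ^ 2 = 2 * y ^ 2 + D →
    0 < D →
    ∃ j : ℕ, ∃ v : ℕ × ℕ, 0 < v.2 ∧ v.2 ^ 2 ≤ 4 * D ∧ v.1 ^ 2 = 2 * v.2 ^ 2 + D ∧
      (x, y) = pellStep^[j] v := by
  induction n with
  | zero => intro x y h1 h2; omega
  | succ n ih =>
    intro x y h1 h2 h3 hD
    by_cases hy : y ^ 2 ≤ 4 * D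
    · exact ⟨0, (x, y), h2, hy, h3, rfl⟩
    · have hlt : 2 * x < 3 * y := by
        by_contra h
        have : (3 * y) ^ 2 ≤ (2 * x) ^ 2 := Nat.pow_le_pow_left (by omega) 2
        nlinarith
      have hgt : 4 * y < 3 * x := by
        by_contra h
        have : (3 * x) ^ 2 ≤ (4 * y) ^ 2 := Nat.pow_le_pow_left (by omega) 2
        nlinarith
      have hxy : y < x := by
        by_contra h
        have : x ^ 2 ≤ y ^ 2 := Nat.pow_le_pow_left (by omega) 2
        nlinarith
      obtain ⟨u, hu⟩ := Nat.exists_eq_add_of_lt hgt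
      obtain ⟨t, ht⟩ := Nat.exists_eq_add_of_lt hlt
      have e1 : x = 3 * (u + 1) + 4 * (t + 1) := by omega
      have e2 : y = 2 * (u + 1) + 3 * (t + 1) := by omega
      have h4 : (u + 1) ^ 2 = 2 * (t + 1) ^ 2 + D := by
        rw [e1, e2] at h3; nlinarith
      obtain ⟨j, v, hv1, hv2, hv3, hv4⟩ := ih (u + 1) (t + 1) (by omega) (by omega) h4 hD
      refine ⟨j + 1, v, hv1, hv2, hv3, ?_⟩
      rw [Function.iterate_succ_apply', ← hv4]
      simp [pellStep, e1, e2]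

lemma pell_iter_mod (j : ℕ) (v : ℕ × ℕ) :
    ((pellStep^[j] v).1 % 8224, (pellStep^[j] v).2 % 8224) =
      pellStepMod^[j] (v.1 % 8224, v.2 % 8224) := by
  induction j with
  | zero => rfl
  | succ j ih =>
    rw [Function.iterate_succ_apply', Function.iterate_succ_apply', ← ih]
    simp only [pellStep, pellStepMod, Prod.mk.injEq]
    constructor <;> omega

/-- the check on one residue orbit -/
def orbitOk : ℕ → ℕ × ℕ → Bool
  | 0, _ => true
  | n + 1, v => (v.2 % 32 != 0 || (List.range 16).all fun i => v.2 % 257 != 2 ^ i % 257)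
      && orbitOk n (pellStepMod v)

lemma orbitOk_spec (n : ℕ) : ∀ v, orbitOk n v = true → ∀ j < n,
    (pellStepMod^[j] v).2 % 32 = 0 → ∀ i < 16, (pellStepMod^[j] v).2 % 257 ≠ 2 ^ i % 257 := by
  induction n with
  | zero => intro v _ j hj; omega
  | succ n ih =>
    intro v hv j hj
    simp only [orbitOk, Bool.and_eq_true, Bool.or_eq_true, bne_iff_ne, List.all_eq_true,
      List.mem_range] at hv
    cases j with
    | zero =>
      intro h0 i hi
      rcases hv.1 with h | h
      · exact absurd h0 h
      · exact h i hi
    | succ j =>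
      rw [Function.iterate_succ_apply]
      exact ih _ hv.2 j (by omega)

lemma two_pow_mod_257 (k : ℕ) : 2 ^ k % 257 = 2 ^ (k % 16) % 257 := by
  conv_lhs => rw [← Nat.div_add_mod k 16, pow_add, pow_mul, Nat.mul_mod, Nat.pow_mod]
  norm_num

/-- integer square root by structural recursion on the number of binary digits of the root -/
def rootBits : ℕ → ℕ → ℕ
  | 0, _ => 0
  | k + 1, n => if (2 * rootBits k (n / 4) + 1) * (2 * rootBits k (n / 4) + 1) ≤ n
      then 2 * rootBits k (n / 4) + 1 else 2 * rootBits k (n / 4)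

lemma rootBits_sq (k : ℕ) : ∀ x, x < 2 ^ k → rootBits k (x ^ 2) = x := by
  have gen : ∀ n, n < 4 ^ k → rootBits k n * rootBits k n ≤ n ∧
      n < (rootBits k n + 1) * (rootBits k n + 1) := by
    induction k with
    | zero => intro n hn; simp at hn; subst hn; simp [rootBits]
    | succ k ih =>
      intro n hn
      obtain ⟨h1, h2⟩ := ih (n / 4) (by rw [pow_succ] at hn; omega)
      simp only [rootBits]
      generalize rootBits k (n / 4) = r at *
      have h3 : 4 * (n / 4) ≤ n := Nat.mul_div_le n 4
      have h4 : n < 4 * (n / 4) + 4 := by omega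
      split_ifs with hc
      · exact ⟨hc, by nlinarith⟩
      · exact ⟨by nlinarith, by omega⟩
  intro x hx
  obtain ⟨h1, h2⟩ := gen (x ^ 2) (by
    calc x ^ 2 < (2 ^ k) ^ 2 := Nat.pow_lt_pow_left hx (by norm_num)
      _ = 4 ^ k := by rw [← pow_mul, mul_comm, pow_mul]; norm_num)
  generalize rootBits k (x ^ 2) = r at *
  have : r ≤ x := by nlinarith
  have : x < r + 1 := by nlinarith
  omega

lemma pell_base (D : ℕ) (hD : D = 17 ∨ D = 257 ∨ D = 4097) (x y : ℕ) (hy : 0 < y)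
    (hy2 : y ^ 2 ≤ 4 * D) (h : x ^ 2 = 2 * y ^ 2 + D) :
    (x, y) ∈ [(5, 2), (7, 4), (17, 4), (35, 22), (65, 8), (67, 14), (145, 92), (163, 106)] := by
  have hy3 : y < 129 := by
    by_contra hc
    have : 129 ^ 2 ≤ y ^ 2 := Nat.pow_le_pow_left (by omega) 2
    rcases hD with rfl | rfl | rfl <;> omega
  have hxb : x < 2 ^ 8 := by
    have : y ^ 2 ≤ 128 ^ 2 := Nat.pow_le_pow_left (by omega) 2
    have : D ≤ 4097 := by omega
    nlinarith
  have hx : x = rootBits 8 (2 * y ^ 2 + D) := by rw [← h, rootBits_sq 8 x hxb]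
  have key : ∀ D ∈ [17, 257, 4097], ∀ y < 129, 0 < y → y ^ 2 ≤ 4 * D →
      (rootBits 8 (2 * y ^ 2 + D)) ^ 2 = 2 * y ^ 2 + D →
      (rootBits 8 (2 * y ^ 2 + D), y) ∈
      [(5, 2), (7, 4), (17, 4), (35, 22), (65, 8), (67, 14), (145, 92), (163, 106)] := by
    decide +kernel
  subst hx
  exact key D (by rcases hD with rfl | rfl | rfl <;> simp) y hy3 hy hy2 h

lemma pell_no_sol (D : ℕ) (hD : D = 17 ∨ D = 257 ∨ D = 4097) (x k : ℕ) (hk : 5 ≤ k)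
    (h : x ^ 2 = 2 * (2 ^ k) ^ 2 + D) : False := by
  obtain ⟨j, v, hv1, hv2, hv3, hv4⟩ := pell_descent D (2 ^ k) x (2 ^ k) le_rfl (by positivity) h
    (by omega)
  have hb := pell_base D hD v.1 v.2 hv1 hv2 hv3
  have hm := pell_iter_mod j v
  rw [← hv4] at hm
  have hcheck : ∀ v ∈ [(5, 2), (7, 4), (17, 4), (35, 22), (65, 8), (67, 14), (145, 92), (163, 106)],
      orbitOk 64 (v.1 % 8224, v.2 % 8224) = true ∧
        pellStepMod^[64] (v.1 % 8224, v.2 % 8224) = (v.1 % 8224, v.2 % 8224) := by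
    decide +kernel
  obtain ⟨c1, c2⟩ := hcheck v hb
  have hper : Function.IsPeriodicPt pellStepMod 64 (v.1 % 8224, v.2 % 8224) := c2
  rw [← hper.iterate_mod_apply j] at hm
  have := orbitOk_spec 64 _ c1 (j % 64) (Nat.mod_lt _ (by norm_num))
  rw [← hm] at this
  have h32 : 2 ^ k % 32 = 0 := by
    obtain ⟨r, rfl⟩ := Nat.exists_eq_add_of_le hk
    rw [pow_add]; norm_num
  refine this (by simp only; omega) (k % 16) (Nat.mod_lt _ (by norm_num)) ?_
  rw [← two_pow_mod_257]; simp only; omega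

open PowerSeries in
lemma exists_sqrt_series : ∃ S : ℤ⟦X⟧, S ^ 2 = 1 + 4 * X ∧ constantCoeff S = 1 := by
  have h := congrArg (PowerSeries.map (Nat.castRingHom ℤ)) catalanSeries_sq_mul_X_add_one
  simp only [map_add, map_mul, map_pow, map_one, PowerSeries.map_X] at h
  set c := PowerSeries.map (Nat.castRingHom ℤ) catalanSeries with hc
  refine ⟨rescale (-1) (1 - 2 * X * c), ?_, ?_⟩
  · rw [← map_pow]
    have : (1 - 2 * X * c) ^ 2 = 1 - 4 * X := by linear_combination 4 * X * h
    have h4 : rescale (-1 : ℤ) (4 : ℤ⟦X⟧) = 4 := map_ofNat _ 4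
    rw [this, map_sub, map_mul, rescale_X, h4]
    simp
  · simp

namespace Pade
open PowerSeries

/-- Euler operator -/
noncomputable def th (f : ℤ⟦X⟧) : ℤ⟦X⟧ := X * d⁄dX ℤ f

lemma coeff_th (f : ℤ⟦X⟧) (k : ℕ) : coeff k (th f) = k * coeff k f := by
  unfold th
  cases k with
  | zero => simp
  | succ k => rw [coeff_succ_X_mul, coeff_derivative]; push_cast; ring

lemma th_mul (f g : ℤ⟦X⟧) : th (f * g) = th f * g + f * th g := by
  unfold th; rw [Derivation.leibniz]; simp only [smul_eq_mul]; ring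

lemma th_add (f g : ℤ⟦X⟧) : th (f + g) = th f + th g := by
  unfold th; rw [map_add]; ring

lemma th_X : th X = X := by unfold th; simp
lemma th_one : th 1 = 0 := by unfold th; rw [derivative_one]; simp
lemma th_nat (n : ℕ) : th (n : ℤ⟦X⟧) = 0 := by
  ext k; rw [coeff_th]
  rcases k with _ | k
  · simp
  · have : (n : ℤ⟦X⟧) = C (n : ℤ) := by simp
    rw [this, coeff_C]; simp

lemma th_S {S : ℤ⟦X⟧} (hS : S ^ 2 = 1 + 4 * X) (h1 : constantCoeff S = 1) :
    (1 + 4 * X) * th S = 2 * X * S := by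
  have hne : S ≠ 0 := by rintro rfl; simp at h1
  have h := congrArg th hS
  rw [sq, th_mul, th_add, th_one, th_mul, th_X] at h
  have h4 : th (4 : ℤ⟦X⟧) = 0 := th_nat 4
  rw [h4] at h
  have h2 : S * th S = 2 * X := by
    have : (2 : ℤ⟦X⟧) ≠ 0 := by
      intro h0
      have h0 := congrArg constantCoeff h0
      have h2 : constantCoeff (2 : ℤ⟦X⟧) = 2 := map_ofNat _ 2
      rw [h2] at h0; simp at h0
    apply mul_left_cancel₀ this; linear_combination h
  linear_combination S * h2 - th S * hS

lemma th_S_pow {S : ℤ⟦X⟧} (hS : S ^ 2 = 1 + 4 * X) (h1 : constantCoeff S = 1) (n : ℕ) :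
    (1 + 4 * X) * th (S ^ n) = 2 * (n : ℤ⟦X⟧) * X * S ^ n := by
  induction n with
  | zero => simp [th_one]
  | succ n ih =>
    rw [pow_succ, th_mul]
    push_cast
    linear_combination S * ih + S ^ n * th_S hS h1

lemma coeff_S_pow {S : ℤ⟦X⟧} (hS : S ^ 2 = 1 + 4 * X) (h1 : constantCoeff S = 1) (n k : ℕ) :
    ((k : ℤ) + 1) * coeff (k + 1) (S ^ n) = (2 * n - 4 * k) * coeff k (S ^ n) := by
  have h := congrArg (coeff (k + 1)) (th_S_pow hS h1 n)
  have e1 : (1 + 4 * X) * th (S ^ n) = th (S ^ n) + X * (C (4 : ℤ) * th (S ^ n)) := by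
    have : (C (4 : ℤ) : ℤ⟦X⟧) = 4 := by simp
    rw [this]; ring
  have e2 : 2 * (n : ℤ⟦X⟧) * X * S ^ n = X * (C (2 * n : ℤ) * S ^ n) := by
    have : (C (2 * n : ℤ) : ℤ⟦X⟧) = 2 * n := by simp
    rw [this]; ring
  rw [e1, e2, map_add, coeff_succ_X_mul, coeff_succ_X_mul, coeff_C_mul, coeff_C_mul, coeff_th,
    coeff_th] at h
  push_cast at h
  linear_combination h

lemma ode_coeff (P Q U V : ℤ) (f : ℤ⟦X⟧) (k : ℕ)
    (h : C P * th f - th (th f) = X * (C Q * f - C U * th f + C V * th (th f))) :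
    ((k : ℤ) + 1) * (P - (k + 1)) * coeff (k + 1) f =
      (Q - U * k + V * k ^ 2) * coeff k f := by
  have h := congrArg (coeff (k + 1)) h
  rw [coeff_succ_X_mul] at h
  simp only [map_sub, map_add, coeff_C_mul, coeff_th] at h
  push_cast at h
  linear_combination h

lemma ode_of_coeff (P Q U V : ℤ) (f : ℤ⟦X⟧)
    (h : ∀ k : ℕ, ((k : ℤ) + 1) * (P - (k + 1)) * coeff (k + 1) f =
      (Q - U * k + V * k ^ 2) * coeff k f) :
    C P * th f - th (th f) = X * (C Q * f - C U * th f + C V * th (th f)) := by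
  ext k
  cases k with
  | zero =>
    rw [coeff_zero_X_mul]
    simp only [map_sub, coeff_C_mul, coeff_th]
    simp
  | succ k =>
    rw [coeff_succ_X_mul]
    simp only [map_sub, map_add, coeff_C_mul, coeff_th]
    push_cast
    linear_combination h k

lemma ode_mul_S {S : ℤ⟦X⟧} (hS : S ^ 2 = 1 + 4 * X) (h1 : constantCoeff S = 1)
    (p q : ℤ) (B : ℤ⟦X⟧)
    (h : C (p + q + 1) * th B - th (th B) =
      X * (C ((4 * p - 2) * q) * B - C (4 * p - 2 + 4 * q) * th B + C 4 * th (th B))) :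
    C (p + q + 1) * th (B * S) - th (th (B * S)) =
      X * (C ((4 * q + 2) * p) * (B * S) - C (4 * q + 2 + 4 * p) * th (B * S)
        + C 4 * th (th (B * S))) := by
  have hs := th_S hS h1
  have hs2 := congrArg th hs
  have h4 : th (4 : ℤ⟦X⟧) = 0 := th_nat 4
  have h2 : th (2 : ℤ⟦X⟧) = 0 := th_nat 2
  simp only [th_mul, th_add, th_one, th_X, h4, h2] at hs2
  have hne : (1 + 4 * X : ℤ⟦X⟧) ≠ 0 := by
    intro h0
    have := congrArg constantCoeff h0
    simp at this
  apply mul_left_cancel₀ hne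
  simp only [map_add, map_sub, map_mul, map_one, map_ofNat, th_mul, th_add] at h ⊢
  set p' : ℤ⟦X⟧ := C p
  set q' : ℤ⟦X⟧ := C q
  set b1 := th B
  set b2 := th b1
  set s1 := th S
  set s2 := th s1
  linear_combination (1 + 4 * X) * S * h + (((p' + q' + 1) + X * (4 * q' + 2 + 4 * p')) * B
    - 2 * (1 + 4 * X) * b1 + 2 * X * B) * hs - (1 + 4 * X) * B * hs2


/-- denominators of the Pade approximants -/
noncomputable def Bc (S : ℤ⟦X⟧) (p q k : ℕ) : ℤ :=
  if k ≤ q then coeff k (S ^ (2 * p - 1)) * ((p + q - k).choose p : ℕ) else 0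

/-- numerators of the Pade approximants -/
noncomputable def Ac (S : ℤ⟦X⟧) (p q k : ℕ) : ℤ :=
  if k ≤ p then coeff k (S ^ (2 * q + 1)) * ((p + q - k).choose q : ℕ) else 0

lemma choose_step (p q k : ℕ) (hk : k < q) :
    ((p : ℤ) + q - k) * ((p + q - (k + 1)).choose p : ℕ) =
      ((q : ℤ) - k) * ((p + q - k).choose p : ℕ) := by
  obtain ⟨j, rfl⟩ := Nat.exists_eq_add_of_lt hk
  have e1 : p + (k + j + 1) - (k + 1) = p + j := by omega
  have e2 : p + (k + j + 1) - k = p + j + 1 := by omega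
  rw [e1, e2]
  have := Nat.choose_mul_succ_eq (p + j) p
  have e3 : p + j + 1 - p = j + 1 := by omega
  rw [e3] at this
  push_cast
  have t : ((p + j).choose p : ℤ) * (p + j + 1) = (p + j + 1).choose p * (j + 1) := by
    exact_mod_cast this
  linear_combination t

lemma Bc_step {S : ℤ⟦X⟧} (hS : S ^ 2 = 1 + 4 * X) (h1 : constantCoeff S = 1) (p q : ℕ)
    (hp : 0 < p) (k : ℕ) :
    ((k : ℤ) + 1) * (p + q - k) * Bc S p q (k + 1) = (4 * p - 2 - 4 * k) * (q - k) * Bc S p q k := by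
  have hc := coeff_S_pow hS h1 (2 * p - 1) k
  have e : ((2 * p - 1 : ℕ) : ℤ) = 2 * p - 1 := by omega
  rw [e] at hc
  unfold Bc
  rcases lt_trichotomy k q with h | h | h
  · rw [if_pos (by omega), if_pos (by omega)]
    have h2 := choose_step p q k h
    linear_combination (((p : ℤ) + q - k) * ((p + q - (k + 1)).choose p : ℕ)) * hc +
      ((4 * p - 2 - 4 * k) * coeff k (S ^ (2 * p - 1))) * h2
  · subst h; rw [if_neg (by omega)]; ring
  · rw [if_neg (by omega), if_neg (by omega)]; ring

lemma Ac_step {S : ℤ⟦X⟧} (hS : S ^ 2 = 1 + 4 * X) (h1 : constantCoeff S = 1) (p q : ℕ)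
    (k : ℕ) :
    ((k : ℤ) + 1) * (p + q - k) * Ac S p q (k + 1) = (4 * q + 2 - 4 * k) * (p - k) * Ac S p q k := by
  have hc := coeff_S_pow hS h1 (2 * q + 1) k
  unfold Ac
  push_cast at hc
  rcases lt_trichotomy k p with h | h | h
  · rw [if_pos (by omega), if_pos (by omega)]
    have h2 := choose_step q p k h
    rw [add_comm q p] at h2
    linear_combination (((p : ℤ) + q - k) * ((p + q - (k + 1)).choose q : ℕ)) * hc +
      ((4 * q + 2 - 4 * k) * coeff k (S ^ (2 * q + 1))) * h2
  · subst h; rw [if_neg (by omega)]; ring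
  · rw [if_neg (by omega), if_neg (by omega)]; ring

lemma pade {S : ℤ⟦X⟧} (hS : S ^ 2 = 1 + 4 * X) (h1 : constantCoeff S = 1) (p q : ℕ)
    (hp : 0 < p) : ∀ k ≤ p + q, coeff k (PowerSeries.mk (Bc S p q) * S) = Ac S p q k := by
  have hB := ode_mul_S hS h1 p q (PowerSeries.mk (Bc S p q)) (by
    apply ode_of_coeff
    intro k
    rw [coeff_mk, coeff_mk]
    linear_combination Bc_step hS h1 p q hp k)
  intro k
  induction k with
  | zero =>
    intro _
    rw [coeff_zero_eq_constantCoeff, map_mul, h1]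
    simp only [Bc, Ac, ← coeff_zero_eq_constantCoeff_apply, coeff_mk]
    simp [h1]
    rw [Nat.choose_symm_add]
  | succ k ih =>
    intro hk
    have h2 := ode_coeff _ _ _ _ _ k hB
    rw [ih (by omega)] at h2
    have h3 := Ac_step hS h1 p q k
    have hne : ((k : ℤ) + 1) * (p + q - k) ≠ 0 := by
      apply mul_ne_zero <;> omega
    apply mul_left_cancel₀ hne
    linear_combination h2 - h3


lemma eval_dvd (P : Polynomial ℤ) (N : ℕ) (w : ℤ) (h : (X : ℤ⟦X⟧) ^ N ∣ (P : ℤ⟦X⟧)) :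
    w ^ N ∣ P.eval w := by
  have h2 : (Polynomial.X : Polynomial ℤ) ^ N ∣ P := by
    rw [Polynomial.X_pow_dvd_iff]
    intro d hd
    rw [PowerSeries.X_pow_dvd_iff] at h
    simpa using h d hd
  have := Polynomial.eval_dvd (x := w) h2
  simpa using this

lemma dvd_sub_trunc (S : ℤ⟦X⟧) (N : ℕ) : (X : ℤ⟦X⟧) ^ N ∣ S - (trunc N S : Polynomial ℤ) := by
  rw [PowerSeries.X_pow_dvd_iff]
  intro d hd
  rw [map_sub, Polynomial.coeff_coe, coeff_trunc, if_pos hd, sub_self]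

lemma coe_trunc_mk (f : ℕ → ℤ) (n : ℕ) (h : ∀ k, n < k → f k = 0) :
    ((trunc (n + 1) (PowerSeries.mk f) : Polynomial ℤ) : ℤ⟦X⟧) = PowerSeries.mk f := by
  ext d
  rw [Polynomial.coeff_coe, coeff_trunc, coeff_mk]
  split_ifs with hd
  · rfl
  · exact (h d (by omega)).symm

lemma eval_trunc_mk (f : ℕ → ℤ) (n : ℕ) (w : ℤ) :
    (trunc (n + 1) (PowerSeries.mk f) : Polynomial ℤ).eval w =
      ∑ k ∈ Finset.range (n + 1), f k * w ^ k := by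
  rw [Polynomial.eval_eq_sum_range' (natDegree_trunc_lt _ n)]
  apply Finset.sum_congr rfl
  intro k hk
  rw [Finset.mem_range] at hk
  rw [coeff_trunc, if_pos hk, coeff_mk]

lemma pade_eval {S : ℤ⟦X⟧} (hS : S ^ 2 = 1 + 4 * X) (h1 : constantCoeff S = 1) (p q : ℕ)
    (hp : 0 < p) (w : ℤ) : ∃ T : ℤ, w ^ (p + q + 1) ∣ T ^ 2 - (1 + 4 * w) ∧
      w ^ (p + q + 1) ∣ (∑ k ∈ Finset.range (p + 1), Ac S p q k * w ^ k) -
        (∑ k ∈ Finset.range (q + 1), Bc S p q k * w ^ k) * T := by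
  set N := p + q + 1
  obtain ⟨R, hR⟩ := dvd_sub_trunc S N
  refine ⟨(trunc N S : Polynomial ℤ).eval w, ?_, ?_⟩
  · have := eval_dvd ((trunc N S) ^ 2 - (1 + 4 * Polynomial.X)) N w (by
      have e4 : (((4 : Polynomial ℤ)) : ℤ⟦X⟧) = 4 := by
        exact map_ofNat (Polynomial.coeToPowerSeries.ringHom (R := ℤ)) 4
      push_cast
      rw [e4, ← hS]
      generalize ((trunc N S : Polynomial ℤ) : ℤ⟦X⟧) = t at hR ⊢
      refine ⟨(-1) * (S + t) * R, ?_⟩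
      have e5 : t ^ 2 - S ^ 2 = (-1) * (S + t) * (S - t) := by ring
      rw [e5, hR]
      ring)
    simpa using this
  · have hA := coe_trunc_mk (Ac S p q) p (fun k hk => if_neg (by omega))
    have hB := coe_trunc_mk (Bc S p q) q (fun k hk => if_neg (by omega))
    have := eval_dvd (trunc (p + 1) (PowerSeries.mk (Ac S p q)) -
      trunc (q + 1) (PowerSeries.mk (Bc S p q)) * trunc N S) N w (by
      push_cast
      rw [hA, hB]
      have h3 : (X : ℤ⟦X⟧) ^ N ∣ PowerSeries.mk (Ac S p q) - PowerSeries.mk (Bc S p q) * S := by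
        rw [PowerSeries.X_pow_dvd_iff]
        intro d hd
        rw [map_sub, pade hS h1 p q hp d (by omega), coeff_mk, sub_self]
      obtain ⟨R2, hR2⟩ := h3
      exact ⟨R2 + PowerSeries.mk (Bc S p q) * R, by
        linear_combination hR2 + PowerSeries.mk (Bc S p q) * hR⟩)
    rw [Polynomial.eval_sub, Polynomial.eval_mul, eval_trunc_mk, eval_trunc_mk] at this
    exact this

lemma coeff_zero_pow {S : ℤ⟦X⟧} (h1 : constantCoeff S = 1) (n : ℕ) : coeff 0 (S ^ n) = 1 := by
  rw [coeff_zero_eq_constantCoeff, map_pow, h1, one_pow]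

lemma e_lower {S : ℤ⟦X⟧} (hS : S ^ 2 = 1 + 4 * X) (h1 : constantCoeff S = 1) (n : ℕ) (k : ℕ) :
    k ≤ n → (4 : ℤ) ^ k ≤ coeff k (S ^ (2 * (2 * n) - 1)) := by
  induction k with
  | zero => intro _; rw [coeff_zero_pow h1]; simp
  | succ k ih =>
    intro hk
    have h := coeff_S_pow hS h1 (2 * (2 * n) - 1) k
    have e : ((2 * (2 * n) - 1 : ℕ) : ℤ) = 4 * n - 1 := by omega
    rw [e] at h
    have ih := ih (by omega)
    have hk' : (k : ℤ) + 1 ≤ n := by exact_mod_cast hk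
    have hpos : (0 : ℤ) < 4 ^ k := by positivity
    have : ((k : ℤ) + 1) * 4 ^ (k + 1) ≤ ((k : ℤ) + 1) * coeff (k + 1) (S ^ (2 * (2 * n) - 1)) := by
      rw [h, pow_succ]
      calc ((k : ℤ) + 1) * (4 ^ k * 4) = (4 * k + 4) * 4 ^ k := by ring
        _ ≤ (2 * (4 * n - 1) - 4 * k) * 4 ^ k := by
          apply mul_le_mul_of_nonneg_right _ hpos.le; linarith
        _ ≤ _ := by apply mul_le_mul_of_nonneg_left ih; linarith
    exact le_of_mul_le_mul_left this (by positivity)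

lemma e_upper {S : ℤ⟦X⟧} (hS : S ^ 2 = 1 + 4 * X) (h1 : constantCoeff S = 1) (n : ℕ) (k : ℕ) :
    k ≤ n → coeff k (S ^ (2 * (2 * n) - 1)) ≤ 4 ^ k * ((2 * n).choose k : ℕ) := by
  induction k with
  | zero => intro _; rw [coeff_zero_pow h1]; simp
  | succ k ih =>
    intro hk
    have h := coeff_S_pow hS h1 (2 * (2 * n) - 1) k
    have e : ((2 * (2 * n) - 1 : ℕ) : ℤ) = 4 * n - 1 := by omega
    rw [e] at h
    have ih := ih (by omega)
    have hl := e_lower hS h1 n k (by omega)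
    have hk' : (k : ℤ) + 1 ≤ n := by exact_mod_cast hk
    have hpos : (0 : ℤ) < 4 ^ k := by positivity
    have hc := Nat.choose_succ_right_eq (2 * n) k
    have hc' : ((2 * n).choose (k + 1) : ℤ) * (k + 1) = (2 * n).choose k * (2 * n - k) := by
      have : ((2 * n - k : ℕ) : ℤ) = 2 * n - k := by omega
      rw [← this]; exact_mod_cast hc
    have : ((k : ℤ) + 1) * coeff (k + 1) (S ^ (2 * (2 * n) - 1)) ≤
        ((k : ℤ) + 1) * (4 ^ (k + 1) * ((2 * n).choose (k + 1) : ℕ)) := by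
      rw [h]
      calc _ ≤ (4 * (2 * n - k)) * coeff k (S ^ (2 * (2 * n) - 1)) := by
            apply mul_le_mul_of_nonneg_right _ (hpos.le.trans hl); linarith
        _ ≤ (4 * (2 * n - k)) * (4 ^ k * ((2 * n).choose k : ℕ)) := by
            apply mul_le_mul_of_nonneg_left ih; linarith
        _ = _ := by rw [pow_succ]; linear_combination (-4 ^ (k + 1)) * hc'
    exact le_of_mul_le_mul_left this (by positivity)

lemma e'_upper1 {S : ℤ⟦X⟧} (hS : S ^ 2 = 1 + 4 * X) (h1 : constantCoeff S = 1) (n : ℕ) (k : ℕ) :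
    k ≤ n + 1 → |coeff k (S ^ (2 * n + 1))| ≤ 4 ^ k * ((n + 1).choose k : ℕ) := by
  induction k with
  | zero => intro _; rw [coeff_zero_pow h1]; simp
  | succ k ih =>
    intro hk
    have h := coeff_S_pow hS h1 (2 * n + 1) k
    push_cast at h
    have ih := ih (by omega)
    have hk' : (k : ℤ) ≤ n := by omega
    have hc := Nat.choose_succ_right_eq (n + 1) k
    have hc' : ((n + 1).choose (k + 1) : ℤ) * (k + 1) = (n + 1).choose k * (n + 1 - k) := by
      have : ((n + 1 - k : ℕ) : ℤ) = n + 1 - k := by omega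
      rw [← this]; exact_mod_cast hc
    have h := congrArg abs h
    rw [abs_mul, abs_mul, abs_of_nonneg (show (0 : ℤ) ≤ (k : ℤ) + 1 by positivity),
      abs_of_nonneg (show (0 : ℤ) ≤ 2 * (2 * (n : ℤ) + 1) - 4 * k by linarith)] at h
    have : ((k : ℤ) + 1) * |coeff (k + 1) (S ^ (2 * n + 1))| ≤
        ((k : ℤ) + 1) * (4 ^ (k + 1) * ((n + 1).choose (k + 1) : ℕ)) := by
      rw [h]
      calc _ ≤ (4 * (n + 1 - k)) * |coeff k (S ^ (2 * n + 1))| := by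
            apply mul_le_mul_of_nonneg_right _ (abs_nonneg _); linarith
        _ ≤ (4 * (n + 1 - k)) * (4 ^ k * ((n + 1).choose k : ℕ)) := by
            apply mul_le_mul_of_nonneg_left ih; linarith
        _ = _ := by rw [pow_succ]; linear_combination (-4 ^ (k + 1)) * hc'
    exact le_of_mul_le_mul_left this (by positivity)

lemma e'_upper {S : ℤ⟦X⟧} (hS : S ^ 2 = 1 + 4 * X) (h1 : constantCoeff S = 1) (n : ℕ) (k : ℕ) :
    |coeff k (S ^ (2 * n + 1))| ≤ 4 ^ k * 2 ^ (n + 1) := by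
  rcases le_total k (n + 1) with hk | hk
  · refine (e'_upper1 hS h1 n k hk).trans ?_
    apply mul_le_mul_of_nonneg_left _ (by positivity)
    exact_mod_cast Nat.choose_le_two_pow (n + 1) k
  · induction k, hk using Nat.le_induction with
    | base =>
      refine (e'_upper1 hS h1 n (n + 1) le_rfl).trans ?_
      apply mul_le_mul_of_nonneg_left _ (by positivity)
      exact_mod_cast Nat.choose_le_two_pow (n + 1) (n + 1)
    | succ k hk ih =>
      have h := coeff_S_pow hS h1 (2 * n + 1) k
      push_cast at h
      have hk' : (n : ℤ) + 1 ≤ k := by omega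
      have h := congrArg abs h
      rw [abs_mul, abs_mul, abs_of_nonneg (show (0 : ℤ) ≤ (k : ℤ) + 1 by positivity),
        abs_of_nonpos (show 2 * (2 * (n : ℤ) + 1) - 4 * k ≤ 0 by linarith)] at h
      have : ((k : ℤ) + 1) * |coeff (k + 1) (S ^ (2 * n + 1))| ≤
          ((k : ℤ) + 1) * (4 ^ (k + 1) * 2 ^ (n + 1)) := by
        rw [h]
        calc _ ≤ (4 * ((k : ℤ) + 1)) * |coeff k (S ^ (2 * n + 1))| := by
              apply mul_le_mul_of_nonneg_right _ (abs_nonneg _); linarith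
          _ ≤ (4 * ((k : ℤ) + 1)) * (4 ^ k * 2 ^ (n + 1)) := by
              apply mul_le_mul_of_nonneg_left ih; positivity
          _ = _ := by ring
      exact le_of_mul_le_mul_left this (by positivity)

lemma geom_bound (W : ℤ) (hW : 4 ≤ W) (M : ℕ) :
    ∑ k ∈ Finset.range (M + 1), W ^ k * 2 ^ (M - k) ≤ 2 * W ^ M := by
  induction M with
  | zero => simp
  | succ M ih =>
    rw [Finset.sum_range_succ]
    have : ∑ k ∈ Finset.range (M + 1), W ^ k * 2 ^ (M + 1 - k) =
        2 * ∑ k ∈ Finset.range (M + 1), W ^ k * 2 ^ (M - k) := by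
      rw [Finset.mul_sum]
      apply Finset.sum_congr rfl
      intro k hk
      rw [Finset.mem_range] at hk
      rw [show M + 1 - k = (M - k) + 1 by omega, pow_succ]; ring
    rw [this]
    simp only [Nat.sub_self, pow_zero, mul_one]
    have h0 : 0 ≤ W ^ M := by positivity
    rw [pow_succ]
    nlinarith

lemma A_bound {S : ℤ⟦X⟧} (hS : S ^ 2 = 1 + 4 * X) (h1 : constantCoeff S = 1) (n : ℕ) (w : ℤ)
    (hw : 4 ≤ w) :
    |∑ k ∈ Finset.range (2 * n + 1), Ac S (2 * n) n k * w ^ k| ≤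
      2 ^ (2 * n + 2) * (4 * w) ^ (2 * n) := by
  calc _ ≤ ∑ k ∈ Finset.range (2 * n + 1), |Ac S (2 * n) n k * w ^ k| :=
        Finset.abs_sum_le_sum_abs _ _
    _ ≤ ∑ k ∈ Finset.range (2 * n + 1), 2 ^ (2 * n + 1) * ((4 * w) ^ k * 2 ^ (2 * n - k)) := by
        apply Finset.sum_le_sum
        intro k hk
        rw [Finset.mem_range] at hk
        unfold Ac
        rw [if_pos (by omega), abs_mul, abs_mul, abs_of_nonneg (show 0 ≤ w ^ k by positivity),
          Nat.abs_cast]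
        have hc : ((2 * n + n - k).choose n : ℤ) ≤ 2 ^ (2 * n + n - k) := by
          exact_mod_cast Nat.choose_le_two_pow _ _
        have he := e'_upper hS h1 n k
        calc _ ≤ (4 ^ k * 2 ^ (n + 1)) * 2 ^ (2 * n + n - k) * w ^ k := by gcongr
          _ = _ := by
            rw [show 2 * n + n - k = n + (2 * n - k) by omega, mul_pow, pow_add,
              show 2 * n + 1 = (n + 1) + n by omega, pow_add 2 (n + 1) n]
            ring
    _ = 2 ^ (2 * n + 1) * ∑ k ∈ Finset.range (2 * n + 1), ((4 * w) ^ k * 2 ^ (2 * n - k)) := by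
        rw [Finset.mul_sum]
    _ ≤ 2 ^ (2 * n + 1) * (2 * (4 * w) ^ (2 * n)) := by
        apply mul_le_mul_of_nonneg_left (geom_bound _ (by linarith) _) (by positivity)
    _ = _ := by ring

lemma B_lower {S : ℤ⟦X⟧} (hS : S ^ 2 = 1 + 4 * X) (h1 : constantCoeff S = 1) (n : ℕ) (w : ℤ)
    (hw : 4 ≤ w) :
    (4 * w) ^ n ≤ ∑ k ∈ Finset.range (n + 1), Bc S (2 * n) n k * w ^ k := by
  have hnn : ∀ k ∈ Finset.range (n + 1), 0 ≤ Bc S (2 * n) n k * w ^ k := by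
    intro k hk
    rw [Finset.mem_range] at hk
    unfold Bc
    rw [if_pos (by omega)]
    have := e_lower hS h1 n k (by omega)
    have : 0 ≤ coeff k (S ^ (2 * (2 * n) - 1)) := le_trans (by positivity) this
    positivity
  refine le_trans ?_ (Finset.single_le_sum hnn (Finset.mem_range.2 (Nat.lt_succ_self n)))
  unfold Bc
  rw [if_pos le_rfl, show 2 * n + n - n = 2 * n by omega, Nat.choose_self, mul_pow]
  have := e_lower hS h1 n n le_rfl
  push_cast
  rw [mul_one]
  gcongr

lemma choose_bound (N j : ℕ) : 15 ^ N * (N + j).choose N ≤ 16 ^ (N + j) := by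
  have h := add_pow 15 1 (N + j)
  rw [show 15 + 1 = 16 by rfl] at h
  rw [h]
  have := Finset.single_le_sum (f := fun m => 15 ^ m * 1 ^ (N + j - m) * (N + j).choose m)
    (fun i _ => Nat.zero_le _) (Finset.mem_range.2 (show N < N + j + 1 by omega))
  simpa using this

lemma B_upper {S : ℤ⟦X⟧} (hS : S ^ 2 = 1 + 4 * X) (h1 : constantCoeff S = 1) (n : ℕ) (w : ℤ)
    (hw : 4 ≤ w) :
    15 ^ (2 * n) * ∑ k ∈ Finset.range (n + 1), Bc S (2 * n) n k * w ^ k ≤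
      16 ^ (2 * n) * (4 * w) ^ n * 4 ^ n := by
  rw [Finset.mul_sum]
  calc _ ≤ ∑ k ∈ Finset.range (n + 1),
          16 ^ (2 * n) * (4 * w) ^ n * ((2 * n).choose k : ℤ) := by
        apply Finset.sum_le_sum
        intro k hk
        rw [Finset.mem_range] at hk
        unfold Bc
        rw [if_pos (by omega)]
        have he := e_upper hS h1 n k (by omega)
        have hc : (15 : ℤ) ^ (2 * n) * ((2 * n + n - k).choose (2 * n) : ℕ) ≤
            16 ^ (2 * n) * 16 ^ (n - k) := by
          rw [← pow_add, show 2 * n + n - k = 2 * n + (n - k) by omega]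
          exact_mod_cast choose_bound (2 * n) (n - k)
        have h16 : (16 : ℤ) ^ (n - k) ≤ (4 * w) ^ (n - k) := by
          apply pow_le_pow_left₀ (by norm_num); linarith
        have hsplit : (4 * w) ^ n = (4 * w) ^ k * (4 * w) ^ (n - k) := by
          rw [← pow_add]; congr 1; omega
        calc _ = coeff k (S ^ (2 * (2 * n) - 1)) *
              ((15 : ℤ) ^ (2 * n) * ((2 * n + n - k).choose (2 * n) : ℕ)) * w ^ k := by ring
          _ ≤ (4 ^ k * ((2 * n).choose k : ℕ)) * (16 ^ (2 * n) * (4 * w) ^ (n - k)) * w ^ k := by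
            have := hc.trans (mul_le_mul_of_nonneg_left h16 (by positivity))
            gcongr
          _ = _ := by rw [hsplit, mul_pow 4 w k]; ring
    _ = 16 ^ (2 * n) * (4 * w) ^ n * ∑ k ∈ Finset.range (n + 1), ((2 * n).choose k : ℤ) := by
        rw [Finset.mul_sum]
    _ ≤ _ := by
        apply mul_le_mul_of_nonneg_left _ (by positivity)
        have h : ∑ k ∈ Finset.range (n + 1), (2 * n).choose k ≤ 2 ^ (2 * n) := by
          rw [← Nat.sum_range_choose]
          apply Finset.sum_le_sum_of_subset
          apply Finset.range_subset_range.2; omega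
        rw [pow_mul] at h
        exact_mod_cast h

end Pade

lemma two_adic_split (u v : ℤ) (E : ℕ) (hu : Odd u) (hv : Odd v)
    (h : (2 : ℤ) ^ (E + 1) ∣ u ^ 2 - v ^ 2) : 2 ^ E ∣ u - v ∨ 2 ^ E ∣ u + v := by
  cases E with
  | zero => left; simp
  | succ E =>
    obtain ⟨i, hi⟩ := hu
    obtain ⟨j, hj⟩ := hv
    have e1 : u - v = 2 * (i - j) := by rw [hi, hj]; ring
    have e2 : u + v = 2 * (i + j + 1) := by rw [hi, hj]; ring
    have h2 : (2 : ℤ) ^ E ∣ (i - j) * (i + j + 1) := by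
      have h3 : u ^ 2 - v ^ 2 = 4 * ((i - j) * (i + j + 1)) := by rw [hi, hj]; ring
      rw [h3, show (2 : ℤ) ^ (E + 1 + 1) = 4 * 2 ^ E by ring] at h
      exact (mul_dvd_mul_iff_left (by norm_num)).1 h
    rw [e1, e2, pow_succ']
    rcases Int.even_or_odd (i - j) with he | ho
    · left
      apply mul_dvd_mul_left
      have : IsCoprime ((2 : ℤ) ^ E) (i + j + 1) := by
        apply IsCoprime.pow_left
        rw [Int.isCoprime_iff_gcd_eq_one, Int.gcd_comm]
        rw [← Int.isCoprime_iff_gcd_eq_one, Int.isCoprime_two_right]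
        obtain ⟨r, hr⟩ := he
        exact ⟨j + r, by linarith⟩
      exact this.dvd_of_dvd_mul_right h2
    · right
      apply mul_dvd_mul_left
      have : IsCoprime ((2 : ℤ) ^ E) (i - j) := by
        apply IsCoprime.pow_left
        rw [Int.isCoprime_iff_gcd_eq_one, Int.gcd_comm]
        rw [← Int.isCoprime_iff_gcd_eq_one, Int.isCoprime_two_right]
        exact ho
      exact this.dvd_of_dvd_mul_left h2

lemma large_no_sol (m h n : ℕ) (x : ℤ) (hm : 14 ≤ m) (hn : 1 ≤ n) (hx : 0 < x)
    (heq : x ^ 2 = 2 ^ (2 * h - 1) + 4 * 2 ^ m + 1)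
    (hxl : 2 ^ (h - 1) < x) (hxu : x < 2 ^ h)
    (hlo : (4 * m + 17) * n + 12 ≤ 4 * h) (hhi : 4 * h + 8 + 17 * n ≤ 8 * m * n + 4 * m) :
    False := by
  obtain ⟨S, hS, h1⟩ := exists_sqrt_series
  have hw : (4 : ℤ) ≤ 2 ^ m := by
    calc (4 : ℤ) = 2 ^ 2 := by norm_num
      _ ≤ 2 ^ m := pow_le_pow_right₀ (by norm_num) (by omega)
  have hA := Pade.A_bound hS h1 n (2 ^ m) hw
  have hBl := Pade.B_lower hS h1 n (2 ^ m) hw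
  have hBu := Pade.B_upper hS h1 n (2 ^ m) hw
  obtain ⟨T, hT, hAB⟩ := Pade.pade_eval hS h1 (2 * n) n (by omega) (2 ^ m)
  set A := ∑ k ∈ Finset.range (2 * n + 1), Pade.Ac S (2 * n) n k * (2 ^ m) ^ k
  set B := ∑ k ∈ Finset.range (n + 1), Pade.Bc S (2 * n) n k * (2 ^ m) ^ k
  have hW : (4 * 2 ^ m : ℤ) = 2 ^ (m + 2) := by ring
  rw [hW] at hA hBl hBu
  have hB0 : 0 < B := lt_of_lt_of_le (by positivity) hBl
  rw [← pow_mul] at hT hAB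
  have hmn : 14 * n ≤ m * n := Nat.mul_le_mul_right n hm
  have hlo' : 4 * (m * n) + 17 * n + 12 ≤ 4 * h := by
    have : (4 * m + 17) * n = 4 * (m * n) + 17 * n := by ring
    omega
  have hhi' : 4 * h + 8 + 17 * n ≤ 8 * (m * n) + 4 * m := by
    have : 8 * m * n = 8 * (m * n) := by ring
    omega
  have hmN : m * (2 * n + n + 1) = 3 * (m * n) + m := by ring
  -- choice of the exponent
  obtain ⟨E, hE⟩ : ∃ E, E + 1 = min (2 * h - 1) (m * (2 * n + n + 1)) := by
    refine ⟨min (2 * h - 1) (m * (2 * n + n + 1)) - 1, ?_⟩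
    omega
  have hE1 : E + 1 ≤ 2 * h - 1 := by omega
  have hE2 : E + 1 ≤ m * (2 * n + n + 1) := by omega
  have hxo : Odd x := by
    have h2 : Odd (x ^ 2) := by
      rw [heq, show 2 * h - 1 = (2 * h - 2) + 1 by omega]
      exact ⟨2 ^ (2 * h - 2) + 2 * 2 ^ m, by ring⟩
    exact (Int.odd_pow' (by norm_num)).1 h2
  have hTo : Odd T := by
    have h2 : (2 : ℤ) ∣ T ^ 2 - (1 + 4 * 2 ^ m) :=
      (dvd_pow_self 2 (by omega)).trans hT
    obtain ⟨r, hr⟩ := h2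
    have h2 : Odd (T ^ 2) := ⟨r + 2 * 2 ^ m, by linarith⟩
    exact (Int.odd_pow' (by norm_num)).1 h2
  have hdv : (2 : ℤ) ^ (E + 1) ∣ x ^ 2 - T ^ 2 := by
    have d1 := (pow_dvd_pow (2 : ℤ) hE1)
    have d2 := (pow_dvd_pow (2 : ℤ) hE2).trans hT
    have := dvd_sub d1 d2
    have e : x ^ 2 - T ^ 2 = 2 ^ (2 * h - 1) - (T ^ 2 - (1 + 4 * 2 ^ m)) := by
      rw [heq]; ring
    rw [e]
    exact this
  obtain ⟨x', hx', hxd⟩ : ∃ x' : ℤ, |x'| = x ∧ 2 ^ E ∣ x' - T := by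
    rcases two_adic_split x T E hxo hTo hdv with h | h
    · exact ⟨x, abs_of_pos hx, h⟩
    · refine ⟨-x, by rw [abs_neg, abs_of_pos hx], ?_⟩
      rw [show -x - T = -(x + T) by ring]
      exact (dvd_neg).2 h
  have hdiv : (2 : ℤ) ^ E ∣ A - B * x' := by
    have d2 := (pow_dvd_pow (2 : ℤ) (show E ≤ m * (2 * n + n + 1) by omega)).trans hAB
    have := dvd_sub d2 (hxd.mul_left B)
    have e : A - B * x' = (A - B * T) - B * (x' - T) := by ring
    rw [e]
    exact this
  have hAlt : |A| < B * x := by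
    calc |A| ≤ 2 ^ (2 * n + 2) * (2 ^ (m + 2)) ^ (2 * n) := hA
      _ = 2 ^ (2 * n + 2 + (m + 2) * n) * (2 ^ (m + 2)) ^ n := by
        rw [← pow_mul, ← pow_mul, ← pow_add, ← pow_add]; congr 1; ring
      _ ≤ 2 ^ (h - 1) * (2 ^ (m + 2)) ^ n := by
        apply mul_le_mul_of_nonneg_right _ (by positivity)
        apply pow_le_pow_right₀ (by norm_num)
        have : (m + 2) * n = m * n + 2 * n := by ring
        omega
      _ < x * (2 ^ (m + 2)) ^ n := by
        apply mul_lt_mul_of_pos_right hxl (by positivity)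
      _ ≤ x * B := by apply mul_le_mul_of_nonneg_left hBl hx.le
      _ = B * x := mul_comm _ _
  have habs : |B * x'| = B * x := by rw [abs_mul, hx', abs_of_pos hB0]
  have hne : A - B * x' ≠ 0 := by
    intro h0
    have : A = B * x' := by linarith
    rw [this, habs] at hAlt
    exact lt_irrefl _ hAlt
  have hle : (2 : ℤ) ^ E ≤ |A - B * x'| :=
    Int.le_of_dvd (abs_pos.2 hne) ((dvd_abs _ _).2 hdiv)
  have hlt : |A - B * x'| < 2 ^ (h + 1) * B := by
    calc |A - B * x'| ≤ |A| + |B * x'| := abs_sub _ _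
      _ < B * x + B * x := by rw [habs]; linarith
      _ = 2 * x * B := by ring
      _ ≤ 2 * 2 ^ h * B := by
        apply mul_le_mul_of_nonneg_right _ hB0.le; linarith
      _ = _ := by ring
  have hB4 : B ^ 4 ≤ 2 ^ ((4 * m + 17) * n) := by
    have h4 : (15 ^ (2 * n) * B) ^ 4 ≤ (16 ^ (2 * n) * (2 ^ (m + 2)) ^ n * 4 ^ n) ^ 4 :=
      pow_le_pow_left₀ (by positivity) hBu 4
    have h5 : ((16 : ℤ) ^ (2 * n)) ^ 4 ≤ 2 ^ n * (15 ^ (2 * n)) ^ 4 := by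
      rw [← pow_mul, ← pow_mul, show 2 * n * 4 = 8 * n by ring, pow_mul, pow_mul, ← mul_pow]
      apply pow_le_pow_left₀ (by norm_num)
      norm_num
    have h6 : ((15 : ℤ) ^ (2 * n)) ^ 4 * B ^ 4 ≤
        ((15 : ℤ) ^ (2 * n)) ^ 4 * 2 ^ ((4 * m + 17) * n) := by
      calc _ = (15 ^ (2 * n) * B) ^ 4 := by ring
        _ ≤ _ := h4
        _ = (16 ^ (2 * n)) ^ 4 * ((2 ^ (m + 2)) ^ n * 4 ^ n) ^ 4 := by ring
        _ ≤ (2 ^ n * (15 ^ (2 * n)) ^ 4) * ((2 ^ (m + 2)) ^ n * 4 ^ n) ^ 4 :=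
          mul_le_mul_of_nonneg_right h5 (by positivity)
        _ = ((15 : ℤ) ^ (2 * n)) ^ 4 * (2 ^ n * ((2 ^ (m + 2)) ^ n * 4 ^ n) ^ 4) := by ring
        _ = _ := by
          congr 1
          rw [show (4 : ℤ) = 2 ^ 2 by norm_num, ← pow_mul, ← pow_mul, ← pow_add, ← pow_mul,
            ← pow_add]
          congr 1; ring
    exact le_of_mul_le_mul_left h6 (by positivity)
  have hfin : (2 ^ (h + 1) * B) ^ 4 ≤ ((2 : ℤ) ^ E) ^ 4 := by
    calc (2 ^ (h + 1) * B) ^ 4 = 2 ^ ((h + 1) * 4) * B ^ 4 := by rw [mul_pow, ← pow_mul]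
      _ ≤ 2 ^ ((h + 1) * 4) * 2 ^ ((4 * m + 17) * n) :=
        mul_le_mul_of_nonneg_left hB4 (by positivity)
      _ = 2 ^ ((h + 1) * 4 + (4 * m + 17) * n) := by rw [← pow_add]
      _ ≤ 2 ^ (E * 4) := by
        apply pow_le_pow_right₀ (by norm_num)
        have : (4 * m + 17) * n = 4 * (m * n) + 17 * n := by ring
        omega
      _ = _ := by rw [pow_mul]
  have := le_of_pow_le_pow_left₀ (by norm_num) (by positivity) hfin
  linarith

lemma height_bound (m h : ℕ) (x : ℤ) (hm : 14 ≤ m) (hh : m + 2 ≤ 2 * h - 1) (hx : 0 < x)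
    (heq : x ^ 2 = 2 ^ (2 * h - 1) + 4 * 2 ^ m + 1) (hxu : x < 2 ^ h) : 3 * m + 1 ≤ h := by
  by_contra hcon
  push Not at hcon
  have hxo : Odd x := by
    have h2 : Odd (x ^ 2) := by
      rw [heq, show 2 * h - 1 = (2 * h - 2) + 1 by omega]
      exact ⟨2 ^ (2 * h - 2) + 2 * 2 ^ m, by ring⟩
    exact (Int.odd_pow' (by norm_num)).1 h2
  obtain ⟨w, hw⟩ : ∃ w : ℤ, w = 2 ^ m := ⟨_, rfl⟩
  have hw14 : 16384 ≤ w := by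
    rw [hw]
    calc (16384 : ℤ) = 2 ^ 14 := by norm_num
      _ ≤ 2 ^ m := pow_le_pow_right₀ (by norm_num) hm
  have hw2 : w = 2 * 2 ^ (m - 1) := by
    rw [hw, ← pow_succ']; congr 1; omega
  rw [← hw] at heq
  rcases le_or_gt (3 * m + 3) (2 * h - 1) with hc | hc
  · -- long gap
    have d : (2 : ℤ) ^ (3 * m + 2 + 1) ∣ x ^ 2 - (1 + 2 * w - 2 * w ^ 2) ^ 2 := by
      have d1 := pow_dvd_pow (2 : ℤ) hc
      have e : (2 : ℤ) ^ (3 * m + 2 + 1) = 8 * w ^ 3 := by rw [hw]; ring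
      rw [show 3 * m + 3 = 3 * m + 2 + 1 by rfl, e] at d1
      rw [e]
      have : x ^ 2 - (1 + 2 * w - 2 * w ^ 2) ^ 2 =
          2 ^ (2 * h - 1) + 8 * w ^ 3 * (1 - 2 ^ (m - 1)) := by
        rw [heq]; linear_combination (-4 * w ^ 3) * hw2
      rw [this]
      exact dvd_add d1 (dvd_mul_right _ _)
    have hTo : Odd (1 + 2 * w - 2 * w ^ 2) := ⟨w - w ^ 2, by ring⟩
    have e : (2 : ℤ) ^ (3 * m + 2) = 4 * w ^ 3 := by rw [hw]; ring
    have hxs : x < 2 * w ^ 3 := by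
      calc x < 2 ^ h := hxu
        _ ≤ 2 ^ (3 * m + 1) := pow_le_pow_right₀ (by norm_num) (by omega)
        _ = 2 * w ^ 3 := by rw [hw]; ring
    have hw3 : 16384 * w ^ 2 ≤ w ^ 3 := by nlinarith [sq_nonneg w]
    have hw22 : 16384 * w ≤ w ^ 2 := by nlinarith
    rcases two_adic_split x _ _ hxo hTo d with ⟨r, hr⟩ | ⟨r, hr⟩
    · rw [e] at hr
      rcases le_or_gt r 0 with h0 | h0
      · nlinarith
      · nlinarith
    · rw [e] at hr
      rcases lt_trichotomy r 0 with h0 | h0 | h0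
      · nlinarith
      · subst h0
        have hxv : x = 2 * w ^ 2 - 2 * w - 1 := by linarith
        have h8 : (2 : ℤ) ^ (2 * h - 1) = 8 * w ^ 3 * (2 ^ (m - 1) - 1) := by
          rw [hxv] at heq
          linear_combination -heq + 4 * w ^ 3 * hw2
        have h9 : (2 : ℤ) ^ (2 * h - 1) = 8 * w ^ 3 * 2 ^ (2 * h - 1 - (3 * m + 3)) := by
          rw [hw, show (8 : ℤ) * (2 ^ m) ^ 3 = 2 ^ (3 * m + 3) by ring, ← pow_add]
          congr 1; omega
        have h10 : (2 : ℤ) ^ (2 * h - 1 - (3 * m + 3)) = 2 ^ (m - 1) - 1 := by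
          apply mul_left_cancel₀ (show (8 * w ^ 3 : ℤ) ≠ 0 by positivity)
          rw [← h9, h8]
        rcases Nat.eq_zero_or_pos (2 * h - 1 - (3 * m + 3)) with h11 | h11
        · rw [h11] at h10; simp at h10
          linarith
        · obtain ⟨i, hi⟩ := Nat.exists_eq_add_of_lt h11
          rw [hi, show m - 1 = (m - 2) + 1 by omega] at h10
          rw [pow_succ, pow_succ] at h10
          omega
      · nlinarith
  · rcases le_or_gt (2 * m + 2) (2 * h - 1) with hc2 | hc2
    · have d : (2 : ℤ) ^ (2 * m + 1 + 1) ∣ x ^ 2 - (1 + 2 * w) ^ 2 := by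
        have d1 := pow_dvd_pow (2 : ℤ) hc2
        have e : (2 : ℤ) ^ (2 * m + 1 + 1) = 4 * w ^ 2 := by rw [hw]; ring
        rw [show 2 * m + 2 = 2 * m + 1 + 1 by rfl, e] at d1
        rw [e]
        have : x ^ 2 - (1 + 2 * w) ^ 2 = 2 ^ (2 * h - 1) - 4 * w ^ 2 := by
          rw [heq]; ring
        rw [this]
        exact dvd_sub d1 (dvd_refl _)
      have hTo : Odd (1 + 2 * w) := ⟨w, by ring⟩
      have e : (2 : ℤ) ^ (2 * m + 1) = 2 * w ^ 2 := by rw [hw]; ring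
      have hxs : x < w ^ 2 := by
        calc x < 2 ^ h := hxu
          _ ≤ 2 ^ (2 * m) := pow_le_pow_right₀ (by norm_num) (by omega)
          _ = w ^ 2 := by rw [hw]; ring
      have hw22 : 16384 * w ≤ w ^ 2 := by nlinarith
      rcases two_adic_split x _ _ hxo hTo d with ⟨r, hr⟩ | ⟨r, hr⟩
      · rw [e] at hr
        rcases lt_trichotomy r 0 with h0 | h0 | h0
        · nlinarith
        · subst h0
          have hxv : x = 2 * w + 1 := by linarith
          have h8 : (2 : ℤ) ^ (2 * h - 1) = 2 ^ (2 * m + 2) := by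
            rw [hxv] at heq
            rw [pow_add, pow_mul', ← hw]
            linarith
          have := pow_right_injective₀ (show (0 : ℤ) < 2 by norm_num) (by norm_num) h8
          omega
        · nlinarith
      · rw [e] at hr
        rcases le_or_gt r 0 with h0 | h0
        · nlinarith
        · nlinarith
    · -- short gap
      have hxs : x < 2 * w := by
        calc x < 2 ^ h := hxu
          _ ≤ 2 ^ (m + 1) := pow_le_pow_right₀ (by norm_num) (by omega)
          _ = 2 * w := by rw [hw]; ring
      have hle : (2 : ℤ) ^ (2 * h - 1) ≤ 2 * w ^ 2 := by
        calc (2 : ℤ) ^ (2 * h - 1) ≤ 2 ^ (2 * m + 1) :=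
              pow_le_pow_right₀ (by norm_num) (by omega)
          _ = 2 * w ^ 2 := by rw [hw]; ring
      have hpos : (0 : ℤ) < 2 ^ (2 * h - 1) := by positivity
      have d : (2 : ℤ) ^ (m + 1 + 1) ∣ x ^ 2 - 1 ^ 2 := by
        have e : (2 : ℤ) ^ (m + 1 + 1) = 4 * w := by rw [hw]; ring
        have : x ^ 2 - 1 ^ 2 = 2 ^ (2 * h - 1) + 4 * w := by rw [heq]; ring
        rw [this, ← e]
        exact dvd_add (pow_dvd_pow _ (by omega)) (dvd_refl _)
      have e : (2 : ℤ) ^ (m + 1) = 2 * w := by rw [hw]; ring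
      rcases two_adic_split x 1 _ hxo odd_one d with h0 | h0
      · rw [e] at h0
        have hx1 : 1 < x := by nlinarith
        have := Int.le_of_dvd (by linarith) h0
        linarith
      · rw [e] at h0
        have := Int.le_of_dvd (by linarith) h0
        have hxv : x = 2 * w - 1 := by linarith
        subst hxv
        nlinarith

lemma even_case (c b : ℕ) (x : ℤ) (hc : 0 < c) (hb : 0 < b) (hbc : b ≤ 2 * c) (hx : 0 < x)
    (heq : x ^ 2 = 2 ^ (2 * c) + 2 ^ b + 1) : b = c + 1 ∧ x = 2 ^ c + 1 := by
  obtain ⟨w, hw⟩ : ∃ w : ℤ, w = 2 ^ c := ⟨_, rfl⟩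
  have hw0 : 0 < w := by rw [hw]; positivity
  have e : (2 : ℤ) ^ (2 * c) = w ^ 2 := by rw [hw]; ring
  rw [e] at heq
  have hb0 : (0 : ℤ) < 2 ^ b := by positivity
  have h1 : w + 1 ≤ x := by
    by_contra h
    have : x ≤ w := by linarith
    nlinarith
  have h2 : 2 * w ≤ 2 ^ b := by nlinarith
  have h3 : c + 1 ≤ b := by
    have : (2 : ℤ) ^ (c + 1) ≤ 2 ^ b := by rw [pow_succ', ← hw]; exact h2
    exact (pow_le_pow_iff_right₀ (by norm_num)).1 this
  rcases Nat.eq_or_lt_of_le h3 with h4 | h4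
  · refine ⟨h4.symm, ?_⟩
    have e2 : (2 : ℤ) ^ (c + 1) = 2 * w := by rw [hw]; ring
    rw [← h4, e2] at heq
    rw [← hw]
    have : (x - (w + 1)) * (x + (w + 1)) = 0 := by linear_combination heq
    rcases mul_eq_zero.1 this with h | h <;> linarith
  · exfalso
    have hle : (2 : ℤ) ^ b ≤ w ^ 2 := by
      rw [← e]; exact pow_le_pow_right₀ (by norm_num) hbc
    have hxlt : x < 2 * w := by
      by_contra h
      have : 2 * w ≤ x := by linarith
      have : 4 ≤ w := by
        rw [hw]
        calc (4 : ℤ) = 2 ^ 2 := by norm_num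
          _ ≤ 2 ^ c := pow_le_pow_right₀ (by norm_num) (by omega)
      nlinarith
    have hw4 : 4 ≤ w := by
      rw [hw]
      calc (4 : ℤ) = 2 ^ 2 := by norm_num
        _ ≤ 2 ^ c := pow_le_pow_right₀ (by norm_num) (by omega)
    obtain ⟨d, rfl⟩ : ∃ d, b = d + 1 := ⟨b - 1, by omega⟩
    have hd : 2 * w ≤ 2 ^ d := by
      rw [hw, ← pow_succ']; exact pow_le_pow_right₀ (by norm_num) (by omega)
    have hdiv : (2 : ℤ) ^ (d + 1) ∣ x ^ 2 - 1 ^ 2 := by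
      have : x ^ 2 - 1 ^ 2 = 2 ^ (2 * c) + 2 ^ (d + 1) := by rw [heq, e]; ring
      rw [this]
      exact dvd_add (pow_dvd_pow _ hbc) (dvd_refl _)
    have hxo : Odd x := by
      have h2 : Odd (x ^ 2) := by
        obtain ⟨r, hr⟩ := (dvd_pow_self (2 : ℤ) (by omega : d + 1 ≠ 0)).trans hdiv
        exact ⟨r, by linarith⟩
      exact (Int.odd_pow' (by norm_num)).1 h2
    rcases two_adic_split x 1 d hxo odd_one hdiv with h | h
    · have := Int.le_of_dvd (by linarith) h
      linarith
    · have := Int.le_of_dvd (by linarith) h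
      have : x = 2 * w - 1 := by linarith
      subst this
      nlinarith

lemma odd_case_large (a b : ℕ) (x : ℤ) (hx : 0 < x) (ha : a % 2 = 1) (hb : 16 ≤ b)
    (hab : b < a) (heq : x ^ 2 = 2 ^ a + 2 ^ b + 1) : False := by
  obtain ⟨m, rfl⟩ : ∃ m, b = m + 2 := ⟨b - 2, by omega⟩
  obtain ⟨h, rfl⟩ : ∃ h, a = 2 * h - 1 := ⟨(a + 1) / 2, by omega⟩
  have hm : 14 ≤ m := by omega
  have hle : (2 : ℤ) ^ (m + 2) ≤ 2 ^ (2 * h - 1) := pow_le_pow_right₀ (by norm_num) hab.le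
  have hle2 : (2 : ℤ) * 2 ^ (m + 2) ≤ 2 ^ (2 * h - 1) := by
    rw [← pow_succ']; exact pow_le_pow_right₀ (by norm_num) hab
  have h4 : (4 : ℤ) ≤ 2 ^ (h - 1) := by
    calc (4 : ℤ) = 2 ^ 2 := by norm_num
      _ ≤ 2 ^ (h - 1) := pow_le_pow_right₀ (by norm_num) (by omega)
  have hsm : (2 : ℤ) ^ (m + 2) + 1 < 2 * 2 ^ (2 * h - 1) := by
    have : (1 : ℤ) < 2 ^ (2 * h - 1) := one_lt_pow₀ (by norm_num) (by omega)
    linarith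
  have heven : (2 : ℤ) ^ (2 * h - 1) = 2 * (2 ^ (h - 1)) ^ 2 := by
    rw [← pow_mul, ← pow_succ']; congr 1; omega
  have hh : (2 : ℤ) ^ h = 2 * 2 ^ (h - 1) := by
    rw [← pow_succ']; congr 1; omega
  have hp : (0 : ℤ) < 2 ^ (h - 1) := by positivity
  have hpm : (0 : ℤ) < 2 ^ (m + 2) := by positivity
  have hxl : 2 ^ (h - 1) < x := by
    by_contra hc
    have : x ≤ 2 ^ (h - 1) := by linarith
    nlinarith
  have hxu : x < 2 ^ h := by
    by_contra hc
    have : 2 ^ h ≤ x := by linarith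
    nlinarith
  have heq' : x ^ 2 = 2 ^ (2 * h - 1) + 4 * 2 ^ m + 1 := by rw [heq]; ring
  have hb := height_bound m h x hm (by omega) hx heq' hxu
  obtain ⟨n, hn⟩ : ∃ n, n = (4 * h - 12) / (4 * m + 17) := ⟨_, rfl⟩
  have h1 := Nat.div_mul_le_self (4 * h - 12) (4 * m + 17)
  have h2 := Nat.lt_div_mul_add (a := 4 * h - 12) (show 0 < 4 * m + 17 by omega)
  rw [← hn] at h1 h2
  have hn2 : 2 ≤ n := by
    rw [hn, Nat.le_div_iff_mul_le (by omega)]; omega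
  have hmn : 14 * n ≤ m * n := Nat.mul_le_mul_right n hm
  have e1 : n * (4 * m + 17) = 4 * (m * n) + 17 * n := by ring
  have e2 : 8 * m * n = 8 * (m * n) := by ring
  have e3 : (4 * m + 17) * n = 4 * (m * n) + 17 * n := by ring
  exact large_no_sol m h n x hm (by omega) hx heq' hxl hxu (by omega) (by omega)

theorem two_pow_add_two_pow_add_one_eq_sq
    (a b x : ℕ) (ha : 0 < a) (hb : 0 < b) (hx : 0 < x) (hab : a ≥ b)
    (heq : 2 ^ a + 2 ^ b + 1 = x ^ 2) :
    (∃ t : ℕ, 0 < t ∧ a = 2 * t ∧ b = t + 1 ∧ x = 2 ^ t + 1) ∨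
      (a, b, x) = (5, 4, 7) ∨ (a, b, x) = (9, 4, 23) := by
  have heqZ : (x : ℤ) ^ 2 = 2 ^ a + 2 ^ b + 1 := by exact_mod_cast heq.symm
  have hxZ : (0 : ℤ) < x := by exact_mod_cast hx
  rcases Nat.even_or_odd' a with ⟨c, rfl | rfl⟩
  · left
    obtain ⟨h1, h2⟩ := even_case c b x (by omega) hb hab hxZ heqZ
    exact ⟨c, by omega, rfl, h1, by exact_mod_cast h2⟩
  · right
    -- `b` is divisible by `4`
    have hb4 : b % 4 = 0 := by
      have m3 : (2 ^ (2 * c + 1) + 2 ^ b + 1) % 3 = x ^ 2 % 3 := by rw [heq]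
      have m5 : (2 ^ (2 * c + 1) + 2 ^ b + 1) % 5 = x ^ 2 % 5 := by rw [heq]
      have a3 : 2 ^ (2 * c + 1) % 3 = 2 := by
        rw [pow_succ, pow_mul, Nat.mul_mod, Nat.pow_mod]; norm_num
      have a5 : 2 ^ (2 * c + 1) % 5 = 2 ∨ 2 ^ (2 * c + 1) % 5 = 3 := by
        rcases Nat.even_or_odd' c with ⟨d, rfl | rfl⟩
        · left
          rw [show 2 * (2 * d) + 1 = 4 * d + 1 by ring, pow_succ, pow_mul, Nat.mul_mod,
            Nat.pow_mod]; norm_num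
        · right
          rw [show 2 * (2 * d + 1) + 1 = 4 * d + 3 by ring, pow_add, pow_mul, Nat.mul_mod,
            Nat.pow_mod]; norm_num
      have x3 : x ^ 2 % 3 = 0 ∨ x ^ 2 % 3 = 1 := by
        have : x % 3 < 3 := Nat.mod_lt _ (by norm_num)
        rw [Nat.pow_mod]
        interval_cases x % 3 <;> simp
      have x5 : x ^ 2 % 5 = 0 ∨ x ^ 2 % 5 = 1 ∨ x ^ 2 % 5 = 4 := by
        have : x % 5 < 5 := Nat.mod_lt _ (by norm_num)
        rw [Nat.pow_mod]
        interval_cases x % 5 <;> simp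
      have hbe := Nat.div_add_mod b 4
      have hlt : b % 4 < 4 := Nat.mod_lt _ (by norm_num)
      have b3 : 2 ^ b % 3 = 2 ^ (b % 4) % 3 := by
        conv_lhs => rw [← hbe, pow_add, pow_mul, Nat.mul_mod, Nat.pow_mod]
        norm_num
      have b5 : 2 ^ b % 5 = 2 ^ (b % 4) % 5 := by
        conv_lhs => rw [← hbe, pow_add, pow_mul, Nat.mul_mod, Nat.pow_mod]
        norm_num
      generalize b % 4 = r at *
      interval_cases r <;> norm_num at b3 b5 <;> omega
    rcases Nat.lt_or_ge b 16 with hs | hs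
    · have hcase : b = 4 ∨ b = 8 ∨ b = 12 := by omega
      rcases Nat.lt_or_ge c 5 with hc | hc
      · rcases hcase with rfl | rfl | rfl
        · have hc' : c = 2 ∨ c = 3 ∨ c = 4 := by omega
          rcases hc' with rfl | rfl | rfl
          · left
            have h0 : x ^ 2 = 49 := heq.symm.trans (by norm_num)
            have h1 : 6 < x := by nlinarith
            have h2 : x < 8 := by nlinarith
            have : x = 7 := by omega
            rw [this]
          · exfalso
            have h0 : x ^ 2 = 145 := heq.symm.trans (by norm_num)
            have h1 : 12 < x := by nlinarith
            have h2 : x < 13 := by nlinarith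
            omega
          · right
            have h0 : x ^ 2 = 529 := heq.symm.trans (by norm_num)
            have h1 : 22 < x := by nlinarith
            have h2 : x < 24 := by nlinarith
            have : x = 23 := by omega
            rw [this]
        · exfalso
          have hc' : c = 4 := by omega
          subst hc'
          have h0 : x ^ 2 = 769 := heq.symm.trans (by norm_num)
          have h1 : 27 < x := by nlinarith
          have h2 : x < 28 := by nlinarith
          omega
        · omega
      · exfalso
        have e : x ^ 2 = 2 * (2 ^ c) ^ 2 + (2 ^ b + 1) := by rw [← heq]; ring
        refine pell_no_sol (2 ^ b + 1) ?_ x c hc e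
        rcases hcase with rfl | rfl | rfl <;> simp
    · exact (odd_case_large (2 * c + 1) b x hxZ (by omega) hs (by omega) heqZ).elim
end

section
/- The equation 2^a − 2^b + 1 = x^2 has no solutions in positive integers (a, b, x) with a > b except for the following: (a, b, x) = (2t, t+1, 2^t − 1) for some integer t > 1; (a, b, x) = (5, 3, 5); (a, b, x) = (7, 3, 11); and (a, b, x) = (15, 3, 181). -/
/-- Lucas sequence `U_{n+2} = U_{n+1} - Q U_n`. -/
def lucU (Q : ℤ) : ℕ → ℤ
  | 0 => 0
  | 1 => 1
  | (n + 2) => lucU Q (n + 1) - Q * lucU Q n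

theorem lucU_rec (Q : ℤ) (n : ℕ) : lucU Q (n + 2) = lucU Q (n + 1) - Q * lucU Q n := rfl

/-- Descent. -/
theorem descent (k : ℕ) (Q : ℤ) (hQ : Q = 2 ^ (k + 1)) :
    ∀ (m : ℕ) (u v : ℤ), Odd v → 4 ∣ u - v → u ^ 2 + (4 * Q - 1) * v ^ 2 = 2 ^ (m + 2) →
      ∃ n : ℕ, m = (k + 1) * n ∧
        ((v = lucU Q n ∧ u = 2 * lucU Q (n + 1) - lucU Q n) ∨
         (v = - lucU Q n ∧ u = -(2 * lucU Q (n + 1) - lucU Q n))) := by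
  have hQ2 : (2 : ℤ) ≤ Q := by
    rw [hQ, pow_succ]
    have : (1 : ℤ) ≤ 2 ^ k := one_le_pow₀ (by norm_num)
    linarith
  intro m
  induction m using Nat.strong_induction_on with
  | _ m ih =>
    intro u v hv huv heq
    have hu : Odd u := by
      obtain ⟨c, hc⟩ := hv
      obtain ⟨d, hd⟩ := huv
      exact ⟨c + 2 * d, by linarith⟩
    have hv1 : 1 ≤ v ^ 2 := by
      have : v ≠ 0 := by rintro rfl; exact absurd hv (by decide)
      have := sq_pos_of_ne_zero this
      linarith
    have hu1 : 1 ≤ u ^ 2 := by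
      have : u ≠ 0 := by rintro rfl; exact absurd hu (by decide)
      have := sq_pos_of_ne_zero this
      linarith
    have h4Q : 4 * Q = 2 ^ (k + 1 + 2) := by rw [hQ, pow_add _ (k + 1) 2]; ring
    have hmk : k + 1 ≤ m := by
      have h1 : (2 : ℤ) ^ (k + 1 + 2) ≤ 2 ^ (m + 2) := by
        rw [← h4Q, ← heq]; nlinarith
      have := (pow_le_pow_iff_right₀ (by norm_num : (1 : ℤ) < 2)).1 h1
      omega
    obtain ⟨m', rfl⟩ := Nat.exists_eq_add_of_le hmk
    -- divisibility
    have hpow : (2 : ℤ) ^ (k + 1 + m' + 2) = 4 * Q * 2 ^ m' := by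
      rw [h4Q, ← pow_add]; congr 1; ring
    have hdiv : 2 * Q ∣ v - u := by
      have hw : ∃ w, u + v = 2 * w ∧ Odd w := by
        obtain ⟨c, hc⟩ := hv
        obtain ⟨d, hd⟩ := huv
        exact ⟨v + 2 * d, by linarith, ⟨c + d, by linarith⟩⟩
      obtain ⟨w, hw, hwo⟩ := hw
      have h1 : 2 * (2 * Q) ∣ 2 * (w * (v - u)) := by
        refine ⟨v ^ 2 - 2 ^ m', ?_⟩
        have : 2 * (w * (v - u)) = v ^ 2 - u ^ 2 := by
          linear_combination (u - v) * hw
        rw [this]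
        linear_combination - heq - hpow
      have h2 : 2 * Q ∣ w * (v - u) := Int.dvd_of_mul_dvd_mul_left (by norm_num) h1
      have hcop : IsCoprime (2 * Q) w := by
        rw [show 2 * Q = 2 ^ (k + 2) by rw [hQ]; ring]
        apply IsCoprime.pow_left
        obtain ⟨c, hc⟩ := hwo
        exact ⟨-c, 1, by linarith⟩
      exact hcop.dvd_of_dvd_mul_left h2
    obtain ⟨v', hv'⟩ := hdiv
    have heq' : (2 * v - v') ^ 2 + (4 * Q - 1) * v' ^ 2 = 2 ^ (m' + 2) := by
      have hu' : u = v - 2 * Q * v' := by linarith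
      rw [hpow, hu'] at heq
      have h3 : Q * ((2 * v - v') ^ 2 + (4 * Q - 1) * v' ^ 2) = Q * 2 ^ (m' + 2) := by
        rw [pow_add]; linear_combination heq
      exact mul_left_cancel₀ (by linarith) h3
    rcases Nat.eq_zero_or_pos m' with h0 | hpos
    · subst h0
      have hv0 : v' = 0 := by
        by_contra hne
        have := sq_pos_of_ne_zero hne
        have h5 : 1 ≤ v' ^ 2 := by linarith
        norm_num at heq'
        nlinarith [sq_nonneg (2 * v - v')]
      subst hv0
      norm_num at heq'
      have h6 : v ^ 2 = 1 := by linarith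
      refine ⟨1, by ring, ?_⟩
      rcases sq_eq_sq_iff_eq_or_eq_neg.1 (h6.trans (one_pow 2).symm) with h | h
      · left; simp [lucU]; constructor <;> linarith
      · right; simp [lucU]; constructor <;> linarith
    · have hodd : Odd v' := by
        by_contra hne
        rw [Int.not_odd_iff_even] at hne
        obtain ⟨c, hc⟩ := hne
        obtain ⟨e, he⟩ := hv
        obtain ⟨j, rfl⟩ : ∃ j, m' = j + 1 := ⟨m' - 1, by omega⟩
        rw [hc] at heq'
        have h7 : 2 * (v - c) ^ 2 = 2 * (2 ^ j * 2 * 1 - (4 * Q - 1) * c ^ 2 + (v - c) ^ 2 - 2 ^ j * 2 + (4 * Q - 1) * c ^ 2) := by ring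
        have h8 : (v - c) ^ 2 + (4 * Q - 1) * c ^ 2 = 2 * 2 ^ j := by
          rw [show j + 1 + 2 = j + 3 by ring, pow_add] at heq'
          linarith
        have h9 : v ^ 2 = 2 * (2 ^ j + v * c - 2 * Q * c ^ 2) := by linear_combination h8
        have h10 : Odd (v ^ 2) := Odd.pow ⟨e, he⟩
        rw [h9] at h10
        exact absurd h10 (by simp)
      have h4 : 4 ∣ (2 * v - v') - v' := by
        obtain ⟨c, hc⟩ := hv
        obtain ⟨d, hd⟩ := hodd
        exact ⟨c - d, by linarith⟩
      obtain ⟨n, hn, h⟩ := ih m' (by omega) (2 * v - v') v' hodd h4 heq'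
      refine ⟨n + 1, by rw [hn]; ring, ?_⟩
      rw [show n + 1 + 1 = n + 2 by ring, lucU_rec]
      rcases h with ⟨h1, h2⟩ | ⟨h1, h2⟩
      · left
        have h3 : v = lucU Q (n + 1) := by linarith
        refine ⟨h3, ?_⟩
        rw [← h3, ← h1]; linarith
      · right
        have h3 : v = -lucU Q (n + 1) := by linarith
        refine ⟨h3, ?_⟩
        linear_combination -hv' + h3 - 2 * Q * h1

/-! ### The case `Q ≥ 4` -/

theorem lucU_mod (Q : ℤ) (n : ℕ) : Q ∣ lucU Q (n + 1) - 1 := by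
  induction n with
  | zero => simp [lucU]
  | succ n ih =>
    obtain ⟨c, hc⟩ := ih
    refine ⟨c - lucU Q n, ?_⟩
    rw [show n + 1 + 1 = n + 2 by ring, lucU_rec]
    linear_combination hc

theorem lucU_mod_sq (Q : ℤ) (n : ℕ) : Q ^ 2 ∣ lucU Q (n + 2) - (1 - n * Q) := by
  induction n with
  | zero => simp [lucU]
  | succ n ih =>
    obtain ⟨c, hc⟩ := ih
    obtain ⟨d, hd⟩ := lucU_mod Q n
    refine ⟨c - d, ?_⟩
    rw [show n + 1 + 2 = (n + 1) + 2 by ring, lucU_rec, show n + 1 + 1 = n + 2 by ring]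
    push_cast
    linear_combination hc - Q * hd

theorem lucU_add (Q : ℤ) (m n : ℕ) :
    lucU Q (m + n + 1) = lucU Q (m + 1) * lucU Q (n + 1) - Q * lucU Q m * lucU Q n ∧
    lucU Q (m + n + 2) = lucU Q (m + 2) * lucU Q (n + 1) - Q * lucU Q (m + 1) * lucU Q n := by
  induction m with
  | zero => 
    simp only [Nat.zero_add, lucU_rec Q n]
    simp [lucU]
  | succ m ih =>
    obtain ⟨h1, h2⟩ := ih
    refine ⟨by rw [show m + 1 + n + 1 = m + n + 2 by ring]; exact h2, ?_⟩
    rw [show m + 1 + n + 2 = (m + n + 1) + 2 by ring, lucU_rec, lucU_rec Q (m + 1),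
      show m + n + 1 + 1 = m + n + 2 by ring, show m + 1 + 1 = m + 2 by ring, h1, h2]
    have := lucU_rec Q m
    linear_combination (Q * lucU Q n) * this

theorem lucU_eq_one_mod (Q : ℤ) (hQ : 4 ≤ Q) (n : ℕ) (h : lucU Q (n + 2) = 1) : Q ∣ n := by
  obtain ⟨c, hc⟩ := lucU_mod_sq Q n
  refine ⟨c, ?_⟩
  have : Q * n = Q * (Q * c) := by rw [h] at hc; linear_combination hc
  exact mul_left_cancel₀ (by linarith) this

theorem lucU_big (Q : ℤ) (hQ : 4 ≤ Q) (hev : 2 ∣ Q) (n : ℕ)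
    (h : lucU Q n = 1 ∨ lucU Q n = -1) : n = 1 ∨ n = 2 := by
  have key : ∀ n, lucU Q (n + 1) = 1 ∨ lucU Q (n + 1) = -1 → lucU Q (n + 1) = 1 := by
    rintro n (h | h)
    · exact h
    · have := lucU_mod Q n
      rw [h] at this
      have := Int.le_of_dvd (by norm_num) ((dvd_neg).2 this)
      linarith
  match n, h with
  | 0, h => simp [lucU] at h
  | 1, h => left; rfl
  | (n + 2), h =>
    have h1 := key (n + 1) h
    have hd := lucU_eq_one_mod Q hQ n h1
    have h2 : 2 ∣ n := by exact_mod_cast hev.trans hd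
    obtain ⟨j, rfl⟩ := h2
    have h3 : lucU Q (j + 1) ∣ 1 := by
      have := (lucU_add Q (j + 1) j).1
      rw [show j + 1 + j + 1 = 2 * j + 2 by ring] at this
      refine ⟨lucU Q (j + 1 + 1) - Q * lucU Q j, ?_⟩
      have h1' : lucU Q (2 * j + 2) = 1 := h1
      rw [← h1', this]; ring
    have h4 := key j (Int.isUnit_iff.1 (isUnit_of_dvd_one h3))
    match j, h4 with
    | 0, _ => right; rfl
    | (i + 1), h4 =>
      have h5 := lucU_eq_one_mod Q hQ i h4
      have h6 : Q ∣ 2 := by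
        have := dvd_sub hd (h5.mul_left 2)
        push_cast at this
        ring_nf at this
        exact this
      have := Int.le_of_dvd (by norm_num) h6
      linarith

/-! ### The case `Q = 2` -/

theorem pow_seven_step {R : Type*} [CommRing R] (s c w t : R) (hs : s ^ 2 = -7) :
    ∃ w', (1 + t * (c * s + 7 * w)) ^ 7 = 1 + t * 7 * (c * s + 7 * w') := by
  obtain ⟨y, hy⟩ : ∃ y, (c * s + 7 * w) ^ 2 = 7 * y :=
    ⟨-c ^ 2 + 2 * c * s * w + 7 * w ^ 2, by linear_combination c ^ 2 * hs⟩
  refine ⟨w + (3 * t * y + 5 * t ^ 2 * y * (c * s + 7 * w) + 35 * t ^ 3 * y ^ 2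
    + 21 * t ^ 4 * y ^ 2 * (c * s + 7 * w) + 49 * t ^ 5 * y ^ 3
    + 7 * t ^ 6 * y ^ 3 * (c * s + 7 * w)), ?_⟩
  have e : ∀ z : R, z ^ 2 = 7 * y → (1 + t * z) ^ 7 = 1 + t * 7 * (z + 7 * (3 * t * y +
      5 * t ^ 2 * y * z + 35 * t ^ 3 * y ^ 2
    + 21 * t ^ 4 * y ^ 2 * z + 49 * t ^ 5 * y ^ 3 + 7 * t ^ 6 * y ^ 3 * z)) := by
    intro z hz
    have h3 : z ^ 3 = 7 * y * z := by linear_combination z * hz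
    have h4 : z ^ 4 = 49 * y ^ 2 := by linear_combination (z ^ 2 + 7 * y) * hz
    have h5 : z ^ 5 = 49 * y ^ 2 * z := by linear_combination z * h4
    have h6 : z ^ 6 = 343 * y ^ 3 := by linear_combination z ^ 2 * h4 + 49 * y ^ 2 * hz
    have h7 : z ^ 7 = 343 * y ^ 3 * z := by linear_combination z * h6
    linear_combination 21 * t ^ 2 * hz + 35 * t ^ 3 * h3 + 35 * t ^ 4 * h4 + 21 * t ^ 5 * h5
      + 7 * t ^ 6 * h6 + t ^ 7 * h7
  rw [e _ hy]; ring

theorem pow_k_step {R : Type*} [CommRing R] (s c w t : R) (hs : s ^ 2 = -7) (k : ℕ) :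
    ∃ w', (1 + t * (c * s + 7 * w)) ^ k = 1 + t * (k * c * s + 7 * w') := by
  induction k with
  | zero => exact ⟨0, by simp⟩
  | succ k ih =>
    obtain ⟨w', h⟩ := ih
    rw [pow_succ, h]
    refine ⟨w' + w + t * (-k * c ^ 2 + k * c * s * w + c * s * w' + 7 * w * w'), ?_⟩
    push_cast
    linear_combination (t ^ 2 * k * c ^ 2) * hs

abbrev QA := QuadraticAlgebra ℤ (-2) 1

def qal : QA := ⟨0, 1⟩
def qs : QA := ⟨-1, 2⟩

theorem qs_sq : qs ^ 2 = -7 := by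
  decide +kernel

theorem qal_six : qal ^ 6 = 1 + 1 * ((-1) * qs + 7 * qal) := by
  decide +kernel

theorem qal_pow (n : ℕ) : qal ^ (n + 1) = ⟨-2 * lucU 2 n, lucU 2 (n + 1)⟩ := by
  induction n with
  | zero => simp [lucU, qal]
  | succ n ih =>
    rw [pow_succ, ih, qal, QuadraticAlgebra.mk_mul_mk, show n + 1 + 1 = n + 2 by ring, lucU_rec]
    ext <;> simp <;> ring

theorem qal_lte (l : ℕ) : ∃ w, qal ^ (6 * 7 ^ l) = 1 + 7 ^ l * ((-1) * qs + 7 * w) := by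
  induction l with
  | zero => exact ⟨qal, by simpa using qal_six⟩
  | succ l ih =>
    obtain ⟨w, h⟩ := ih
    obtain ⟨w', h'⟩ := pow_seven_step qs (-1) w (7 ^ l) qs_sq
    refine ⟨w', ?_⟩
    rw [pow_succ, ← mul_assoc, pow_mul, h, h', pow_succ]

theorem lucU_seven (m k : ℕ) (hk : 0 < k) (h : lucU 2 (m + 1 + 6 * k) = lucU 2 (m + 1)) :
    7 ∣ 2 * lucU 2 (m + 2) - lucU 2 (m + 1) := by
  obtain ⟨l, j, hj, rfl⟩ := Nat.exists_eq_pow_mul_and_not_dvd hk.ne' 7 (by norm_num)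
  obtain ⟨w, hw⟩ := qal_lte l
  obtain ⟨w', hw'⟩ := pow_k_step qs (-1) w (7 ^ l) qs_sq j
  rw [← hw, ← pow_mul] at hw'
  have h1 := qal_pow (m + 6 * (7 ^ l * j))
  rw [show m + 6 * (7 ^ l * j) + 1 = (m + 1) + 6 * 7 ^ l * j by ring, pow_add, hw',
    qal_pow] at h1
  have h2 := congrArg QuadraticAlgebra.im h1
  rw [show m + 1 + 6 * 7 ^ l * j = m + 1 + 6 * (7 ^ l * j) by ring, h] at h2
  have h70 : (7 : QA) = ⟨7, 0⟩ := by decide +kernel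
  have h7 : (7 : QA) ^ l = ⟨7 ^ l, 0⟩ := by
    induction l with
    | zero => rfl
    | succ l ih =>
      clear * - h70
      generalize l + 1 = i
      induction i with
      | zero => rfl
      | succ i ih => rw [pow_succ, ih, h70, QuadraticAlgebra.mk_mul_mk]; ext <;> simp [pow_succ]
  have hjc : (j : QA) = ⟨(j : ℤ), 0⟩ := by ext <;> simp
  obtain ⟨p, q⟩ := w'
  rw [h7, h70, hjc] at h2
  simp [qs] at h2
  have hi : (1 : QA).im = 0 := rfl
  have hr : (1 : QA).re = 1 := rfl
  rw [hi, hr] at h2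
  have hrec := lucU_rec 2 m
  have h3 : (7 : ℤ) ^ l * (j * (2 * lucU 2 (m + 2) - lucU 2 (m + 1))) =
      7 ^ l * (7 * (-2 * lucU 2 m * q + lucU 2 (m + 1) * (p + q))) := by
    linear_combination -h2 + 7 ^ l * j * 2 * hrec
  have h4 := mul_left_cancel₀ (by positivity) h3
  have hp : Prime (7 : ℤ) := by norm_num
  rcases hp.dvd_or_dvd ⟨_, h4⟩ with h5 | h5
  · exact absurd (by exact_mod_cast h5) hj
  · exact h5

theorem lucU_period (n : ℕ) : 7 ∣ lucU 2 (n + 42) - lucU 2 n ∧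
    7 ∣ lucU 2 (n + 43) - lucU 2 (n + 1) := by
  induction n with
  | zero => decide +kernel
  | succ n ih =>
    have h1 := lucU_rec 2 (n + 42)
    have h2 := lucU_rec 2 n
    simp only [Nat.add_assoc, Nat.reduceAdd] at *
    omega

theorem lucU_period' (r q : ℕ) : 7 ∣ lucU 2 (r + 42 * q) - lucU 2 r := by
  induction q with
  | zero => simp
  | succ q ih =>
    have := (lucU_period (r + 42 * q)).1
    rw [show r + 42 * (q + 1) = r + 42 * q + 42 by ring]
    omega

theorem lucU_mod8 (n : ℕ) : lucU 2 (2 * n + 3) % 8 = 7 ∧ lucU 2 (2 * n + 4) % 8 = 5 := by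
  induction n with
  | zero => decide +kernel
  | succ n ih =>
    have h1 := lucU_rec 2 (2 * n + 3)
    have h2 := lucU_rec 2 (2 * n + 4)
    rw [show 2 * (n + 1) + 3 = 2 * n + 5 by ring, show 2 * (n + 1) + 4 = 2 * n + 6 by ring]
    simp only [Nat.add_assoc, Nat.reduceAdd] at *
    omega

theorem lucU_two (n : ℕ) (h : lucU 2 n = 1 ∨ lucU 2 n = -1) :
    n = 1 ∨ n = 2 ∨ n = 3 ∨ n = 5 ∨ n = 13 := by
  by_cases hn : n < 3
  · interval_cases n
    · simp [lucU] at h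
    · simp
    · simp
  obtain ⟨j, hj⟩ := Nat.even_or_odd' n
  rcases hj with rfl | rfl
  · have := (lucU_mod8 (j - 2)).2
    rw [show 2 * (j - 2) + 4 = 2 * j by omega] at this
    omega
  have hm := (lucU_mod8 (j - 1)).1
  rw [show 2 * (j - 1) + 3 = 2 * j + 1 by omega] at hm
  have h' : lucU 2 (2 * j + 1) = -1 := by omega
  generalize hN : 2 * j + 1 = N at *
  have hp := lucU_period' (N % 42) (N / 42)
  rw [Nat.mod_add_div, h'] at hp
  have hr : ∀ r < 42, r % 2 = 1 → (7 : ℤ) ∣ -1 - lucU 2 r → r = 3 ∨ r = 5 ∨ r = 13 := by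
    decide +kernel
  have fin : ∀ m, lucU 2 (m + 1) = -1 → ¬ (7 ∣ 2 * lucU 2 (m + 2) - lucU 2 (m + 1)) →
      N % 42 = m + 1 → N = m + 1 := by
    intro m hm hnd hmod
    by_contra hne
    have hq : 0 < N / 42 := by omega
    refine hnd (lucU_seven m (7 * (N / 42)) (by omega) ?_)
    rw [hm, show m + 1 + 6 * (7 * (N / 42)) = N by omega, h']
  rcases hr (N % 42) (Nat.mod_lt _ (by norm_num)) (by omega) hp with h3 | h3 | h3
  · right; right; left; exact fin 2 (by decide +kernel) (by decide +kernel) h3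
  · right; right; right; left; exact fin 4 (by decide +kernel) (by decide +kernel) h3
  · right; right; right; right; exact fin 12 (by decide +kernel) (by decide +kernel) h3

theorem two_pow_sub_two_pow_add_one_eq_sq
    (a b x : ℕ) (ha : 0 < a) (hb : 0 < b) (hx : 0 < x) (hab : a > b)
    (heq : 2 ^ a - 2 ^ b + 1 = x ^ 2) :
    (∃ t : ℕ, 1 < t ∧ a = 2 * t ∧ b = t + 1 ∧ x = 2 ^ t - 1) ∨
      (a, b, x) = (5, 3, 5) ∨ (a, b, x) = (7, 3, 11) ∨ (a, b, x) = (15, 3, 181) := by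
  have hle : 2 ^ b ≤ 2 ^ a := Nat.pow_le_pow_right (by norm_num) hab.le
  have heq' : 2 ^ a + 1 = x ^ 2 + 2 ^ b := by omega
  have hxo : x % 2 = 1 := by
    have h1 : 2 ∣ 2 ^ a := dvd_pow_self 2 (by omega)
    have h2 : 2 ∣ 2 ^ b := dvd_pow_self 2 (by omega)
    have h3 : x ^ 2 % 2 = 1 := by omega
    rcases Nat.mod_two_eq_zero_or_one x with h | h
    · simp [Nat.pow_mod, h] at h3
    · exact h
  have hx8 : x ^ 2 % 8 = 1 := by
    have : x % 8 = 1 ∨ x % 8 = 3 ∨ x % 8 = 5 ∨ x % 8 = 7 := by omega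
    rcases this with h | h | h | h <;> simp [Nat.pow_mod, h]
  have hb3 : 3 ≤ b := by
    by_contra hlt
    have hb12 : b = 1 ∨ b = 2 := by omega
    by_cases ha3 : 3 ≤ a
    · have h1 : 2 ^ 3 ∣ 2 ^ a := pow_dvd_pow 2 ha3
      rcases hb12 with rfl | rfl <;> omega
    · have ha2 : a = 2 := by omega
      have hb1 : b = 1 := by omega
      subst ha2; subst hb1
      omega
  obtain ⟨k, rfl⟩ : ∃ k, b = k + 3 := ⟨b - 3, by omega⟩
  obtain ⟨m, rfl⟩ : ∃ m, a = m + 2 := ⟨a - 2, by omega⟩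
  have hZ : (2 : ℤ) ^ (m + 2) + 1 = x ^ 2 + 2 ^ (k + 3) := by exact_mod_cast heq'
  have hQ : (2 : ℤ) ^ (k + 3) = 4 * 2 ^ (k + 1) := by ring
  have hd : ∃ n : ℕ, m = (k + 1) * n ∧
      (lucU (2 ^ (k + 1)) n = 1 ∨ lucU (2 ^ (k + 1)) n = -1) := by
    obtain ⟨u, hu, hu2⟩ : ∃ u : ℤ, 4 ∣ u - 1 ∧ u ^ 2 = x ^ 2 := by
      have : x % 4 = 1 ∨ x % 4 = 3 := by omega
      rcases this with h | h
      · exact ⟨x, by omega, rfl⟩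
      · exact ⟨-x, by omega, by ring⟩
    obtain ⟨n, hn, h⟩ := descent k _ rfl m u 1 (by decide) hu (by rw [hu2]; linarith)
    refine ⟨n, hn, ?_⟩
    rcases h with ⟨h, _⟩ | ⟨h, _⟩
    · left; exact h.symm
    · right; linarith
  obtain ⟨n, rfl, hn⟩ := hd
  have hn1 : n ≠ 1 := by rintro rfl; omega
  have htwo : n = 2 → (∃ t : ℕ, 1 < t ∧ (k + 1) * n + 2 = 2 * t ∧ k + 3 = t + 1 ∧
      x = 2 ^ t - 1) := by
    rintro rfl
    refine ⟨k + 2, by omega, by ring, rfl, ?_⟩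
    have h1 : 1 ≤ 2 ^ (k + 2) := Nat.one_le_two_pow
    have h2 : (x : ℤ) ^ 2 = (2 ^ (k + 2) - 1) ^ 2 := by
      linear_combination -hZ
    have h3 : (x : ℤ) = 2 ^ (k + 2) - 1 := by
      have h1' : (1 : ℤ) ≤ 2 ^ (k + 2) := by exact_mod_cast h1
      exact (pow_left_inj₀ (by positivity) (by linarith) (by norm_num)).1 h2
    zify [h1]
    exact h3
  rcases Nat.eq_zero_or_pos k with rfl | hk
  · have hn' := lucU_two n (by simpa using hn)
    have hfin : ∀ y : ℕ, x ^ 2 = y ^ 2 → x = y := fun y h =>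
      (pow_left_inj₀ (Nat.zero_le _) (Nat.zero_le _) (by norm_num)).1 h
    rcases hn' with h | h | rfl | rfl | rfl
    · exact absurd h hn1
    · left; exact htwo h
    · right; left; simpa using hfin 5 (by omega)
    · right; right; left; simpa using hfin 11 (by omega)
    · right; right; right; simpa using hfin 181 (by omega)
  · left
    apply htwo
    have h4 : (4 : ℤ) ≤ 2 ^ (k + 1) := by
      calc (4 : ℤ) = 2 ^ 2 := by norm_num
        _ ≤ 2 ^ (k + 1) := pow_le_pow_right₀ (by norm_num) (by omega)
    have := lucU_big (2 ^ (k + 1)) h4 (dvd_pow_self 2 (by omega)) n hn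
    tauto
end

section
/- Let p be an odd prime and let a > b be positive integers, x a positive integer, and ε ∈ {1, −1}. If p^a + ε·p^b + 1 = x^2, then ε = −1 and (x, p, a, b) = (5, 3, 3, 1) or (x, p, a, b) = (11, 5, 3, 1). -/
lemma pell_small (r : ℤ) (hr : 2 ≤ r) : ∀ (m : ℕ) (X Y N : ℤ), Y.natAbs = m →
    X ^ 2 - (r ^ 2 + 1) * Y ^ 2 = N → |N| ≤ r → ∃ d : ℕ, N.natAbs = d ^ 2 := by
  intro m
  induction m using Nat.strong_induction_on with
  | _ m ih =>
    intro X Y N hm h hN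
    by_cases hY : Y = 0
    · subst hY
      refine ⟨X.natAbs, ?_⟩
      rw [← h]
      simp [Int.natAbs_pow]
    · have hY1 : 1 ≤ |Y| := Int.one_le_abs hY
      obtain ⟨hN1, hN2⟩ := abs_le.mp hN
      have h' : |X| ^ 2 - (r ^ 2 + 1) * |Y| ^ 2 = N := by rw [sq_abs, sq_abs]; exact h
      have hX0 : 0 ≤ |X| := abs_nonneg X
      have hm' : (|Y|).natAbs = m := by rw [Int.natAbs_abs]; exact hm
      generalize |X| = U at *
      generalize |Y| = V at *
      have hU2 : 2 ≤ U := by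
        by_contra hc
        have : U ≤ 1 := by omega
        nlinarith [mul_self_nonneg (V-1)]
      have key : (U - r * V) * (U + r * V) = V ^ 2 + N := by linarith [h', sq_nonneg U, (by ring : (U - r * V) * (U + r * V) = U^2 - r^2*V^2)]
      have hlt : |U - r * V| < V := by
        have hpos : 0 < U + r * V := by nlinarith
        rw [abs_lt]
        constructor
        · by_contra hc
          have hc' : U - r * V ≤ -V := by omega
          nlinarith
        · by_contra hc
          have hc' : V ≤ U - r * V := by omega
          nlinarith
      have hlt2 : (U - r * V).natAbs < m := by
        have e1 : ((U - r * V).natAbs : ℤ) = |U - r * V| := Int.natCast_natAbs _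
        have e2 : ((V.natAbs : ℕ) : ℤ) = V := by
          rw [Int.natCast_natAbs]; exact abs_of_nonneg (by linarith)
        rw [hm'] at e2
        have hlt3 : ((U - r * V).natAbs : ℤ) < (m : ℤ) := by rw [e1, e2]; exact hlt
        exact_mod_cast hlt3
      have := ih (U - r * V).natAbs hlt2 ((r ^ 2 + 1) * V - r * U) (U - r * V) (-N) rfl
        (by rw [← h']; ring) (by rw [abs_neg]; exact hN)
      simpa using this

lemma odd_pow_not_sq (p : ℕ) (hp : p.Prime) (k d : ℕ) (hk : Odd k) : p ^ k ≠ d ^ 2 := by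
  intro h
  have h1 : d ∣ p ^ k := ⟨d, by rw [h]; ring⟩
  obtain ⟨j, _, hj⟩ := (Nat.dvd_prime_pow hp).1 h1
  rw [hj, ← pow_mul] at h
  have := Nat.pow_right_injective hp.two_le h
  obtain ⟨t, ht⟩ := hk
  omega

lemma dvd_sub_or_add (p : ℕ) (hp : p.Prime) (hodd : Odd p) (k : ℕ) (X Y : ℤ)
    (hXY : ¬ ((p : ℤ) ∣ X ∧ (p : ℤ) ∣ Y)) (h : (p : ℤ) ^ k ∣ X ^ 2 - Y ^ 2) :
    (p : ℤ) ^ k ∣ X - Y ∨ (p : ℤ) ^ k ∣ X + Y := by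
  have hpi : Prime (p : ℤ) := Nat.prime_iff_prime_int.mp hp
  have h2 : ¬ (p : ℤ) ∣ 2 := by
    intro h2
    have : p ∣ 2 := by exact_mod_cast h2
    have := (Nat.prime_dvd_prime_iff_eq hp Nat.prime_two).1 this
    subst this
    exact absurd hodd (by decide)
  have e : X ^ 2 - Y ^ 2 = (X - Y) * (X + Y) := by ring
  rw [e] at h
  by_cases h1 : (p : ℤ) ∣ X - Y
  · have h3 : ¬ (p : ℤ) ∣ X + Y := by
      intro h3
      apply hXY
      constructor
      · have : (p : ℤ) ∣ 2 * X := by have := dvd_add h1 h3; ring_nf at this ⊢; exact this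
        exact (hpi.dvd_or_dvd this).resolve_left h2
      · have : (p : ℤ) ∣ 2 * Y := by have := dvd_sub h3 h1; ring_nf at this ⊢; exact this
        exact (hpi.dvd_or_dvd this).resolve_left h2
    left
    exact IsCoprime.dvd_of_dvd_mul_right ((Prime.coprime_iff_not_dvd hpi).2 h3).pow_left h
  · right
    exact IsCoprime.dvd_of_dvd_mul_left ((Prime.coprime_iff_not_dvd hpi).2 h1).pow_left h

lemma plus_descent (p : ℕ) (hp : p.Prime) (hodd : Odd p) (c : ℕ) (hc : 0 < c) :
    ∀ (k : ℕ) (X Y N : ℤ), Odd k → N.natAbs = p ^ k →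
      X ^ 2 - (((p : ℤ) ^ c) ^ 2 + 1) * Y ^ 2 = N →
      ¬ ((p : ℤ) ∣ X ∧ (p : ℤ) ∣ Y) → False := by
  intro k
  induction k using Nat.strong_induction_on with
  | _ k ih =>
    intro X Y N hk hN h hXY
    have hp3 : 2 ≤ p := hp.two_le
    have hp0 : (p : ℤ) ≠ 0 := by exact_mod_cast hp.ne_zero
    have hr : (2 : ℤ) ≤ (p : ℤ) ^ c := by
      have : 2 ≤ p ^ c := le_trans hp3 (Nat.le_self_pow hc.ne' p)
      exact_mod_cast this
    have hNabs : |N| = (p : ℤ) ^ k := by rw [Int.abs_eq_natAbs, hN]; push_cast; rfl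
    have small : ∀ (j : ℕ) (X Y N : ℤ), Odd j → j ≤ c → N.natAbs = p ^ j →
        X ^ 2 - (((p : ℤ) ^ c) ^ 2 + 1) * Y ^ 2 = N → False := by
      intro j X Y N hj hjc hN h
      obtain ⟨d, hd⟩ := pell_small _ hr _ X Y N rfl h (by
        rw [Int.abs_eq_natAbs, hN]; push_cast
        exact pow_le_pow_right₀ (by exact_mod_cast hp.one_le) hjc)
      exact odd_pow_not_sq p hp j d hj (hN ▸ hd)
    -- common step
    have step : ∀ e : ℕ, e ≤ k → e ≤ 2 * c → ∃ X1 Y1 : ℤ,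
        (p : ℤ) ^ (2 * e) * (X1 ^ 2 - (((p : ℤ) ^ c) ^ 2 + 1) * Y1 ^ 2) = - (p : ℤ) ^ (2 * c) * N ∧
        (e = 2 * c → ¬ ((p : ℤ) ∣ X1 ∧ (p : ℤ) ∣ Y1)) := by
      intro e he he2
      have hdN : (p : ℤ) ^ e ∣ N := by
        rw [← dvd_abs, hNabs]; exact pow_dvd_pow _ he
      have hdq : (p : ℤ) ^ e ∣ (p : ℤ) ^ (2 * c) := pow_dvd_pow _ he2
      have hq : ((p : ℤ) ^ c) ^ 2 = (p : ℤ) ^ (2 * c) := by rw [← pow_mul, mul_comm]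
      have hd : (p : ℤ) ^ e ∣ X ^ 2 - Y ^ 2 := by
        have : X ^ 2 - Y ^ 2 = N + (p : ℤ) ^ (2 * c) * Y ^ 2 := by rw [← h, ← hq]; ring
        rw [this]
        exact dvd_add hdN (hdq.mul_right _)
      have main : ∀ Y : ℤ, X ^ 2 - (((p : ℤ) ^ c) ^ 2 + 1) * Y ^ 2 = N →
          ¬ ((p : ℤ) ∣ X ∧ (p : ℤ) ∣ Y) → (p : ℤ) ^ e ∣ X - Y → ∃ X1 Y1 : ℤ,
        (p : ℤ) ^ (2 * e) * (X1 ^ 2 - (((p : ℤ) ^ c) ^ 2 + 1) * Y1 ^ 2) = - (p : ℤ) ^ (2 * c) * N ∧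
        (e = 2 * c → ¬ ((p : ℤ) ∣ X1 ∧ (p : ℤ) ∣ Y1)) := by
        intro Y h hXY hd
        obtain ⟨t, ht⟩ := hd
        obtain ⟨w, hw⟩ := hdq
        refine ⟨t - w * Y, -t, ?_, ?_⟩
        · have e1 : (p : ℤ) ^ e * (t - w * Y) = X - (((p : ℤ) ^ c) ^ 2 + 1) * Y := by
            rw [hq, hw]; linear_combination -ht
          have e2 : (p : ℤ) ^ e * (-t) = Y - X := by linear_combination ht
          have : (p : ℤ) ^ (2 * e) * ((t - w * Y) ^ 2 - (((p : ℤ) ^ c) ^ 2 + 1) * (-t) ^ 2)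
            = ((p : ℤ) ^ e * (t - w * Y)) ^ 2 - (((p : ℤ) ^ c) ^ 2 + 1) * ((p : ℤ) ^ e * (-t)) ^ 2 := by
            ring
          rw [this, e1, e2, ← h, ← hq]; ring
        · intro hec ⟨d1, d2⟩
          subst hec
          have hw1 : w = 1 := by
            have : (p : ℤ) ^ (2 * c) ≠ 0 := pow_ne_zero _ hp0
            apply mul_left_cancel₀ this; rw [← hw, mul_one]
          subst hw1
          have d3 : (p : ℤ) ∣ t := (dvd_neg).1 d2
          have d4 : (p : ℤ) ∣ Y := by
            have := dvd_sub d3 d1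
            simpa using this
          apply hXY
          refine ⟨?_, d4⟩
          have : X = (p : ℤ) ^ (2 * c) * t + Y := by linarith
          rw [this]
          exact dvd_add (d3.mul_left _) d4
      rcases dvd_sub_or_add p hp hodd e X Y hXY hd with h1 | h1
      · exact main Y h hXY h1
      · exact main (-Y) (by rw [← h]; ring) (by rwa [dvd_neg]) (by rwa [sub_neg_eq_add])
    by_cases hkc : k ≤ c
    · exact small k X Y N hk hkc hN h
    by_cases hk2 : 2 * c ≤ k
    · obtain ⟨X1, Y1, h1, h2⟩ := step (2 * c) hk2 le_rfl
      have hpc : (p : ℤ) ^ (2 * c) ≠ 0 := pow_ne_zero _ hp0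
      refine ih (k - 2 * c) (by omega) X1 Y1 _ (by
        obtain ⟨t, ht⟩ := hk
        exact ⟨t - c, by omega⟩) ?_ rfl (h2 rfl)
      have h3 : (p : ℤ) ^ (2 * c) * (X1 ^ 2 - (((p : ℤ) ^ c) ^ 2 + 1) * Y1 ^ 2) = - N := by
        apply mul_left_cancel₀ hpc
        rw [← mul_assoc, ← pow_add, ← two_mul, h1]; ring
      have h4 := congrArg Int.natAbs h3
      rw [Int.natAbs_mul, Int.natAbs_neg, hN, Int.natAbs_pow, Int.natAbs_natCast] at h4
      apply Nat.eq_of_mul_eq_mul_left (show 0 < p ^ (2 * c) from pow_pos hp.pos _)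
      rw [h4, ← pow_add]; congr 1; omega
    · obtain ⟨X1, Y1, h1, -⟩ := step k le_rfl (by omega)
      refine small (2 * c - k) X1 Y1 _ ?_ (by omega) ?_ rfl
      · obtain ⟨t, ht⟩ := hk
        exact ⟨c - t - 1, by omega⟩
      have h4 := congrArg Int.natAbs h1
      rw [Int.natAbs_mul, Int.natAbs_mul, Int.natAbs_neg, hN, Int.natAbs_pow, Int.natAbs_pow, Int.natAbs_natCast] at h4
      apply Nat.eq_of_mul_eq_mul_left (show 0 < p ^ (2 * k) from pow_pos hp.pos _)
      rw [h4, ← pow_add, ← pow_add]; congr 1; omega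

lemma plus_case (p a b x : ℕ) (hp : p.Prime) (hodd : Odd p) (hb : 0 < b) (hab : a > b)
    (heq : p ^ a + p ^ b + 1 = x ^ 2) : False := by
  have hp3 : 3 ≤ p := by
    have := hp.two_le
    rcases hodd with ⟨t, ht⟩
    omega
  have hpa : Odd (p ^ a) := hodd.pow
  have hpb : Odd (p ^ b) := hodd.pow
  have hxodd : Odd x := by
    by_contra hx
    rw [Nat.not_odd_iff_even] at hx
    have : Even (x ^ 2) := hx.pow_of_ne_zero (by norm_num)
    rw [← heq] at this
    have := (hpa.add_odd hpb).add_one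
    rw [← Nat.not_even_iff_odd] at this
    contradiction
  -- 2 b ≤ a
  have h2b : 2 * b ≤ a := by
    by_contra hlt
    have hz : ((x : ℤ)) ^ 2 - 1 ^ 2 = (p : ℤ) ^ b * ((p : ℤ) ^ (a - b) + 1) := by
      have : (x : ℤ) ^ 2 = (p : ℤ) ^ a + (p : ℤ) ^ b + 1 := by exact_mod_cast heq.symm
      rw [this, mul_add, ← pow_add, Nat.add_sub_cancel' hab.le]; ring
    have hk : ∃ k : ℤ, (x : ℤ) - 1 = (p : ℤ) ^ b * k ∨ (x : ℤ) + 1 = (p : ℤ) ^ b * k := by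
      rcases dvd_sub_or_add p hp hodd b x 1 (by
        rintro ⟨-, h⟩
        have : p ∣ 1 := by exact_mod_cast h
        have := Nat.le_of_dvd one_pos this
        omega) ⟨_, hz⟩ with ⟨k, hk⟩ | ⟨k, hk⟩
      · exact ⟨k, Or.inl hk⟩
      · exact ⟨k, Or.inr hk⟩
    have hq3 : (3 : ℤ) ≤ (p : ℤ) ^ b := by
      have : 3 ≤ p ^ b := le_trans hp3 (Nat.le_self_pow hb.ne' p)
      exact_mod_cast this
    have hsm : (p : ℤ) ^ (a - b) < (p : ℤ) ^ b := by
      have : p ^ (a - b) < p ^ b := Nat.pow_lt_pow_right (by omega) (by omega)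
      exact_mod_cast this
    have hsp : (0 : ℤ) < (p : ℤ) ^ (a - b) := by positivity
    have hqodd : Odd ((p : ℤ) ^ b) := by exact_mod_cast hpb
    obtain ⟨k, hk⟩ := hk
    have hkev : Even k := by
      rcases hxodd with ⟨t, ht⟩
      have : Even ((p : ℤ) ^ b * k) := by
        rcases hk with hk | hk <;> rw [← hk, ht] <;> push_cast
        · exact ⟨t, by ring⟩
        · exact ⟨t + 1, by ring⟩
      rcases Int.even_mul.1 this with h | h
      · exact absurd h (Int.not_even_iff_odd.2 hqodd)
      · exact h
    obtain ⟨m, hm⟩ := hkev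
    have hm1 : 1 ≤ m := by
      by_contra hm0
      have : (p : ℤ) ^ b * k ≤ 0 := by nlinarith
      have hx1 : (x : ℤ) ^ 2 ≤ 1 := by
        have : (0:ℤ) ≤ x := by positivity
        have : (x : ℤ) ≤ 1 := by rcases hk with hk | hk <;> linarith
        nlinarith
      nlinarith
    have hx2 : 2 * (p : ℤ) ^ b - 1 ≤ x := by
      have : (p : ℤ) ^ b * k ≥ 2 * (p : ℤ) ^ b := by nlinarith
      rcases hk with hk | hk <;> linarith
    nlinarith
  have haodd : Odd a := by
    by_contra hae
    rw [Nat.not_odd_iff_even] at hae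
    obtain ⟨c, hc⟩ := hae
    have hle : p ^ b ≤ p ^ c := Nat.pow_le_pow_right hp.pos (by omega)
    have hpa2 : p ^ a = p ^ c * p ^ c := by rw [hc, pow_add]
    have hb1 : 0 < p ^ b := pow_pos hp.pos _
    rw [hpa2] at heq
    have h1 : p ^ c < x := by
      by_contra h; nlinarith
    nlinarith
  have hbe : Even b := by
    by_contra hbo
    rw [Nat.not_even_iff_odd] at hbo
    obtain ⟨s, hs⟩ := haodd
    obtain ⟨t, ht⟩ := hbo
    obtain ⟨y, hy⟩ := hxodd
    have sq1 : ∀ j, (p ^ j * p ^ j) % 4 = 1 := by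
      intro j
      obtain ⟨z, hz⟩ := (hodd.pow : Odd (p ^ j))
      rw [hz]; ring_nf; omega
    have hpp : ∀ j, (p ^ (2 * j + 1)) % 4 = p % 4 := by
      intro j
      have : p ^ (2 * j + 1) = (p ^ j * p ^ j) * p := by rw [pow_succ, two_mul, pow_add]
      rw [this, Nat.mul_mod, sq1]; simp
    have h1 := hpp s
    have h2 := hpp t
    rw [← hs] at h1
    rw [← ht] at h2
    have h3 : x ^ 2 % 4 = 1 := by rw [hy]; ring_nf; omega
    obtain ⟨z, hz⟩ := hodd
    omega
  obtain ⟨c, hc⟩ := hbe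
  refine plus_descent p hp hodd c (by omega) a x 1 ((p : ℤ) ^ a) haodd ?_ ?_ ?_
  · rw [Int.natAbs_pow, Int.natAbs_natCast]
  · have : (x : ℤ) ^ 2 = (p : ℤ) ^ a + (p : ℤ) ^ b + 1 := by exact_mod_cast heq.symm
    rw [this, hc, pow_add]; ring
  · rintro ⟨-, h⟩
    have : p ∣ 1 := by exact_mod_cast h
    have := Nat.le_of_dvd one_pos this
    omega
/-- coefficients of `(1 + √(-D)) ^ n` -/
def cc (D : ℤ) : ℕ → ℤ × ℤ
  | 0 => (1, 0)
  | n + 1 => ((cc D n).1 - D * (cc D n).2, (cc D n).1 + (cc D n).2)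

lemma cc_add (D : ℤ) (m n : ℕ) :
    (cc D (m + n)).1 = (cc D m).1 * (cc D n).1 - D * ((cc D m).2 * (cc D n).2) ∧
    (cc D (m + n)).2 = (cc D m).1 * (cc D n).2 + (cc D m).2 * (cc D n).1 := by
  induction n with
  | zero => simp [cc]
  | succ n ih =>
    rw [← add_assoc]
    simp only [cc, ih.1, ih.2]
    constructor <;> ring

lemma minus_descent (p : ℕ) (hp : p.Prime) (hodd : Odd p) (b : ℕ) (hb : 0 < b) :
    ∀ (k : ℕ) (X Y : ℤ), X ^ 2 + ((p : ℤ) ^ b - 1) * Y ^ 2 = (p : ℤ) ^ k →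
      ¬ ((p : ℤ) ∣ X ∧ (p : ℤ) ∣ Y) →
      ∃ n, k = b * n ∧ (X = (cc ((p : ℤ) ^ b - 1) n).1 ∨ X = -(cc ((p : ℤ) ^ b - 1) n).1) ∧
        (Y = (cc ((p : ℤ) ^ b - 1) n).2 ∨ Y = -(cc ((p : ℤ) ^ b - 1) n).2) := by
  intro k
  induction k using Nat.strong_induction_on with
  | _ k ih =>
    intro X Y h hXY
    have hp0 : (p : ℤ) ≠ 0 := by exact_mod_cast hp.ne_zero
    have hp3 : 3 ≤ p := by
      have := hp.two_le
      rcases hodd with ⟨t, ht⟩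
      omega
    by_cases hk : k < b
    · have hlt : (p : ℤ) ^ k < (p : ℤ) ^ b - 1 := by
        have h1 : p ^ (k + 1) ≤ p ^ b := Nat.pow_le_pow_right hp.pos hk
        have h2 : 1 ≤ p ^ k := Nat.one_le_pow _ _ hp.pos
        rw [pow_succ] at h1
        have h3 : p ^ k + 1 < p ^ b := by nlinarith
        have : (p : ℤ) ^ k + 1 < (p : ℤ) ^ b := by exact_mod_cast h3
        linarith
      have hk0 : (0 : ℤ) < (p : ℤ) ^ k := by positivity
      have hY : Y = 0 := by
        by_contra hY
        have : 1 ≤ Y ^ 2 := by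
          have := Int.one_le_abs hY
          rw [← sq_abs]; nlinarith
        nlinarith [sq_nonneg X]
      subst hY
      have hX : ¬ (p : ℤ) ∣ X := fun hX => hXY ⟨hX, dvd_zero _⟩
      have hk1 : k = 0 := by
        by_contra hk1
        apply hX
        have : (p : ℤ) ∣ X ^ 2 := by
          have e : X ^ 2 = (p : ℤ) ^ k := by linarith
          rw [e]; exact dvd_pow_self _ hk1
        exact (Nat.prime_iff_prime_int.mp hp).dvd_of_dvd_pow this
      subst hk1
      refine ⟨0, by simp, ?_, by simp [cc]⟩
      have : X ^ 2 = 1 := by simpa using h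
      have h0 : (X - 1) * (X + 1) = 0 := by linarith [(by ring : (X - 1) * (X + 1) = X ^ 2 - 1)]
      simp only [cc]
      rcases mul_eq_zero.1 h0 with h | h
      · left; linarith
      · right; linarith
    · have hk : b ≤ k := by omega
      have hd : (p : ℤ) ^ b ∣ X ^ 2 - Y ^ 2 := by
        have : X ^ 2 - Y ^ 2 = (p : ℤ) ^ k - (p : ℤ) ^ b * Y ^ 2 := by rw [← h]; ring
        rw [this]
        exact dvd_sub (pow_dvd_pow _ hk) (dvd_mul_right _ _)
      have main : ∀ Y : ℤ, X ^ 2 + ((p : ℤ) ^ b - 1) * Y ^ 2 = (p : ℤ) ^ k →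
          ¬ ((p : ℤ) ∣ X ∧ (p : ℤ) ∣ Y) → (p : ℤ) ^ b ∣ X - Y →
        ∃ n, k = b * n ∧ (X = (cc ((p : ℤ) ^ b - 1) n).1 ∨ X = -(cc ((p : ℤ) ^ b - 1) n).1) ∧
        (Y = (cc ((p : ℤ) ^ b - 1) n).2 ∨ Y = -(cc ((p : ℤ) ^ b - 1) n).2) := by
        intro Y h hXY hd
        obtain ⟨t, ht⟩ := hd
        have hpb : (p : ℤ) ^ b ≠ 0 := pow_ne_zero _ hp0
        have hX : X = (t + Y) - ((p : ℤ) ^ b - 1) * (-t) := by linarith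
        have hY : Y = (t + Y) + (-t) := by ring
        have h1 : (t + Y) ^ 2 + ((p : ℤ) ^ b - 1) * (-t) ^ 2 = (p : ℤ) ^ (k - b) := by
          apply mul_left_cancel₀ hpb
          rw [← pow_add, Nat.add_sub_cancel' hk, ← h, show X = Y + (p : ℤ) ^ b * t by linarith]
          ring
        have hbk : 0 < b := hb
        obtain ⟨n, hn, hA, hB⟩ := ih (k - b) (by omega) (t + Y) (-t) h1 (by
          rintro ⟨d1, d2⟩
          apply hXY
          constructor
          · rw [hX]; exact dvd_sub d1 (d2.mul_left _)
          · rw [hY]; exact dvd_add d1 d2)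
        have hkn : k = b * (n + 1) := by rw [mul_add, ← hn]; omega
        have bad : ∀ n X1 Y1 : ℤ, (p : ℤ) ∣ X1 - ((p : ℤ) ^ b - 1) * Y1 → (p : ℤ) ∣ X1 + Y1 →
            t + Y = X1 → -t = Y1 → False := by
          intro n X1 Y1 d1 d2 e1 e2
          apply hXY
          rw [hX, e1, e2]
          refine ⟨d1, ?_⟩
          rw [hY, e1, e2]; exact d2
        have hpd : (p : ℤ) ∣ (p : ℤ) ^ b := dvd_pow_self _ hb.ne'
        generalize hDD : (p : ℤ) ^ b - 1 = D at *
        have hD1 : (p : ℤ) ^ b = D + 1 := by linarith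
        rw [hD1] at hpd
        have opp : ∀ n : ℕ, n ≠ 0 → (p : ℤ) ∣ (cc D n).1 + D * (cc D n).2 ∧
            (p : ℤ) ∣ (cc D n).1 - (cc D n).2 := by
          intro n hn
          obtain ⟨m, rfl⟩ := Nat.exists_eq_succ_of_ne_zero hn
          simp only [cc]
          constructor
          · have e : (cc D m).1 - D * (cc D m).2 + D * ((cc D m).1 + (cc D m).2)
                = (cc D m).1 * (D + 1) := by ring
            rw [e]; exact hpd.mul_left _
          · have e : (cc D m).1 - D * (cc D m).2 - ((cc D m).1 + (cc D m).2)
                = -(cc D m).2 * (D + 1) := by ring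
            rw [e]; exact hpd.mul_left _
        by_cases hn0 : n = 0
        · subst hn0
          refine ⟨1, hkn, ?_⟩
          simp only [cc] at hA hB ⊢
          have hB' : -t = 0 := by rcases hB with h | h <;> simpa using h
          have ht0 : t = 0 := by linarith
          subst ht0
          have hXY' : X = Y := by linarith
          have hYA : Y = 1 ∨ Y = -1 := by
            rcases hA with hA | hA
            · left; linarith
            · right; linarith
          rw [hXY']
          rcases hYA with h | h <;> rw [h] <;> norm_num
        · refine ⟨n + 1, hkn, ?_⟩
          simp only [cc]
          obtain ⟨o1, o2⟩ := opp n hn0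
          rcases hA with hA | hA <;> rcases hB with hB | hB
          · constructor
            · left; rw [hX, hA, hB]
            · left; rw [hY, hA, hB]
          · exfalso
            exact bad 0 _ _ (by rw [mul_neg, sub_neg_eq_add]; exact o1) (by rw [← sub_eq_add_neg]; exact o2) hA hB
          · exfalso
            exact bad 0 _ _ (by rw [← neg_add']; exact dvd_neg.2 o1)
              (by rw [neg_add_eq_sub, ← neg_sub]; exact dvd_neg.2 o2) hA hB
          · constructor
            · right; rw [hX, hA, hB]; ring
            · right; rw [hY, hA, hB]; ring
      rcases dvd_sub_or_add p hp hodd b X Y hXY hd with h1 | h1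
      · exact main Y h hXY h1
      · obtain ⟨n, hn, hA, hB⟩ := main (-Y) (by rw [← h]; ring) (by rwa [dvd_neg])
          (by rwa [sub_neg_eq_add])
        refine ⟨n, hn, hA, ?_⟩
        rcases hB with hB | hB
        · right; linarith
        · left; linarith

lemma cc_mod_D (D : ℤ) (n : ℕ) : D ∣ (cc D n).1 - 1 ∧ D ∣ (cc D n).2 - n := by
  induction n with
  | zero => simp [cc]
  | succ n ih =>
    simp only [cc]
    obtain ⟨⟨s, hs⟩, t, ht⟩ := ih
    exact ⟨⟨s - (cc D n).2, by linear_combination hs⟩, ⟨s + t, by push_cast; linear_combination hs + ht⟩⟩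

lemma cc_mod_q (D : ℤ) (n : ℕ) : D + 1 ∣ (cc D (n + 1)).1 - 2 ^ n ∧ D + 1 ∣ (cc D (n + 1)).2 - 2 ^ n := by
  induction n with
  | zero => simp [cc]
  | succ n ih =>
    rw [cc]
    generalize cc D (n + 1) = u at *
    obtain ⟨⟨s, hs⟩, t, ht⟩ := ih
    exact ⟨⟨s + t - u.2, by simp only []; rw [pow_succ]; linear_combination hs + ht⟩,
      ⟨s + t, by simp only []; rw [pow_succ]; linear_combination hs + ht⟩⟩

lemma cc_sum (D : ℤ) (N : ℕ) :
    ∑ j ∈ Finset.range (N + 1), (N.choose j : ℤ) * (-D) ^ (j / 2) = (cc D N).1 + (cc D N).2 ∧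
    ∑ j ∈ Finset.range (N + 1), (N.choose j : ℤ) * (-D) ^ ((j + 1) / 2)
      = (cc D N).1 - D * (cc D N).2 := by
  induction N with
  | zero => simp [cc]
  | succ N ih =>
    have pascal : ∀ e : ℕ → ℤ, ∑ j ∈ Finset.range (N + 1 + 1), ((N + 1).choose j : ℤ) * e j
        = ∑ j ∈ Finset.range (N + 1), (N.choose j : ℤ) * e j
          + ∑ j ∈ Finset.range (N + 1), (N.choose j : ℤ) * e (j + 1) := by
      intro e
      rw [Finset.sum_range_succ']
      simp only [Nat.choose_succ_succ, Nat.cast_add, add_mul, Finset.sum_add_distrib]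
      have h := Finset.sum_range_succ' (fun j => (N.choose j : ℤ) * e j) (N + 1)
      rw [Finset.sum_range_succ] at h
      simp at h ⊢
      linarith
    have h2 : ∑ j ∈ Finset.range (N + 1), (N.choose j : ℤ) * (-D) ^ ((j + 1 + 1) / 2)
        = -D * ((cc D N).1 + (cc D N).2) := by
      rw [← ih.1, Finset.mul_sum]
      refine Finset.sum_congr rfl fun j _ => ?_
      rw [show (j + 1 + 1) / 2 = j / 2 + 1 by omega, pow_succ]; ring
    constructor
    · rw [pascal (fun j => (-D) ^ (j / 2)), ih.1, ih.2]
      simp only [cc]; ring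
    · rw [pascal (fun j => (-D) ^ ((j + 1) / 2)), ih.2, h2]
      simp only [cc]; ring

lemma radic (r D N : ℕ) (hr : r.Prime) (hN : 0 < N)
    (H : ∀ j, 2 ≤ j → r ^ (j.factorization r + 1) ∣ D ^ (j / 2)) :
    (cc (D : ℤ) (N + 1)).2 ≠ 1 := by
  intro h
  simp only [cc] at h
  rw [← (cc_sum D N).1, Finset.sum_range_succ'] at h
  obtain ⟨N', rfl⟩ := Nat.exists_eq_succ_of_ne_zero hN.ne'
  rw [Finset.sum_range_succ'] at h
  set s := (N' + 1).factorization r with hs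
  have hsN : r ^ s ∣ N' + 1 := Nat.ordProj_dvd _ _
  have hterm : ∀ j, 2 ≤ j → (r : ℤ) ^ (s + 1) ∣ ((N' + 1).choose j : ℤ) * (-(D : ℤ)) ^ (j / 2) := by
    intro j hj
    have h1 : r ^ (s + 1) ∣ (N' + 1).choose j * D ^ (j / 2) := by
      obtain ⟨E, hE⟩ := H j hj
      rw [hE]
      obtain ⟨i, rfl⟩ := Nat.exists_eq_succ_of_ne_zero (show j ≠ 0 by omega)
      have h2 : r ^ s ∣ (N' + 1).choose (i + 1) * (i + 1) := by
        rw [← Nat.add_one_mul_choose_eq]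
        exact hsN.mul_right _
      set v := (i + 1).factorization r with hv
      have h3 : (i + 1) = r ^ v * ((i + 1) / r ^ v) := (Nat.ordProj_mul_ordCompl_eq_self _ _).symm
      have hcop : Nat.Coprime (r ^ s) ((i + 1) / r ^ v) :=
        (Nat.coprime_ordCompl hr (by omega)).pow_left _
      have h4 : r ^ s ∣ (N' + 1).choose (i + 1) * r ^ v := by
        rw [h3, ← mul_assoc, ← h3] at h2
        exact hcop.dvd_of_dvd_mul_right h2
      have : (N' + 1).choose (i + 1) * (r ^ (v + 1) * E)
          = ((N' + 1).choose (i + 1) * r ^ v) * r * E := by ring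
      rw [Nat.succ_eq_add_one, this, pow_succ]
      exact (Nat.mul_dvd_mul_right h4 r).mul_right _
    rw [neg_pow, mul_left_comm]
    apply Dvd.dvd.mul_left
    exact_mod_cast h1
  have hsum : (r : ℤ) ^ (s + 1) ∣ ∑ k ∈ Finset.range N',
      ((N' + 1).choose (k + 1 + 1) : ℤ) * (-(D : ℤ)) ^ ((k + 1 + 1) / 2) :=
    Finset.dvd_sum fun k _ => hterm _ (by omega)
  obtain ⟨w, hw⟩ := hsum
  simp only [Nat.succ_eq_add_one] at h
  rw [hw] at h
  have h5 : (r : ℤ) ^ (s + 1) ∣ ((N' + 1 : ℕ) : ℤ) := by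
    refine ⟨-w, ?_⟩
    norm_num at h
    push_cast
    linarith
  have h6 : r ^ (s + 1) ∣ N' + 1 := by exact_mod_cast h5
  exact Nat.pow_succ_factorization_not_dvd (by omega) hr h6

lemma D_dvd_six (D N : ℕ) (hD : 0 < D) (hN : 0 < N) (h : (cc (D : ℤ) (N + 1)).2 = 1) :
    D ∣ 6 := by
  have hfac : ∀ r j : ℕ, 2 ≤ j → r ^ (j.factorization r) ≤ j := fun r j hj =>
    Nat.le_of_dvd (by omega) (Nat.ordProj_dvd _ _)
  have gen : ∀ r e v j : ℕ, r ^ e ∣ D → v + 1 ≤ e * (j / 2) → r ^ (v + 1) ∣ D ^ (j / 2) := by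
    intro r e v j h1 h2
    calc r ^ (v + 1) ∣ r ^ (e * (j / 2)) := pow_dvd_pow _ h2
      _ = (r ^ e) ^ (j / 2) := pow_mul _ _ _
      _ ∣ D ^ (j / 2) := pow_dvd_pow_of_dvd h1 _
  have h5 : ∀ r, r.Prime → r ∣ D → r < 5 := by
    intro r hr hrD
    by_contra hc
    refine radic r D N hr hN (fun j hj => ?_) h
    apply gen r 1 _ _ (by simpa using hrD)
    have h1 := hfac r j hj
    have h2 : 5 ^ (j.factorization r) ≤ j := le_trans (Nat.pow_le_pow_left (by omega) _) h1
    have h3 : ∀ v : ℕ, v = 0 ∨ 2 * v + 3 ≤ 5 ^ v := by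
      intro v
      induction v with
      | zero => left; rfl
      | succ v ih => right; rcases ih with rfl | ih <;> [norm_num; (rw [pow_succ]; omega)]
    rcases h3 (j.factorization r) with h | h <;> omega
  have h9 : ¬ 3 ^ 2 ∣ D := by
    intro hd
    refine radic 3 D N Nat.prime_three hN (fun j hj => ?_) h
    apply gen 3 2 _ _ hd
    have h1 := hfac 3 j hj
    have h3 : ∀ v : ℕ, v = 0 ∨ v + 2 ≤ 3 ^ v := by
      intro v
      induction v with
      | zero => left; rfl
      | succ v ih => right; rcases ih with rfl | ih <;> [norm_num; (rw [pow_succ]; omega)]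
    rcases h3 (j.factorization 3) with h | h <;> omega
  have h4 : ¬ 2 ^ 2 ∣ D := by
    intro hd
    refine radic 2 D N Nat.prime_two hN (fun j hj => ?_) h
    apply gen 2 2 _ _ hd
    have h1 := hfac 2 j hj
    have h3 : ∀ v : ℕ, v ≤ 1 ∨ v + 2 ≤ 2 ^ v := by
      intro v
      induction v with
      | zero => left; omega
      | succ v ih =>
        rcases Nat.lt_or_ge v 1 with h | h
        · left; omega
        · right
          rcases ih with ih | ih
          · obtain rfl : v = 1 := by omega
            norm_num
          · rw [pow_succ]; omega
    rcases h3 (j.factorization 2) with h | h <;> omega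
  have hsq : Squarefree D := by
    rw [Nat.squarefree_iff_prime_squarefree]
    intro r hr hrr
    have := h5 r hr (dvd_trans (dvd_mul_right _ _) hrr)
    have h2 := hr.two_le
    interval_cases r
    · exact h4 (by simpa using hrr)
    · exact h9 (by simpa using hrr)
    · exact absurd hr (by norm_num)
  rw [← Nat.prod_primeFactors_of_squarefree hsq]
  have hsub : D.primeFactors ⊆ {2, 3} := by
    intro r hr
    have hr' := Nat.prime_of_mem_primeFactors hr
    have := h5 r hr' (Nat.dvd_of_mem_primeFactors hr)
    have h2 := hr'.two_le
    interval_cases r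
    · simp
    · simp
    · exact absurd hr' (by norm_num)
  have := Finset.prod_dvd_prod_of_subset D.primeFactors {2, 3} (fun p => p) hsub
  simpa using this

/-- 2-adic behaviour -/
lemma two_adic (D : ℤ) (c : ℕ) (h : (4 ∣ D ∧ c = 1) ∨ (4 ∣ D - 2 ∧ c = 4)) :
    ∀ k : ℕ, 0 < k → ∃ s : ℕ, (s = 0 → 4 ∣ D) ∧ (2 : ℤ) ^ (s + 1) ∣ (cc D (c * k)).1 - 1 ∧
      (2 : ℤ) ^ s ∣ (cc D (c * k)).2 ∧ ¬ (2 : ℤ) ^ (s + 1) ∣ (cc D (c * k)).2 := by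
  intro k
  have hD2 : 2 ∣ D := by omega
  induction k using Nat.strong_induction_on with
  | _ k ih =>
    intro hk
    rcases Nat.even_or_odd k with ⟨m, hm⟩ | hko
    · obtain ⟨s, h0, h1, h2, h3⟩ := ih m (by omega) (by omega)
      have hadd := cc_add D (c * m) (c * m)
      rw [← mul_add, ← hm] at hadd
      generalize cc D (c * m) = u at *
      rw [hadd.1, hadd.2]
      obtain ⟨A, B⟩ := u
      simp only at *
      obtain ⟨α, hα⟩ := h1
      obtain ⟨β, hβ⟩ := h2
      have hA : A = 1 + 2 ^ (s + 1) * α := by linarith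
      have hβo : ¬ 2 ∣ β := by
        rintro ⟨γ, rfl⟩
        exact h3 ⟨γ, by rw [hβ]; ring⟩
      refine ⟨s + 1, by simp, ?_, ?_, ?_⟩
      · have hDB : (2 : ℤ) ^ (s + 2) ∣ D * (B * B) := by
          rw [hβ]
          rcases Nat.eq_zero_or_pos s with rfl | hs
          · obtain ⟨e, he⟩ := h0 rfl
            exact ⟨e * (β * β), by rw [he]; ring⟩
          · obtain ⟨e, he⟩ := hD2
            obtain ⟨s', rfl⟩ := Nat.exists_eq_succ_of_ne_zero hs.ne'
            exact ⟨e * β * β * 2 ^ s', by rw [he, Nat.succ_eq_add_one]; ring⟩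
        have : A * A - D * (B * B) - 1 = 2 ^ (s + 2) * (α + 2 ^ s * α * α) - D * (B * B) := by
          rw [hA]; ring
        rw [this]
        exact dvd_sub (dvd_mul_right _ _) hDB
      · exact ⟨A * β, by rw [hβ]; ring⟩
      · rintro ⟨γ, hγ⟩
        have hp : (2 : ℤ) ^ (s + 1) ≠ 0 := by positivity
        have : A * β = 2 * γ := by
          apply mul_left_cancel₀ hp
          linear_combination hγ - 2 * A * hβ
        apply hβo
        rw [hA] at this
        exact ⟨γ - 2 ^ s * α * β, by linear_combination this⟩
    · rcases h with ⟨h4, rfl⟩ | ⟨h4, rfl⟩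
      · refine ⟨0, fun _ => h4, ?_, by simp, ?_⟩
        · have := (cc_mod_D D (1 * k)).1
          simpa using dvd_trans hD2 this
        · have := dvd_trans hD2 (cc_mod_D D (1 * k)).2
          obtain ⟨t, ht⟩ := hko
          rw [ht] at this ⊢
          push_cast at this
          rw [zero_add, pow_one]
          omega
      · have key : ∀ m : ℕ, 8 ∣ (cc D (4 * m)).1 - 1 ∧ 8 ∣ (cc D (4 * m)).2 - 4 * m := by
          intro m
          induction m with
          | zero => simp [cc]
          | succ m ihm =>
            have hadd := cc_add D (4 * m) 4
            rw [show 4 * (m + 1) = 4 * m + 4 by ring, hadd.1, hadd.2]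
            generalize cc D (4 * m) = u at *
            obtain ⟨⟨s, hs⟩, t, ht⟩ := ihm
            obtain ⟨e, he⟩ := h4
            obtain ⟨A, B⟩ := u
            simp only at *
            have hA : A = 1 + 8 * s := by linarith
            have hB : B = 4 * m + 8 * t := by linarith
            have hD : D = 2 + 4 * e := by linarith
            subst hA hB hD
            simp only [cc]
            push_cast
            constructor
            · ring_nf
              omega
            · ring_nf
              omega
        refine ⟨2, by simp, ?_, ?_, ?_⟩
        · simpa using (key k).1
        · have := (key k).2; norm_num; omega
        · have := (key k).2
          obtain ⟨t, ht⟩ := hko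
          rw [ht] at this ⊢
          norm_num at this ⊢
          omega

lemma two_adic' (D : ℤ) (c : ℕ) (h : (4 ∣ D ∧ c = 1) ∨ (4 ∣ D - 2 ∧ c = 4)) (k : ℕ) (hk : 0 < k)
    (e : ℤ) (heq : (cc D (c * k)).1 - 1 = (2 * e + 1) * (cc D (c * k)).2) : False := by
  obtain ⟨s, -, h1, h2, h3⟩ := two_adic D c h k hk
  rw [heq] at h1
  apply h3
  refine IsCoprime.dvd_of_dvd_mul_left (IsCoprime.pow_left ?_) h1
  exact ⟨-e, 1, by ring⟩
open PowerSeries in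
/-- generating function of the central binomial coefficients -/
noncomputable def WW : PowerSeries ℤ := PowerSeries.mk fun k => (Nat.centralBinom k : ℤ)

/-- `W (1 - 4 X) ^ N` -/
noncomputable def hs (N : ℕ) : PowerSeries ℤ := WW * (1 - 4 * PowerSeries.X) ^ N

/-- its coefficients -/
noncomputable def hc (N k : ℕ) : ℤ := PowerSeries.coeff k (hs N)

open PowerSeries in
lemma coeff_ode (F : PowerSeries ℤ) (k : ℕ) :
    coeff k ((1 - 4 * X) * derivative ℤ F)
      = (k + 1) * coeff (k + 1) F - 4 * k * coeff k F := by
  have e : (1 - 4 * X) * derivative ℤ F = derivative ℤ F - 4 • (X * derivative ℤ F) := by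
    rw [nsmul_eq_mul]; push_cast; ring
  rw [e, map_sub, map_nsmul, coeff_derivative]
  cases k with
  | zero => simp
  | succ k => rw [coeff_succ_X_mul, coeff_derivative]; simp; ring

open PowerSeries in
lemma WW_ode : (1 - 4 * X) * derivative ℤ WW = 2 * WW := by
  ext k
  rw [coeff_ode, show (2 : PowerSeries ℤ) * WW = 2 • WW by rw [nsmul_eq_mul]; push_cast; rfl, map_nsmul]
  simp only [WW, coeff_mk]
  have := Nat.succ_mul_centralBinom_succ k
  zify at this
  rw [nsmul_eq_mul]
  push_cast
  linear_combination this

open PowerSeries in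
lemma deriv_lin : derivative ℤ (1 - 4 * X : PowerSeries ℤ) = -4 := by
  have e : (1 - 4 * X : PowerSeries ℤ) = 1 - 4 • X := by rw [nsmul_eq_mul]; push_cast; rfl
  rw [e, map_sub, map_nsmul]
  simp [derivative_X]

open PowerSeries in
lemma WW_sq : WW ^ 2 * (1 - 4 * X) = 1 := by
  apply PowerSeries.derivative.ext (R := ℤ)
  · rw [Derivation.leibniz, Derivation.leibniz_pow, deriv_lin]
    simp only [smul_eq_mul, nsmul_eq_mul]
    have := WW_ode
    simp
    linear_combination 2 * WW * this
  · simp [WW]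

open PowerSeries in
lemma hs_ode (N : ℕ) : (1 - 4 * X) * derivative ℤ (hs N) = (2 - 4 * (N : PowerSeries ℤ)) * hs N := by
  cases N with
  | zero => simp [hs, WW_ode]
  | succ N =>
    rw [hs, Derivation.leibniz, Derivation.leibniz_pow, deriv_lin]
    simp only [smul_eq_mul, nsmul_eq_mul, Nat.add_sub_cancel]
    have := WW_ode
    push_cast
    linear_combination (1 - 4 * X) ^ (N + 1) * this

lemma hc_zero (N : ℕ) : hc N 0 = 1 := by simp [hc, hs, WW]

lemma hc_succ (N k : ℕ) : ((k : ℤ) + 1) * hc N (k + 1) = (4 * k + 2 - 4 * N) * hc N k := by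
  have h := congrArg (PowerSeries.coeff k) (hs_ode N)
  rw [coeff_ode] at h
  have e : ((2 : PowerSeries ℤ) - 4 * N) * hs N = (2 - 4 * (N : ℤ)) • hs N := by
    rw [zsmul_eq_mul]; push_cast; rfl
  rw [e, map_zsmul, smul_eq_mul] at h
  unfold hc
  linear_combination h

lemma hc_mul (m i j : ℕ) :
    ((i + j).choose i : ℤ) * hc (i + m) (i + j) = hc (i + m) i * hc m j := by
  induction j with
  | zero => simp [hc_zero]
  | succ j ih =>
    have h1 := hc_succ (i + m) (i + j)
    have h2 := hc_succ m j
    have h3 : ((i + (j + 1)).choose i : ℤ) * (j + 1) = (i + j + 1) * (i + j).choose i := by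
      have := Nat.add_one_mul_choose_eq (i + j) j
      have e1 : (i + j).choose j = (i + j).choose i := Nat.choose_symm_add.symm
      have e2 : (i + j).succ.choose j.succ = (i + (j + 1)).choose i :=
        (Nat.choose_symm_add (a := i) (b := j + 1)).symm
      rw [e1, e2] at this
      zify at this
      rw [← this]
    have hj : ((j : ℤ) + 1) ≠ 0 := by positivity
    apply mul_left_cancel₀ hj
    push_cast at h1
    rw [← add_assoc]
    rw [← add_assoc] at h3
    linear_combination (hc (i + m) (i + j + 1)) * h3 + ((i + j).choose i : ℤ) * h1 + (4 * j + 2 - 4 * m) * ih - hc (i + m) i * h2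

lemma alt_sum (L k : ℕ) : ∀ M, k ≤ M + L →
    ∑ i ∈ Finset.range (M + 1), (-1 : ℤ) ^ i * (k.choose i) * ((M + L - i).choose L)
      = ((M + L - k).choose M : ℤ) := by
  induction k with
  | zero =>
    intro M _
    rw [Finset.sum_range_succ']
    simp [Nat.choose_symm_add]
  | succ k ih =>
    intro M hk
    cases M with
    | zero => simp
    | succ M =>
      have h1 := ih (M + 1) (by omega)
      have h2 := ih M (by omega)
      have h3 : (M + 1 + L - k).choose (M + 1) = (M + L - k).choose M + (M + L - k).choose (M + 1) := by
        rw [show M + 1 + L - k = (M + L - k) + 1 by omega, Nat.choose_succ_succ]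
      rw [Finset.sum_range_succ'] at h1 ⊢
      have h4 : ∀ i, (-1 : ℤ) ^ (i + 1) * ((k + 1).choose (i + 1)) * ((M + 1 + L - (i + 1)).choose L)
         = (-1 : ℤ) ^ (i + 1) * (k.choose (i + 1)) * ((M + 1 + L - (i + 1)).choose L) -
           (-1 : ℤ) ^ i * (k.choose i) * ((M + L - i).choose L) := by
        intro i
        rw [Nat.choose_succ_succ, show M + 1 + L - (i + 1) = M + L - i by omega]
        push_cast; ring
      simp only [h4, Finset.sum_sub_distrib, h2]
      rw [show M + 1 + L - (k + 1) = M + L - k by omega]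
      rw [h3] at h1
      push_cast at h1 ⊢
      simp at h1 ⊢
      linarith

/-- the two Padé approximants -/
noncomputable def PB (M L : ℕ) (q : ℤ) : ℤ :=
  ∑ k ∈ Finset.range (L + 1), ((M + L - k).choose M : ℤ) * hc M k * 4 ^ (M - k) * q ^ k

noncomputable def PA (M L : ℕ) (q : ℤ) : ℤ :=
  ∑ i ∈ Finset.range (M + 1), ((-1 : ℤ) ^ i * hc M i * ((M + L - i).choose L)) * 4 ^ (M - i) * q ^ i *
    (1 - q) ^ (M - i)

open PowerSeries in
lemma pade_series (M L k : ℕ) (hk : k < M + L + 1) :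
    coeff k (∑ j ∈ Finset.range (L + 1), C (((M + L - j).choose M : ℤ) * hc M j) * X ^ j) =
    coeff k (∑ i ∈ Finset.range (M + 1), C ((-1 : ℤ) ^ i * hc M i * ((M + L - i).choose L)) *
      X ^ i * hs (M - i)) := by
  simp only [map_sum]
  have h1 : ∀ i ∈ Finset.range (M + 1),
      coeff k (C ((-1 : ℤ) ^ i * hc M i * ((M + L - i).choose L)) * X ^ i * hs (M - i))
      = ((-1 : ℤ) ^ i * (k.choose i) * ((M + L - i).choose L)) * hc M k := by
    intro i hi
    rw [Finset.mem_range] at hi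
    rw [mul_assoc, coeff_C_mul, coeff_X_pow_mul']
    split_ifs with h
    · obtain ⟨j, rfl⟩ := Nat.exists_eq_add_of_le h
      obtain ⟨m, rfl⟩ := Nat.exists_eq_add_of_le (show i ≤ M by omega)
      have := hc_mul m i j
      rw [show i + j - i = j by omega, show i + m - i = m by omega]
      change _ * hc m j = _
      linear_combination -((-1 : ℤ) ^ i * ((i + m + L - i).choose L)) * this
    · rw [Nat.choose_eq_zero_of_lt (show k < i by omega)]; simp
  rw [Finset.sum_congr rfl h1, ← Finset.sum_mul, alt_sum L k M (by omega)]
  simp only [coeff_C_mul, coeff_X_pow]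
  by_cases hkL : k < L + 1
  · rw [Finset.sum_eq_single k]
    · simp
    · intro b _ hb; rw [if_neg (Ne.symm hb)]; simp
    · intro h; exact absurd (Finset.mem_range.2 hkL) h
  · rw [Nat.choose_eq_zero_of_lt (show M + L - k < M by omega), Finset.sum_eq_zero]
    · simp
    · intro b hb
      rw [if_neg]; · simp
      intro h; rw [Finset.mem_range] at hb; omega

/-- truncated evaluation at a nilpotent element -/
noncomputable def ev {R : Type*} [CommRing R] (n : ℕ) (T : R) (hn : 0 < n) (hT : T ^ n = 0) :
    PowerSeries ℤ →+* R where
  toFun F := Polynomial.aeval T (PowerSeries.trunc n F)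
  map_one' := by
    obtain ⟨m, rfl⟩ := Nat.exists_eq_succ_of_ne_zero hn.ne'
    rw [PowerSeries.trunc_one]; simp
  map_zero' := by simp
  map_add' F G := by simp
  map_mul' F G := by
    rw [← map_mul, ← sub_eq_zero, ← map_sub]
    have : (Polynomial.X : Polynomial ℤ) ^ n ∣
        PowerSeries.trunc n (F * G) - PowerSeries.trunc n F * PowerSeries.trunc n G := by
      rw [Polynomial.X_pow_dvd_iff]
      intro d hd
      rw [Polynomial.coeff_sub, sub_eq_zero, PowerSeries.coeff_trunc, if_pos hd,
        PowerSeries.coeff_mul, Polynomial.coeff_mul]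
      refine Finset.sum_congr rfl fun y hy => ?_
      rw [Finset.HasAntidiagonal.mem_antidiagonal] at hy
      rw [PowerSeries.coeff_trunc, PowerSeries.coeff_trunc, if_pos (by omega), if_pos (by omega)]
    obtain ⟨z, hz⟩ := this
    rw [hz, map_mul, map_pow, Polynomial.aeval_X, hT, zero_mul]

lemma ev_congr {R : Type*} [CommRing R] (n : ℕ) (T : R) (hn : 0 < n) (hT : T ^ n = 0)
    (F G : PowerSeries ℤ) (h : ∀ k < n, PowerSeries.coeff k F = PowerSeries.coeff k G) :
    ev n T hn hT F = ev n T hn hT G := by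
  change Polynomial.aeval T _ = Polynomial.aeval T _
  congr 1
  ext k
  rw [PowerSeries.coeff_trunc, PowerSeries.coeff_trunc]
  split_ifs with hk
  · exact h k hk
  · rfl

lemma ev_X {R : Type*} [CommRing R] (n : ℕ) (T : R) (hn : 0 < n) (hT : T ^ n = 0) (h2 : 2 ≤ n) :
    ev n T hn hT PowerSeries.X = T := by
  change Polynomial.aeval T _ = _
  obtain ⟨m, rfl⟩ := Nat.exists_eq_add_of_le' h2
  rw [PowerSeries.trunc_X]; simp

lemma ev_C {R : Type*} [CommRing R] (n : ℕ) (T : R) (hn : 0 < n) (hT : T ^ n = 0) (c : ℤ) :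
    ev n T hn hT (PowerSeries.C c) = c := by
  rw [eq_intCast, map_intCast]

lemma pade_ring {R : Type*} [CommRing R] (M L : ℕ) (hL : 0 < L) (hLM : L ≤ M) (q : ℤ) (T : R)
    (hT : 4 * T = q) (hT0 : T ^ (M + L + 1) = 0) :
    ∃ w : R, w ^ 2 * (1 - q) = 1 ∧ (PB M L q : R) = w * PA M L q := by
  set E := ev (M + L + 1) T (by omega) hT0 with hE
  refine ⟨E WW, ?_, ?_⟩
  · have h := congrArg E WW_sq
    rw [map_mul, map_pow, map_sub, map_mul, map_one, map_ofNat, hE, ev_X _ _ _ _ (by omega), hT] at h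
    exact h
  · have h := ev_congr (M + L + 1) T (by omega) hT0 _ _ (fun k hk => pade_series M L k hk)
    rw [← hE, map_sum, map_sum] at h
    simp only [map_mul, map_pow, hs, map_sub, map_one, map_ofNat] at h
    rw [hE, ev_X _ _ _ _ (by omega), ← hE, hT] at h
    have hCE : ∀ c : ℤ, E (PowerSeries.C c) = c := fun c => ev_C _ _ _ _ _
    have h' := congrArg (fun z => (4 : R) ^ M * z) h
    simp only [Finset.mul_sum] at h'
    unfold PB PA
    push_cast
    rw [Finset.mul_sum]
    refine Eq.trans ?_ (h'.trans ?_)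
    · refine Finset.sum_congr rfl fun k hk => ?_
      rw [Finset.mem_range] at hk
      rw [← hT, show (4 : R) ^ M = 4 ^ (M - k) * 4 ^ k by rw [← pow_add]; congr 1; omega]
      simp only [← map_mul, hCE]
      push_cast
      ring
    · refine Finset.sum_congr rfl fun k hk => ?_
      rw [Finset.mem_range] at hk
      rw [show (4 : R) ^ M = 4 ^ (M - k) * 4 ^ k by rw [← pow_add]; congr 1; omega]
      simp only [← map_mul, ← map_pow, hCE]
      push_cast
      rw [← hT]
      ring

lemma pade_cong (p b M L : ℕ) (hp : p.Prime) (hodd : Odd p) (hb : 0 < b) (hL : 0 < L) (hLM : L ≤ M)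
    (x : ℤ) (hx : x ^ 2 = ((p : ℤ) ^ b) ^ (M + L + 1) - (p : ℤ) ^ b + 1) :
    ((p : ℤ) ^ b) ^ (M + L + 1) ∣ PB M L ((p : ℤ) ^ b) * x - PA M L ((p : ℤ) ^ b) ∨
    ((p : ℤ) ^ b) ^ (M + L + 1) ∣ PB M L ((p : ℤ) ^ b) * x + PA M L ((p : ℤ) ^ b) := by
  set K := b * (M + L + 1) with hK
  have hpK : ((p : ℤ) ^ b) ^ (M + L + 1) = ((p ^ K : ℕ) : ℤ) := by
    rw [← pow_mul]; push_cast; rfl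
  have hcop : Nat.Coprime 4 (p ^ K) := by
    apply Nat.Coprime.pow_right
    have : Nat.Coprime 2 p := (Nat.coprime_two_left).2 hodd
    exact Nat.Coprime.pow_left 2 this
  have hu : (4 : ZMod (p ^ K)) * (4 : ZMod (p ^ K))⁻¹ = 1 := by
    have := ZMod.coe_mul_inv_eq_one 4 hcop
    exact_mod_cast this
  set q : ℤ := (p : ℤ) ^ b with hq
  have hqn : (q : ZMod (p ^ K)) ^ (M + L + 1) = 0 := by
    have : ((q ^ (M + L + 1) : ℤ) : ZMod (p ^ K)) = 0 := by
      rw [hpK, Int.cast_natCast, ZMod.natCast_self]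
    simpa using this
  obtain ⟨w, hw, hBA⟩ := pade_ring (R := ZMod (p ^ K)) M L hL hLM q ((4 : ZMod (p ^ K))⁻¹ * q)
    (by rw [← mul_assoc, hu, one_mul]) (by rw [mul_pow, hqn, mul_zero])
  obtain ⟨v, hv⟩ := ZMod.intCast_surjective (w * (x : ZMod (p ^ K)))
  have hx' : (x : ZMod (p ^ K)) ^ 2 = 1 - q := by
    have := congrArg (Int.cast : ℤ → ZMod (p ^ K)) hx
    push_cast at this
    rw [this, hqn]; ring
  have hv2 : (p : ℤ) ^ K ∣ v ^ 2 - 1 ^ 2 := by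
    have h : ((v ^ 2 - 1 ^ 2 : ℤ) : ZMod (p ^ K)) = 0 := by
      push_cast
      rw [hv, mul_pow, hx', hw]; ring
    rw [ZMod.intCast_zmod_eq_zero_iff_dvd] at h
    exact_mod_cast h
  have hnd : ¬ ((p : ℤ) ∣ v ∧ (p : ℤ) ∣ 1) := by
    rintro ⟨-, h⟩
    exact (Nat.prime_iff_prime_int.mp hp).not_dvd_one h
  have tr : ∀ z : ℤ, (p : ℤ) ^ K ∣ z → (z : ZMod (p ^ K)) = 0 := by
    intro z hz
    rw [ZMod.intCast_zmod_eq_zero_iff_dvd]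
    exact_mod_cast hz
  rw [hpK]
  rcases dvd_sub_or_add p hp hodd K v 1 hnd hv2 with h | h
  · left
    have h := tr _ h
    rw [← ZMod.intCast_zmod_eq_zero_iff_dvd]
    push_cast at h ⊢
    rw [hv] at h
    rw [hBA]
    linear_combination (PA M L q : ZMod (p ^ K)) * h
  · right
    have h := tr _ h
    rw [← ZMod.intCast_zmod_eq_zero_iff_dvd]
    push_cast at h ⊢
    rw [hv] at h
    rw [hBA]
    linear_combination (PA M L q : ZMod (p ^ K)) * h
/-- signed coefficients -/
noncomputable def ee (M i : ℕ) : ℤ := (-1) ^ i * hc M i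

lemma ee_zero (M : ℕ) : ee M 0 = 1 := by simp [ee, hc_zero]

lemma ee_succ (M i : ℕ) : ((i : ℤ) + 1) * ee M (i + 1) = 2 * (2 * (M - i) - 1) * ee M i := by
  have := hc_succ M i
  unfold ee
  rw [pow_succ]
  linear_combination -(-1 : ℤ) ^ i * this

lemma ee_nonneg (M i : ℕ) (h : i ≤ M) : 0 ≤ ee M i := by
  induction i with
  | zero => rw [ee_zero]; norm_num
  | succ i ih =>
    have h1 := ee_succ M i
    have h2 := ih (by omega)
    have h3 : (0 : ℤ) ≤ 2 * (2 * (M - i) - 1) := by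
      have : (i : ℤ) + 1 ≤ M := by exact_mod_cast h
      linarith
    have h4 : (0 : ℤ) ≤ ((i : ℤ) + 1) * ee M (i + 1) := by rw [h1]; positivity
    exact nonneg_of_mul_nonneg_right h4 (by positivity)

lemma choose_rec (M i : ℕ) (h : i ≤ M) :
    ((i : ℤ) + 1) * M.choose (i + 1) = (M - i) * M.choose i := by
  have := Nat.choose_succ_right_eq M i
  zify [h] at this
  linarith

lemma ee_le (M i : ℕ) (h : i ≤ M) : ee M i ≤ 4 ^ i * M.choose i := by
  induction i with
  | zero => rw [ee_zero]; norm_num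
  | succ i ih =>
    have h1 := ee_succ M i
    have h2 := ih (by omega)
    have h5 := ee_nonneg M i (by omega)
    have h3 : (0 : ℤ) ≤ 2 * (2 * (M - i) - 1) := by
      have : (i : ℤ) + 1 ≤ M := by exact_mod_cast h
      linarith
    have h4 := choose_rec M i (by omega)
    have hi : (0 : ℤ) < (i : ℤ) + 1 := by positivity
    refine le_of_mul_le_mul_left ?_ hi
    rw [h1]
    calc (2 * (2 * ((M : ℤ) - i) - 1)) * ee M i ≤ (2 * (2 * ((M : ℤ) - i) - 1)) * (4 ^ i * M.choose i) :=
          mul_le_mul_of_nonneg_left h2 h3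
      _ ≤ (4 * (M - i)) * (4 ^ i * M.choose i) := by
          apply mul_le_mul_of_nonneg_right _ (by positivity)
          linarith
      _ = ((i : ℤ) + 1) * (4 ^ (i + 1) * M.choose (i + 1)) := by
          rw [pow_succ]; linear_combination -4 ^ i * 4 * h4

lemma ee_central (M i : ℕ) (h : i ≤ M) :
    ee M i * (M - i).centralBinom = M.choose i * M.centralBinom := by
  induction i with
  | zero => simp [ee_zero]
  | succ i ih =>
    have h1 := ee_succ M i
    have h2 := ih (by omega)
    have h4 := choose_rec M i (by omega)
    obtain ⟨d, rfl⟩ := Nat.exists_eq_add_of_le h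
    have h5 := Nat.succ_mul_centralBinom_succ d
    rw [show i + 1 + d - i = d + 1 by omega] at h2
    rw [show i + 1 + d - (i + 1) = d by omega]
    zify at h5
    push_cast at h1 h4 h2 h5 ⊢
    have hi : ((i : ℤ) + 1) ≠ 0 := by positivity
    apply mul_left_cancel₀ hi
    linear_combination (d.centralBinom : ℤ) * h1 - ee (i + 1 + d) i * h5 + (d + 1) * h2
      - ((i + 1 + d).centralBinom : ℤ) * h4

lemma ee_top (M : ℕ) : ee M M = M.centralBinom := by
  have := ee_central M M le_rfl
  simpa using this

lemma ee_two (M v j : ℕ) (hj : j ≤ M) (hv : (2 : ℤ) ^ v ∣ M.centralBinom) :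
    (2 : ℤ) ^ v ∣ 2 ^ j * ee M (M - j) := by
  induction j with
  | zero => simpa [ee_top] using hv
  | succ j ih =>
    have h2 := ih (by omega)
    obtain ⟨i, rfl⟩ := Nat.exists_eq_add_of_le' hj
    have h1 := ee_succ (i + (j + 1)) i
    rw [show i + (j + 1) - (j + 1) = i by omega]
    rw [show i + (j + 1) - j = i + 1 by omega] at h2
    have h3 : (2 : ℤ) ^ v ∣ (2 * j + 1) * (2 ^ (j + 1) * ee (i + (j + 1)) i) := by
      have h4 := h2.mul_left ((i : ℤ) + 1)
      have e : (2 * (j : ℤ) + 1) * (2 ^ (j + 1) * ee (i + (j + 1)) i)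
          = ((i : ℤ) + 1) * (2 ^ j * ee (i + (j + 1)) (i + 1)) := by
        push_cast at h1
        rw [pow_succ]
        linear_combination -2 ^ j * h1
      rw [e]; exact h4
    refine IsCoprime.dvd_of_dvd_mul_left (IsCoprime.pow_left ?_) h3
    exact ⟨-j, 1, by ring⟩

lemma PA_eq (M L : ℕ) (q : ℤ) : PA M L q =
    ∑ i ∈ Finset.range (M + 1), (ee M i * ((M + L - i).choose L)) * 4 ^ (M - i) * q ^ i *
    (1 - q) ^ (M - i) := rfl

lemma nonvanish (M L : ℕ) (q x : ℤ) (h4 : 4 ∣ 1 - q) (hM : M = 3 * L + 2) :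
    PB M L q * x - PA M L q ≠ 0 ∧ PB M L q * x + PA M L q ≠ 0 := by
  set v := M.centralBinom.factorization 2 with hv
  have hvd : 2 ^ v ∣ M.centralBinom := Nat.ordProj_dvd _ _
  have hvd' : (2 : ℤ) ^ v ∣ M.centralBinom := by exact_mod_cast hvd
  have hnd : ¬ (2 : ℤ) ^ (v + 1) ∣ M.centralBinom := by
    have := Nat.pow_succ_factorization_not_dvd (Nat.centralBinom_ne_zero M) Nat.prime_two
    intro h
    exact this (by exact_mod_cast h)
  have hvle : 2 ^ v ≤ 2 * M := Nat.pow_factorization_choose_le (by omega)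
  have hv1 : v + 1 ≤ 2 * (M - L) := by
    by_contra hc
    have h1 : 2 ^ (4 * L + 4) ≤ 2 ^ v := Nat.pow_le_pow_right (by norm_num) (by omega)
    have h2 : L < 2 ^ L := Nat.lt_two_pow_self
    have h3 : (2 : ℕ) ^ (4 * L + 4) = 16 * ((2 ^ L) * (2 ^ L) * (2 ^ L) * (2 ^ L)) := by
      rw [← pow_add, ← pow_add, ← pow_add]
      rw [show (16 : ℕ) = 2 ^ 4 by norm_num, ← pow_add]; congr 1; ring
    have h4 : 1 ≤ 2 ^ L := Nat.one_le_two_pow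
    have h5 : 2 ^ L ≤ (2 ^ L) * (2 ^ L) * (2 ^ L) * (2 ^ L) := by
      calc 2 ^ L = 1 * 1 * 1 * 2 ^ L := by ring
        _ ≤ _ := by gcongr
    omega
  have hB : (2 : ℤ) ^ (v + 1) ∣ PB M L q := by
    apply Finset.dvd_sum
    intro k hk
    rw [Finset.mem_range] at hk
    apply Dvd.dvd.mul_right
    apply Dvd.dvd.mul_left
    rw [show (4 : ℤ) = 2 ^ 2 by norm_num, ← pow_mul]
    exact pow_dvd_pow _ (by omega)
  have hA : ¬ (2 : ℤ) ^ (v + 1) ∣ PA M L q := by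
    rw [PA_eq, Finset.sum_range_succ]
    have hs : (2 : ℤ) ^ (v + 1) ∣ ∑ i ∈ Finset.range M, (ee M i * ((M + L - i).choose L)) * 4 ^ (M - i) * q ^ i *
        (1 - q) ^ (M - i) := by
      apply Finset.dvd_sum
      intro i hi
      rw [Finset.mem_range] at hi
      have h1 := ee_two M v (M - i) (by omega) hvd'
      rw [show M - (M - i) = i by omega] at h1
      obtain ⟨c, hc⟩ := h1
      have h2 : (2 : ℤ) ∣ 4 ^ (M - i) := dvd_trans (by norm_num) (dvd_pow_self (4 : ℤ) (by omega : M - i ≠ 0))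
      obtain ⟨d, hd⟩ := h2
      obtain ⟨f, hf⟩ := h4
      have e : (4 : ℤ) ^ (M - i) = 2 ^ (M - i) * 2 ^ (M - i) := by
        rw [← mul_pow]; norm_num
      refine ⟨c * 2 ^ (M - i) * f ^ (M - i) * d * ((M + L - i).choose L) * q ^ i, ?_⟩
      rw [hf, mul_pow, pow_succ]
      calc _ = ((2 ^ (M - i) * ee M i) * 2 ^ (M - i) * f ^ (M - i)) * 4 ^ (M - i) * ((M + L - i).choose L) * q ^ i := by
            rw [e]; ring
        _ = _ := by rw [hc, hd]; ring
    rw [← dvd_iff_dvd_of_dvd_sub (a := (2 : ℤ) ^ (v + 1)) (b := ee M M * ((M + L - M).choose L) * 4 ^ (M - M) * q ^ M * (1 - q) ^ (M - M))]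
    · simp only [Nat.sub_self, pow_zero, mul_one, Nat.add_sub_cancel_left, Nat.choose_self, Nat.cast_one, ee_top]
      intro h
      apply hnd
      refine IsCoprime.dvd_of_dvd_mul_right (IsCoprime.pow_left (IsCoprime.pow_right ?_)) h
      obtain ⟨f, hf⟩ := h4
      exact ⟨2 * f, 1, by linarith⟩
    · rw [← dvd_neg]
      simpa using hs
  constructor
  · intro h
    apply hA
    rw [← sub_eq_zero.1 h]; exact hB.mul_right _
  · intro h
    apply hA
    rw [← neg_eq_of_add_eq_zero_right h, dvd_neg]; exact hB.mul_right _

lemma PA_bound (M L : ℕ) (q : ℤ) (hq : 1 ≤ q) : |PA M L q| ≤ 2 ^ (4 * M + L) * q ^ M := by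
  rw [PA_eq]
  refine (Finset.abs_sum_le_sum_abs _ _).trans ?_
  have h1 : ∀ i ∈ Finset.range (M + 1),
      |(ee M i * ((M + L - i).choose L)) * 4 ^ (M - i) * q ^ i * (1 - q) ^ (M - i)|
      ≤ (2 ^ (M + L) * 4 ^ M * q ^ M) * (M.choose i : ℤ) := by
    intro i hi
    rw [Finset.mem_range] at hi
    have hn := ee_nonneg M i (by omega)
    have hl := ee_le M i (by omega)
    rw [abs_mul, abs_mul, abs_mul, abs_mul, abs_of_nonneg hn, abs_pow, abs_pow, abs_pow,
      abs_of_nonneg (show (0 : ℤ) ≤ 4 by norm_num), abs_of_nonneg (show (0 : ℤ) ≤ q by omega),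
      abs_of_nonneg (show (0 : ℤ) ≤ ((M + L - i).choose L : ℤ) by positivity),
      abs_of_nonpos (show 1 - q ≤ 0 by omega)]
    have hc : ((M + L - i).choose L : ℤ) ≤ 2 ^ (M + L) := by
      have : (M + L - i).choose L ≤ 2 ^ (M + L) :=
        (Nat.choose_le_two_pow _ _).trans (Nat.pow_le_pow_right (by norm_num) (by omega))
      exact_mod_cast this
    calc ee M i * ((M + L - i).choose L) * 4 ^ (M - i) * q ^ i * (-(1 - q)) ^ (M - i)
        ≤ (4 ^ i * M.choose i) * 2 ^ (M + L) * 4 ^ (M - i) * q ^ i * q ^ (M - i) := by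
          gcongr
          · exact pow_nonneg (by omega) _
          · omega
          · omega
      _ = (2 ^ (M + L) * (4 ^ i * 4 ^ (M - i)) * (q ^ i * q ^ (M - i))) * (M.choose i : ℤ) := by ring
      _ = _ := by rw [← pow_add, ← pow_add, show i + (M - i) = M by omega]
  refine (Finset.sum_le_sum h1).trans ?_
  rw [← Finset.mul_sum]
  have h2 : (∑ i ∈ Finset.range (M + 1), (M.choose i : ℤ)) = 2 ^ M := by
    have := Nat.sum_range_choose M
    exact_mod_cast this
  rw [h2, show (4 : ℤ) = 2 ^ 2 by norm_num, ← pow_mul]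
  apply le_of_eq
  rw [show 4 * M + L = (M + L) + 2 * M + M by ring, pow_add, pow_add]
  ring

lemma PB_bound (M L : ℕ) (hLM : L ≤ M) (q : ℤ) (hq : 1 ≤ q) : |PB M L q| ≤ 2 ^ (4 * M + L) * q ^ L := by
  unfold PB
  refine (Finset.abs_sum_le_sum_abs _ _).trans ?_
  have h1 : ∀ i ∈ Finset.range (L + 1),
      |((M + L - i).choose M : ℤ) * hc M i * 4 ^ (M - i) * q ^ i|
      ≤ (2 ^ (M + L) * 4 ^ M * q ^ L) * (M.choose i : ℤ) := by
    intro i hi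
    rw [Finset.mem_range] at hi
    have hn := ee_nonneg M i (by omega)
    have hl := ee_le M i (by omega)
    have he : |hc M i| = ee M i := by
      rw [← abs_of_nonneg hn, ee, abs_mul, abs_pow]; simp
    rw [abs_mul, abs_mul, abs_mul, he, abs_pow, abs_pow,
      abs_of_nonneg (show (0 : ℤ) ≤ 4 by norm_num), abs_of_nonneg (show (0 : ℤ) ≤ q by omega),
      abs_of_nonneg (show (0 : ℤ) ≤ ((M + L - i).choose M : ℤ) by positivity)]
    have hc : ((M + L - i).choose M : ℤ) ≤ 2 ^ (M + L) := by
      have : (M + L - i).choose M ≤ 2 ^ (M + L) :=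
        (Nat.choose_le_two_pow _ _).trans (Nat.pow_le_pow_right (by norm_num) (by omega))
      exact_mod_cast this
    have hqi : q ^ i ≤ q ^ L := pow_le_pow_right₀ hq (by omega)
    calc ((M + L - i).choose M : ℤ) * ee M i * 4 ^ (M - i) * q ^ i
        ≤ 2 ^ (M + L) * (4 ^ i * M.choose i) * 4 ^ (M - i) * q ^ L := by
          gcongr
      _ = (2 ^ (M + L) * (4 ^ i * 4 ^ (M - i)) * q ^ L) * (M.choose i : ℤ) := by ring
      _ = _ := by rw [← pow_add, show i + (M - i) = M by omega]
  refine (Finset.sum_le_sum h1).trans ?_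
  rw [← Finset.mul_sum]
  have h2 : (∑ i ∈ Finset.range (L + 1), (M.choose i : ℤ)) ≤ 2 ^ M := by
    have h3 : (∑ i ∈ Finset.range (M + 1), (M.choose i : ℤ)) = 2 ^ M := by
      have := Nat.sum_range_choose M
      exact_mod_cast this
    rw [← h3]
    apply Finset.sum_le_sum_of_subset_of_nonneg
    · intro i; simp only [Finset.mem_range]; omega
    · intros; positivity
  calc _ ≤ (2 ^ (M + L) * 4 ^ M * q ^ L) * 2 ^ M := mul_le_mul_of_nonneg_left h2 (by positivity)
    _ = _ := by
      rw [show (4 : ℤ) = 2 ^ 2 by norm_num, ← pow_mul,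
        show 4 * M + L = (M + L) + 2 * M + M by ring, pow_add _ _ M, pow_add _ (M + L)]
      ring

lemma pade_contra (p b L : ℕ) (hp : p.Prime) (hodd : Odd p) (hb : 0 < b) (hL : 0 < L)
    (hbig : (2 : ℤ) ^ 13 ≤ (p : ℤ) ^ b) (h4 : (4 : ℤ) ∣ 1 - (p : ℤ) ^ b) (x : ℤ)
    (hx : x ^ 2 = ((p : ℤ) ^ b) ^ (4 * L + 3) - (p : ℤ) ^ b + 1) : False := by
  have hc := pade_cong p b (3 * L + 2) L hp hodd hb hL (by omega) x
    (by rw [hx, show 3 * L + 2 + L + 1 = 4 * L + 3 by ring])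
  rw [show 3 * L + 2 + L + 1 = 4 * L + 3 by ring] at hc
  generalize (p : ℤ) ^ b = q at *
  have hq1 : 1 ≤ q := le_trans (by norm_num) hbig
  have hn := nonvanish (3 * L + 2) L q x h4 rfl
  have hA := PA_bound (3 * L + 2) L q hq1
  have hB := PB_bound (3 * L + 2) L (by omega) q hq1
  rw [show 4 * (3 * L + 2) + L = 13 * L + 8 by ring] at hA hB
  generalize PA (3 * L + 2) L q = A at *
  generalize PB (3 * L + 2) L q = B at *
  have hA2 : 2 * |A| < q ^ (4 * L + 3) := by
    calc 2 * |A| ≤ 2 * (2 ^ (13 * L + 8) * q ^ (3 * L + 2)) := by linarith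
      _ = 2 ^ (13 * L + 9) * q ^ (3 * L + 2) := by ring
      _ < 2 ^ (13 * (L + 1)) * q ^ (3 * L + 2) := by
          apply mul_lt_mul_of_pos_right _ (by positivity)
          exact pow_lt_pow_right₀ (by norm_num) (by omega)
      _ ≤ q ^ (L + 1) * q ^ (3 * L + 2) := by
          rw [pow_mul]
          gcongr
      _ = q ^ (4 * L + 3) := by rw [← pow_add]; congr 1; ring
  have hB2 : 2 * |B * x| < q ^ (4 * L + 3) := by
    apply lt_of_pow_lt_pow_left₀ 2 (by positivity)
    have hx2 : |x| ^ 2 < q ^ (4 * L + 3) := by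
      rw [sq_abs, hx]
      have : (2 : ℤ) ≤ q := le_trans (by norm_num) hbig
      linarith
    calc (2 * |B * x|) ^ 2 = 4 * |B| ^ 2 * |x| ^ 2 := by rw [abs_mul]; ring
      _ ≤ 4 * (2 ^ (13 * L + 8) * q ^ L) ^ 2 * |x| ^ 2 := by gcongr
      _ ≤ (2 ^ (13 * (2 * L + 3)) * q ^ (2 * L)) * |x| ^ 2 := by
          apply mul_le_mul_of_nonneg_right _ (by positivity)
          calc 4 * (2 ^ (13 * L + 8) * q ^ L) ^ 2 = 2 ^ (26 * L + 18) * q ^ (2 * L) := by ring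
            _ ≤ _ := by
              apply mul_le_mul_of_nonneg_right _ (by positivity)
              exact pow_le_pow_right₀ (by norm_num) (by omega)
      _ ≤ (q ^ (2 * L + 3) * q ^ (2 * L)) * |x| ^ 2 := by
          rw [pow_mul]
          gcongr
      _ = q ^ (4 * L + 3) * |x| ^ 2 := by rw [← pow_add]; congr 2; ring
      _ < q ^ (4 * L + 3) * q ^ (4 * L + 3) := by
          apply mul_lt_mul_of_pos_left hx2 (by positivity)
      _ = _ := by ring
  rcases hc with h | h
  · refine hn.1 (Int.eq_zero_of_abs_lt_dvd h ?_)
    have := abs_sub (B * x) A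
    linarith
  · refine hn.2 (Int.eq_zero_of_abs_lt_dvd h ?_)
    have := abs_add_le (B * x) A
    linarith
lemma cc_period (D m : ℤ) (P : ℕ) (h1 : m ∣ (cc D P).1 - 1) (h2 : m ∣ (cc D P).2) (r k : ℕ) :
    m ∣ (cc D (r + P * k)).1 - (cc D r).1 ∧ m ∣ (cc D (r + P * k)).2 - (cc D r).2 := by
  induction k with
  | zero => simp
  | succ k ih =>
    have h := cc_add D (r + P * k) P
    rw [show r + P * (k + 1) = r + P * k + P by ring, h.1, h.2]
    obtain ⟨⟨s, hs⟩, t, ht⟩ := ih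
    obtain ⟨u, hu⟩ := h1
    obtain ⟨v, hv⟩ := h2
    constructor
    · refine ⟨s + (cc D (r + P * k)).1 * u - D * (cc D (r + P * k)).2 * v, ?_⟩
      linear_combination hs + (cc D (r + P * k)).1 * hu - D * (cc D (r + P * k)).2 * hv
    · refine ⟨t + (cc D (r + P * k)).1 * v + (cc D (r + P * k)).2 * u, ?_⟩
      linear_combination ht + (cc D (r + P * k)).1 * hv + (cc D (r + P * k)).2 * hu

lemma cc_local (D m : ℤ) (P n : ℕ) (hP : 0 < P) (h4 : 4 ∣ P) (hn : n % 4 = 3)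
    (h1 : m ∣ (cc D P).1 - 1) (h2 : m ∣ (cc D P).2)
    (h3 : ∀ r < P, r % 4 = 3 → ¬ m ∣ (cc D r).2 + 1) : (cc D n).2 ≠ -1 := by
  intro h
  have h5 := (cc_period D m P h1 h2 (n % P) (n / P)).2
  rw [Nat.mod_add_div, h] at h5
  refine h3 (n % P) (Nat.mod_lt _ hP) (by rw [Nat.mod_mod_of_dvd _ h4, hn]) ?_
  rw [← dvd_neg, show -((cc D (n % P)).2 + 1) = -1 - (cc D (n % P)).2 by ring]
  exact h5

lemma loc25 (n : ℕ) (hn : n % 4 = 3) : (cc 24 n).2 ≠ -1 :=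
  cc_local 24 11 20 n (by norm_num) (by norm_num) hn (by decide) (by decide) (by decide)

lemma loc125 (n : ℕ) (hn : n % 4 = 3) : (cc 124 n).2 ≠ -1 :=
  cc_local 124 7 12 n (by norm_num) (by norm_num) hn (by decide) (by decide) (by decide)

lemma loc625 (n : ℕ) (hn : n % 4 = 3) : (cc 624 n).2 ≠ -1 :=
  cc_local 624 9 12 n (by norm_num) (by norm_num) hn (by decide) (by decide) (by decide)

lemma loc3125 (n : ℕ) (hn : n % 4 = 3) : (cc 3124 n).2 ≠ -1 :=
  cc_local 3124 17 16 n (by norm_num) (by norm_num) hn (by decide) (by decide) (by decide)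

lemma minus_case (p a b x : ℕ) (hp : p.Prime) (hodd : Odd p) (hb : 0 < b) (hx : 0 < x) (hab : b < a)
    (h : (x : ℤ) ^ 2 + ((p : ℤ) ^ b - 1) * 1 ^ 2 = (p : ℤ) ^ a) :
    (x = 5 ∧ p = 3 ∧ a = 3 ∧ b = 1) ∨ (x = 11 ∧ p = 5 ∧ a = 3 ∧ b = 1) := by
  have hp3 : 3 ≤ p := by
    have := hp.two_le
    rcases hodd with ⟨t, ht⟩
    omega
  obtain ⟨n, hn, -, hY⟩ := minus_descent p hp hodd b hb a x 1 h (by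
    rintro ⟨-, h⟩
    exact (Nat.prime_iff_prime_int.mp hp).not_dvd_one h)
  have hn2 : 2 ≤ n := by
    by_contra hc
    have : n ≤ 1 := by omega
    have : b * n ≤ b * 1 := Nat.mul_le_mul_left _ this
    omega
  have hpb : 3 ≤ p ^ b := hp3.trans (Nat.le_self_pow hb.ne' p)
  obtain ⟨D, hD⟩ : ∃ D, p ^ b = D + 1 := ⟨p ^ b - 1, by omega⟩
  have hDz : (p : ℤ) ^ b - 1 = (D : ℤ) := by
    have : (p : ℤ) ^ b = D + 1 := by exact_mod_cast hD
    linarith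
  have hDe : D % 2 = 0 := by
    have : Odd (p ^ b) := hodd.pow
    rw [hD] at this
    obtain ⟨t, ht⟩ := this
    omega
  rw [hDz] at hY h
  have hmodD := (cc_mod_D D n).2
  have hno : n % 2 = 1 := by
    have h2 : (2 : ℤ) ∣ D := by omega
    have := dvd_trans h2 hmodD
    omega
  have hxeq : (x : ℤ) ^ 2 = ((p : ℤ) ^ b) ^ n - D := by
    rw [← pow_mul, ← hn]; linarith
  rcases hY with hY | hY
  · obtain ⟨N, rfl⟩ : ∃ N, n = N + 1 := ⟨n - 1, by omega⟩
    have h6 := D_dvd_six D N (by omega) (by omega) hY.symm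
    have hD6 : D ≤ 6 := Nat.le_of_dvd (by norm_num) h6
    have hcases : D = 2 ∨ D = 6 := by
      interval_cases D <;> omega
    have case1 : 4 ∣ (D : ℤ) - 2 → N % 4 = 0 → False := by
      intro h4 hN
      obtain ⟨k, rfl⟩ : ∃ k, N = 4 * k := ⟨N / 4, by omega⟩
      simp only [cc] at hY
      refine two_adic' D 4 (Or.inr ⟨h4, rfl⟩) k (by omega) (-1) ?_
      linarith
    rcases hcases with rfl | rfl
    · obtain ⟨rfl, rfl⟩ := (Nat.Prime.pow_eq_iff Nat.prime_three).1 hD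
      by_cases hN : N % 4 = 0
      · exact (case1 (by norm_num) hN).elim
      · obtain ⟨k, rfl⟩ : ∃ k, N = 4 * k + 2 := ⟨N / 4, by omega⟩
        rcases Nat.eq_zero_or_pos k with rfl | hk
        · left
          norm_num at hxeq
          refine ⟨?_, rfl, by omega, rfl⟩
          have : x ^ 2 = 5 ^ 2 := by zify; linarith
          exact Nat.pow_left_injective (by norm_num : (2 : ℕ) ≠ 0) this
        · exfalso
          have hadd := (cc_add ((2 : ℕ) : ℤ) (4 * k) 3).2
          rw [show 4 * k + 3 = 4 * k + 2 + 1 by ring, ← hY] at hadd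
          refine two_adic' ((2 : ℕ) : ℤ) 4 (Or.inr ⟨by norm_num, rfl⟩) k hk 2 ?_
          generalize cc ((2 : ℕ) : ℤ) (4 * k) = u at *
          norm_num [cc] at hadd ⊢
          linarith
    · exfalso
      obtain ⟨rfl, rfl⟩ := (Nat.Prime.pow_eq_iff (by norm_num : Nat.Prime 7)).1 hD
      by_cases hN : N % 4 = 0
      · exact case1 (by norm_num) hN
      · obtain ⟨k, rfl⟩ : ∃ k, N = 4 * k + 2 := ⟨N / 4, by omega⟩
        have h5 := congrArg (Int.cast : ℤ → ZMod 5) hxeq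
        push_cast at h5
        rw [show 4 * k + 2 + 1 = 4 * k + 3 by ring, pow_add, pow_mul,
          show (7 : ZMod 5) ^ 4 = 1 by decide, one_pow] at h5
        generalize (x : ZMod 5) = y at h5
        revert h5
        revert y
        decide
  · have hY' : (cc (D : ℤ) n).2 = -1 := by linarith
    have hDn : D ∣ n + 1 := by
      rw [hY'] at hmodD
      have : (D : ℤ) ∣ ((n + 1 : ℕ) : ℤ) := by
        rw [← dvd_neg, show -((n + 1 : ℕ) : ℤ) = -1 - (n : ℤ) by push_cast; ring]
        exact hmodD
      exact_mod_cast this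
    have hp1 : p - 1 ∣ n + 1 := by
      have h1 : p - 1 ∣ p ^ b - 1 := by simpa using Nat.sub_dvd_pow_sub_pow p 1 b
      rw [hD, Nat.add_sub_cancel] at h1
      exact h1.trans hDn
    have hp5 : p = 5 := by
      obtain ⟨N, rfl⟩ : ∃ N, n = N + 1 := ⟨n - 1, by omega⟩
      have h1 := (cc_mod_q D N).2
      rw [hY'] at h1
      have h2 : (p : ℤ) ∣ -1 - 2 ^ N := by
        refine dvd_trans ?_ h1
        have : (p : ℤ) ^ b = D + 1 := by exact_mod_cast hD
        rw [← this]; exact dvd_pow_self _ hb.ne'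
      have : Fact p.Prime := ⟨hp⟩
      have h3 : ((-1 - 2 ^ N : ℤ) : ZMod p) = 0 := (ZMod.intCast_zmod_eq_zero_iff_dvd _ _).2 h2
      have h4 : (2 : ZMod p) ≠ 0 := by
        intro h
        have : ((2 : ℕ) : ZMod p) = 0 := by exact_mod_cast h
        rw [ZMod.natCast_eq_zero_iff] at this
        have := Nat.le_of_dvd (by norm_num) this
        omega
      have h5 : (2 : ZMod p) ^ (N + 2) = 1 := by
        obtain ⟨c, hc⟩ := hp1
        rw [show N + 2 = N + 1 + 1 by ring, hc, pow_mul, ZMod.pow_card_sub_one_eq_one h4, one_pow]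
      push_cast at h3
      have h6 : ((5 : ℕ) : ZMod p) = 0 := by
        push_cast
        rw [pow_add] at h5
        linear_combination -4 * h3 - h5
      rw [ZMod.natCast_eq_zero_iff] at h6
      exact (Nat.prime_dvd_prime_iff_eq hp (by norm_num)).1 h6
    subst hp5
    have hn4 : n % 4 = 3 := by
      have : 4 ∣ n + 1 := hp1
      omega
    obtain ⟨L, rfl⟩ : ∃ L, n = 4 * L + 3 := ⟨n / 4, by omega⟩
    have h4D : 4 ∣ D := by
      have h1 : 5 - 1 ∣ 5 ^ b - 1 := by simpa using Nat.sub_dvd_pow_sub_pow 5 1 b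
      rw [hD, Nat.add_sub_cancel] at h1
      exact h1
    by_cases hb1 : b = 1
    · subst hb1
      obtain rfl : D = 4 := by omega
      rcases Nat.eq_zero_or_pos L with rfl | hk
      · right
        norm_num at hxeq
        refine ⟨?_, rfl, by omega, rfl⟩
        have : x ^ 2 = 11 ^ 2 := by zify; linarith
        exact Nat.pow_left_injective (by norm_num : (2 : ℕ) ≠ 0) this
      · exfalso
        have hadd := (cc_add ((4 : ℕ) : ℤ) (1 * (4 * L)) 3).2
        rw [one_mul, hY'] at hadd
        refine two_adic' ((4 : ℕ) : ℤ) 1 (Or.inl ⟨by norm_num, rfl⟩) (4 * L) (by omega) (-6) ?_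
        rw [one_mul]
        generalize cc ((4 : ℕ) : ℤ) (4 * L) = u at *
        norm_num [cc] at hadd ⊢
        linarith
    · exfalso
      by_cases hb6 : 6 ≤ b
      · have hLp : 0 < L := by
          by_contra hc
          obtain rfl : L = 0 := by omega
          have h1 : 5 ^ 6 ≤ 5 ^ b := Nat.pow_le_pow_right (by norm_num) hb6
          have := Nat.le_of_dvd (by omega) hDn
          omega
        refine pade_contra 5 b L hp hodd hb hLp ?_ ?_ x ?_
        · calc (2 : ℤ) ^ 13 ≤ 5 ^ 6 := by norm_num
            _ ≤ (5 : ℤ) ^ b := pow_le_pow_right₀ (by norm_num) hb6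
            _ = _ := by push_cast; rfl
        · rw [← dvd_neg, neg_sub, hDz]
          exact_mod_cast h4D
        · rw [hxeq, ← hDz]; ring
      · interval_cases b
        · omega
        · obtain rfl : D = 24 := by omega
          exact loc25 _ hn4 hY'
        · obtain rfl : D = 124 := by omega
          exact loc125 _ hn4 hY'
        · obtain rfl : D = 624 := by omega
          exact loc625 _ hn4 hY'
        · obtain rfl : D = 3124 := by omega
          exact loc3125 _ hn4 hY'

theorem p_pow_pm_p_pow_add_one_eq_sq
    (p a b x : ℕ) (hp : p.Prime) (hodd : Odd p)
    (ha : 0 < a) (hb : 0 < b) (hx : 0 < x) (hab : a > b)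
    (ε : ℤ) (hε : ε = 1 ∨ ε = -1)
    (heq : (p : ℤ) ^ a + ε * (p : ℤ) ^ b + 1 = (x : ℤ) ^ 2) :
    ε = -1 ∧ ((x, p, a, b) = (5, 3, 3, 1) ∨ (x, p, a, b) = (11, 5, 3, 1)) := by
  rcases hε with rfl | rfl
  · exfalso
    have h : p ^ a + p ^ b + 1 = x ^ 2 := by
      zify; linarith
    exact plus_case p a b x hp hodd hb hab h
  · refine ⟨rfl, ?_⟩
    rcases minus_case p a b x hp hodd hb hx hab (by linarith) with ⟨rfl, rfl, rfl, rfl⟩ | ⟨rfl, rfl, rfl, rfl⟩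
    · left; rfl
    · right; rfl
end

section
/- There are no solutions to the equation p^a + p^b + 1 = x^2 in positive integers (x, p, a, b) with a odd and p an odd prime. -/
/-- Pell part: `1 + √d` is not a norm `-1` unit times a square when `d = q ^ 2 + 1`. -/
theorem aux_pell (q d : ℤ) (hq : 1 < q) (hd : d = q ^ 2 + 1) (g e : ℤ√d)
    (he : e.norm = -1) (h : g ^ 2 = -(e * ⟨1, 1⟩)) : False := by
  have hee : (⟨q, 1⟩ : ℤ√d) * ⟨-q, 1⟩ = 1 := by
    ext <;> simp [hd] <;> ring
  have hnorm : (e * ⟨q, 1⟩).norm = 1 := by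
    rw [Zsqrtd.norm_mul, he, Zsqrtd.norm_def]; simp [hd]; ring
  have hfund : Pell.IsFundamental
      (Pell.Solution₁.mk (d := d) (2 * q ^ 2 + 1) (2 * q) (by rw [hd]; ring)) := by
    refine ⟨?_, ?_, ?_⟩
    · simp; nlinarith
    · simp; linarith
    · intro b hb
      simp only [Pell.Solution₁.x_mk]
      have hp := b.prop
      generalize b.x = X at *
      generalize b.y = Y0 at *
      have hY2 : |Y0| ^ 2 = Y0 ^ 2 := sq_abs Y0
      have hY0 : 0 ≤ |Y0| := abs_nonneg _
      rw [← hY2] at hp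
      generalize |Y0| = Y at *
      have hYpos : 0 < Y := by
        rcases hY0.lt_or_eq with h | h
        · exact h
        · subst h; nlinarith
      subst hd
      have h1 : q * Y + 1 ≤ X := by
        by_contra hc
        have : X ≤ q * Y := by linarith
        nlinarith [mul_self_le_mul_self (by linarith : (0:ℤ) ≤ X) this]
      have h2 : 2 * q ≤ Y := by
        have := mul_self_le_mul_self (by positivity : (0:ℤ) ≤ q * Y + 1) h1
        by_contra hc
        have : Y * (2 * q) > Y * Y := by
          apply mul_lt_mul_of_pos_left _ hYpos
          linarith
        nlinarith
      nlinarith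
  have hpow : ∀ (a : Pell.Solution₁ d) (m n : ℤ√d), (a : ℤ√d) = m ^ 2 → m * n = 1 → ∀ k : ℤ,
      ∃ u v : ℤ√d, ((a ^ k : Pell.Solution₁ d) : ℤ√d) = u ^ 2 ∧ u * v = 1 := by
    intro a m n ham hmn k
    have hinv : ((a⁻¹ : Pell.Solution₁ d) : ℤ√d) = n ^ 2 := by
      have h1 : ((a : ℤ√d)) * ((a⁻¹ : Pell.Solution₁ d) : ℤ√d) = 1 := by
        have := congrArg (fun t : Pell.Solution₁ d => (t : ℤ√d)) (mul_inv_cancel a)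
        exact this
      rw [ham] at h1
      generalize ((a⁻¹ : Pell.Solution₁ d) : ℤ√d) = w at *
      linear_combination n ^ 2 * h1 - w * (m * n + 1) * hmn
    have hnat : ∀ (a : Pell.Solution₁ d) (m n : ℤ√d), (a : ℤ√d) = m ^ 2 → m * n = 1 → ∀ k : ℕ,
      ((a ^ k : Pell.Solution₁ d) : ℤ√d) = (m ^ k) ^ 2 ∧ m ^ k * n ^ k = 1 := by
      intro a m n ham hmn k
      constructor
      · have : ((a ^ k : Pell.Solution₁ d) : ℤ√d) = (a : ℤ√d) ^ k := rfl
        rw [this, ham]; ring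
      · rw [← mul_pow, hmn, one_pow]
    obtain ⟨k, rfl | rfl⟩ := k.eq_nat_or_neg
    · exact ⟨_, _, by rw [zpow_natCast]; exact (hnat a m n ham hmn k).1, (hnat a m n ham hmn k).2⟩
    · have := hnat a⁻¹ n m hinv (by rw [mul_comm, hmn]) k
      exact ⟨_, _, by rw [zpow_neg, zpow_natCast, ← inv_pow]; exact this.1, this.2⟩
  obtain ⟨k, hk⟩ := hfund.eq_zpow_or_neg_zpow
    (⟨e * ⟨q, 1⟩, Zsqrtd.norm_eq_one_iff_mem_unitary.1 hnorm⟩ : Pell.Solution₁ d)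
  obtain ⟨u, v, huv, huv1⟩ := hpow (Pell.Solution₁.mk (d := d) (2 * q ^ 2 + 1) (2 * q)
    (by rw [hd]; ring)) ⟨q, 1⟩ ⟨-q, 1⟩ (by
      show (⟨2 * q ^ 2 + 1, 2 * q⟩ : ℤ√d) = _
      rw [sq (⟨q, 1⟩ : ℤ√d), Zsqrtd.ext_iff, Zsqrtd.re_mul, Zsqrtd.im_mul]
      constructor
      · simp only; rw [hd]; ring
      · simp only; ring) hee k
  have hcases : e * ⟨q, 1⟩ = u ^ 2 ∨ e * ⟨q, 1⟩ = - u ^ 2 := by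
    rcases hk with hk | hk
    · left; rw [← huv]; exact congrArg (fun t : Pell.Solution₁ d => (t : ℤ√d)) hk
    · right; rw [← huv]; exact congrArg (fun t : Pell.Solution₁ d => (t : ℤ√d)) hk
  have hprod : (⟨-q, 1⟩ : ℤ√d) * ⟨1, 1⟩ = ⟨d - q, 1 - q⟩ := by
    ext <;> simp <;> ring
  have hfin : (v * g) * (v * g) = -⟨d - q, 1 - q⟩ ∨ (v * g) * (v * g) = ⟨d - q, 1 - q⟩ := by
    rw [← hprod]
    generalize (⟨-q, 1⟩ : ℤ√d) = E' at *
    generalize (⟨q, 1⟩ : ℤ√d) = E at *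
    generalize (⟨1, 1⟩ : ℤ√d) = T at *
    rcases hcases with hc | hc
    · left
      linear_combination v ^ 2 * h - v ^ 2 * E' * T * hc + v ^ 2 * e * T * hee
        - E' * T * (u * v + 1) * huv1
    · right
      linear_combination v ^ 2 * h - v ^ 2 * E' * T * hc + v ^ 2 * e * T * hee
        + E' * T * (u * v + 1) * huv1
  generalize v * g = w at *
  rcases hfin with hf | hf
  · have h1 := congrArg Zsqrtd.re hf
    simp at h1
    nlinarith [mul_self_nonneg w.re, mul_self_nonneg w.im, mul_nonneg (by nlinarith : 0 ≤ d) (mul_self_nonneg w.im)]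
  · have h1 := congrArg Zsqrtd.re hf
    have h2 := congrArg Zsqrtd.im hf
    simp at h1 h2
    have h3 : w.im ≠ 0 := by
      intro h0; rw [h0] at h2; simp at h2; linarith
    have h4 : 1 ≤ w.im * w.im := by
      have : 0 < w.im * w.im := mul_self_pos.2 h3
      linarith
    have := mul_le_mul_of_nonneg_left h4 (by nlinarith : 0 ≤ d)
    nlinarith [mul_self_nonneg w.re]

theorem aux_main (p : ℕ) (hp : p.Prime) (hodd : Odd p) (n j : ℕ) (hn : 0 < n) (x : ℤ)
    (hx1 : (p : ℤ) ∣ x - 1) (h : x ^ 2 = (p : ℤ) ^ (2 * j + 1) + (p : ℤ) ^ (2 * n) + 1) :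
    False := by
  haveI : Fact p.Prime := ⟨hp⟩
  obtain ⟨d, hd⟩ : ∃ d : ℤ, d = ((p : ℤ) ^ n) ^ 2 + 1 := ⟨_, rfl⟩
  have hp0 : (p : ℤ) ≠ 0 := by exact_mod_cast hp.ne_zero
  have h2norm : ‖(2 : ℤ_[p])‖ = 1 := by
    have h1 := PadicInt.norm_int_lt_one_iff_dvd (p := p) 2
    have h3 : ¬ ((p : ℤ) ∣ 2) := by
      intro hh
      have : p ∣ 2 := by exact_mod_cast hh
      rcases (Nat.dvd_prime Nat.prime_two).1 this with h | h
      · exact hp.one_lt.ne' h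
      · subst h; exact absurd hodd (by decide)
    have h4 := PadicInt.norm_le_one (2 : ℤ_[p])
    rw [← h1] at h3
    push_cast at h3
    exact le_antisymm h4 (not_lt.1 h3)
  have h2u : IsUnit (2 : ℤ_[p]) := PadicInt.isUnit_iff.2 h2norm
  -- p-adic square root
  obtain ⟨t, ht, htp⟩ : ∃ t : ℤ_[p], t * t = (d : ℤ_[p]) ∧ (p : ℤ_[p]) ∣ t - 1 := by
    have hF := hensels_lemma (p := p) (R := ℤ_[p])
      (F := Polynomial.X ^ 2 - Polynomial.C (d : ℤ_[p])) (a := 1) (by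
        have h11 : ‖(1 + 1 : ℤ_[p])‖ = 1 := by rw [one_add_one_eq_two, h2norm]
        have hlt : ‖(p : ℤ_[p])‖ < 1 := (PadicInt.norm_lt_one_iff_dvd _).2 dvd_rfl
        have hlt2 : ‖(p : ℤ_[p])‖ ^ n < 1 := pow_lt_one₀ (norm_nonneg _) hlt hn.ne'
        have hlt3 : (‖(p : ℤ_[p])‖ ^ n) ^ 2 < 1 := pow_lt_one₀ (by positivity) hlt2 (by norm_num)
        have e1 : Polynomial.aeval (1 : ℤ_[p]) (Polynomial.X ^ 2 - Polynomial.C (d : ℤ_[p]))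
            = -(((p : ℤ_[p]) ^ n) ^ 2) := by
          simp [hd]
        rw [e1, norm_neg, norm_pow, norm_pow]
        simpa [h11] using hlt3)
    obtain ⟨z, hz, hz1, -⟩ := hF
    refine ⟨z, ?_, ?_⟩
    · simp at hz
      linear_combination hz
    · rw [← PadicInt.norm_lt_one_iff_dvd]
      have h11 : ‖(1 + 1 : ℤ_[p])‖ = 1 := by rw [one_add_one_eq_two, h2norm]
      simpa [h11] using hz1
  have hunit : ∀ y : ℤ_[p], (p : ℤ_[p]) ∣ y - 2 → IsUnit y := by
    intro y hy
    by_contra hc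
    have h1 : ‖y‖ < 1 := PadicInt.mem_nonunits.1 hc
    rw [PadicInt.norm_lt_one_iff_dvd] at h1
    have h3 := dvd_sub h1 hy
    rw [← PadicInt.norm_lt_one_iff_dvd] at h3
    simp [h2norm] at h3
  have hxp : (p : ℤ_[p]) ∣ (x : ℤ_[p]) - 1 := by
    have := (Int.castRingHom ℤ_[p]).map_dvd hx1
    simpa using this
  have htu : IsUnit t := by
    have : IsUnit (t + 1) := hunit _ (by convert htp using 1; ring)
    have h3 : IsUnit (2 * t) := hunit _ (by convert htp.mul_left 2 using 1; ring)
    exact (isUnit_of_mul_isUnit_right h3)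
  have hxt : (p : ℤ_[p]) ^ (2 * j + 1) ∣ (x : ℤ_[p]) - t := by
    have hu : IsUnit ((x : ℤ_[p]) + t) := hunit _ (by convert hxp.add htp using 1; ring)
    rw [← hu.dvd_mul_right]
    have hc : (x : ℤ_[p]) ^ 2 = (p : ℤ_[p]) ^ (2 * j + 1) + (p : ℤ_[p]) ^ (2 * n) + 1 := by
      exact_mod_cast congrArg (Int.cast : ℤ → ℤ_[p]) h
    rw [hd] at ht; push_cast at ht
    exact ⟨1, by linear_combination hc - ht⟩
  have h1t : (p : ℤ_[p]) ^ (2 * n) ∣ 1 - t := by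
    have hu : IsUnit (1 + t) := hunit _ (by convert htp using 1; ring)
    rw [← hu.dvd_mul_right]
    rw [hd] at ht; push_cast at ht
    exact ⟨-1, by linear_combination - ht⟩
  obtain ⟨φ, hφ⟩ : ∃ φ : ℤ√d →+* ℤ_[p], ∀ z, φ z = z.re + z.im * t :=
    ⟨Zsqrtd.lift ⟨t, ht⟩, fun z => rfl⟩
  obtain ⟨ψ, hψ⟩ : ∃ ψ : ℤ√d →+* ℤ_[p], ∀ z, ψ z = z.re + z.im * (-t) :=
    ⟨Zsqrtd.lift ⟨-t, by rw [neg_mul_neg, ht]⟩, fun z => rfl⟩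
  have hdiv : ∀ (z : ℤ√d) (K : ℕ), (p : ℤ_[p]) ^ K ∣ φ z → (p : ℤ_[p]) ^ K ∣ ψ z →
      (((p : ℤ) ^ K : ℤ) : ℤ√d) ∣ z := by
    intro z K h1 h2
    rw [hφ] at h1
    rw [hψ] at h2
    rw [Zsqrtd.intCast_dvd, ← PadicInt.pow_p_dvd_int_iff, ← PadicInt.pow_p_dvd_int_iff]
    constructor
    · rw [← h2u.dvd_mul_left]
      convert h1.add h2 using 1; ring
    · rw [← (h2u.mul htu).dvd_mul_left]
      convert dvd_sub h1 h2 using 1; ring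
  obtain ⟨γ, hγ⟩ := hdiv ((⟨x, 1⟩ : ℤ√d) ^ n * (⟨1, -1⟩ : ℤ√d) ^ j) (2 * n * j) (by
      rw [map_mul, map_pow, map_pow, hφ ⟨1, -1⟩, pow_mul]
      apply Dvd.dvd.mul_left
      apply pow_dvd_pow_of_dvd
      convert h1t using 1; simp; ring) (by
      rw [map_mul, map_pow, map_pow, hψ ⟨x, 1⟩]
      apply Dvd.dvd.mul_right
      refine dvd_trans (pow_dvd_pow _ (by nlinarith : 2 * n * j ≤ (2 * j + 1) * n)) ?_
      rw [pow_mul]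
      apply pow_dvd_pow_of_dvd
      convert hxt using 1; simp; ring)
  have hψγ : (p : ℤ_[p]) ^ n ∣ ψ γ := by
    have h1 := congrArg ψ hγ
    rw [map_mul, map_pow, map_pow, map_mul, hψ ⟨x, 1⟩, map_intCast] at h1
    have h2 : ((p : ℤ_[p]) ^ (2 * j + 1)) ^ n ∣ (p : ℤ_[p]) ^ (2 * n * j) * ψ γ := by
      push_cast at h1
      rw [← h1]
      apply Dvd.dvd.mul_right
      apply pow_dvd_pow_of_dvd
      convert hxt using 1; ring
    rw [← pow_mul, show (2 * j + 1) * n = 2 * n * j + n by ring, pow_add] at h2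
    exact (mul_dvd_mul_iff_left (pow_ne_zero _ (by exact_mod_cast hp.ne_zero))).1 h2
  obtain ⟨η, hη⟩ := hdiv (γ ^ 2 * (⟨1, -1⟩ : ℤ√d)) (2 * n) (by
      rw [map_mul, hφ ⟨1, -1⟩]
      apply Dvd.dvd.mul_left
      convert h1t using 1; simp; ring) (by
      rw [map_mul, map_pow]
      apply Dvd.dvd.mul_right
      rw [mul_comm, pow_mul]
      exact pow_dvd_pow_of_dvd hψγ 2)
  have npow : ∀ (z : ℤ√d) (k : ℕ), (z ^ k).norm = z.norm ^ k :=
    fun z k => map_pow Zsqrtd.normMonoidHom z k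
  have hN1 : (⟨x, 1⟩ : ℤ√d).norm = (p : ℤ) ^ (2 * j + 1) := by
    rw [Zsqrtd.norm_def]; simp only; rw [hd]; linear_combination h
  have hN2 : (⟨1, -1⟩ : ℤ√d).norm = -(p : ℤ) ^ (2 * n) := by
    rw [Zsqrtd.norm_def]; simp only; rw [hd]; ring
  have hNγ : γ.norm ^ 2 = (p : ℤ) ^ (2 * n) := by
    have h1 := congrArg Zsqrtd.norm hγ
    rw [Zsqrtd.norm_mul, Zsqrtd.norm_mul, npow, npow, hN1, hN2, Zsqrtd.norm_intCast] at h1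
    have h2 := congrArg (· ^ 2) h1
    simp only [mul_pow] at h2
    rw [← pow_mul (-_) j 2, mul_comm j 2, pow_mul (-_) 2 j, neg_sq] at h2
    apply mul_left_cancel₀ (pow_ne_zero (8 * n * j) hp0)
    have e1 : (p : ℤ) ^ (8 * n * j) * γ.norm ^ 2 = ((p : ℤ) ^ (2 * n * j)) ^ 2 * ((p : ℤ) ^ (2 * n * j)) ^ 2 * γ.norm ^ 2 := by
      ring
    rw [e1, ← h2]
    ring
  have hNη : η.norm = -1 := by
    have h1 := congrArg Zsqrtd.norm hη
    rw [Zsqrtd.norm_mul, Zsqrtd.norm_mul, npow, hN2, Zsqrtd.norm_intCast, hNγ] at h1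
    have h3 : (p : ℤ) ^ (2 * n) * (p : ℤ) ^ (2 * n) ≠ 0 := by positivity
    apply mul_left_cancel₀ h3
    linear_combination -h1
  refine aux_pell ((p : ℤ) ^ n) d ?_ hd γ η hNη ?_
  · exact_mod_cast Nat.one_lt_pow hn.ne' hp.one_lt
  · have h11 : (⟨1, -1⟩ : ℤ√d) * ⟨1, 1⟩ = -(((p : ℤ) ^ (2 * n) : ℤ) : ℤ√d) := by
      rw [Zsqrtd.intCast_val]
      ext <;> simp [hd]
      ring
    apply Zsqrtd.eq_of_smul_eq_smul_left (pow_ne_zero (2 * n) hp0)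
    linear_combination -(⟨1, 1⟩ : ℤ√d) * hη + γ ^ 2 * h11

theorem no_p_pow_add_p_pow_add_one_eq_sq_of_odd_exponent
    (p a b x : ℕ) (hp : p.Prime) (hodd : Odd p)
    (ha : 0 < a) (hb : 0 < b) (hx : 0 < x) (haodd : Odd a) :
    p ^ a + p ^ b + 1 ≠ x ^ 2 := by
  intro h
  obtain ⟨j, rfl⟩ := haodd
  rcases Nat.even_or_odd b with hbe | hbo
  · obtain ⟨n, rfl⟩ := hbe
    have hz : (x : ℤ) ^ 2 = (p : ℤ) ^ (2 * j + 1) + (p : ℤ) ^ (2 * n) + 1 := by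
      rw [← two_mul] at h
      exact_mod_cast h.symm
    have hdvd : (p : ℤ) ∣ ((x : ℤ) - 1) * (x + 1) := by
      have : ((x : ℤ) - 1) * (x + 1) = (p : ℤ) ^ (2 * j + 1) + (p : ℤ) ^ (2 * n) := by
        linear_combination hz
      rw [this]
      exact dvd_add (dvd_pow_self _ (by omega)) (dvd_pow_self _ (by omega))
    rcases (Nat.prime_iff_prime_int.1 hp).dvd_or_dvd hdvd with h1 | h1
    · exact aux_main p hp hodd n j (by omega) x h1 hz
    · refine aux_main p hp hodd n j (by omega) (-x) ?_ (by rw [neg_sq]; exact hz)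
      rw [← dvd_neg]; convert h1 using 1; ring
  · obtain ⟨k, rfl⟩ := hbo
    have hp4 : p % 4 = 1 ∨ p % 4 = 3 := by
      obtain ⟨m, rfl⟩ := hodd; omega
    have hsq : p ^ 2 ≡ 1 [MOD 4] := by
      unfold Nat.ModEq
      rw [Nat.pow_mod]
      rcases hp4 with h | h <;> rw [h]
    have hpw : ∀ m : ℕ, p ^ (2 * m + 1) ≡ p [MOD 4] := by
      intro m
      rw [pow_succ, pow_mul]
      simpa using (hsq.pow m).mul_right p
    have h1 := hpw j
    have h2 := hpw k
    have h3 : x ^ 2 % 4 = 0 ∨ x ^ 2 % 4 = 1 := by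
      rw [Nat.pow_mod]
      have : x % 4 < 4 := Nat.mod_lt _ (by norm_num)
      interval_cases x % 4 <;> simp
    unfold Nat.ModEq at h1 h2
    omega
end
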